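/- Let n ≥ 1, 1/2 < p < ∞, 1 ≤ p₁ ≤ ∞, 1 < p₂ < ∞ with 1/p = 1/p₁ + 1/p₂, and let 0 ≤ a₁ < ∞, 0 ≤ a₂ ≤ n(p₂ − 1), and a/p = a₁/p₁ + a₂/p₂. If s > max{1, n(1/p − 1)} and s ∉ 2ℕ, then there exists C > 0 such that for all f, g ∈ 𝒮(ℝⁿ): ‖J^s(fg) − f·(J^s g)‖_{L^p_{⟨x⟩^a}} ≤ C ( ‖J^s f‖_{L^{p₁}_{⟨x⟩^{a₁}}} ‖g‖_{L^{p₂}_{⟨x⟩^{a₂}}} + ‖∇f‖_{L^{p₁}_{⟨x⟩^{a₁}}} ‖J^{s−1} g‖_{L^{p₂}_{⟨x⟩^{a₂}}} ). -/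

import Mathlib

open MeasureTheory Real Complex
open scoped ENNReal NNReal RealInnerProductSpace

noncomputable section

abbrev Eu (n : ℕ) := EuclideanSpace ℝ (Fin n)

/-- The polynomial weight `⟨x⟩^a = (1+|x|²)^{a/2}` as an `ℝ≥0∞`-valued function. -/
def jweight {n : ℕ} (a : ℝ) (x : Eu n) : ℝ≥0∞ :=
  ENNReal.ofReal ((1 + ‖x‖ ^ 2) ^ (a / 2))

/-- Weighted Lebesgue (quasi-)norm `‖f‖_{L^p_{⟨x⟩^a}}`; for `p = ∞` the essential sup norm. -/
def wNorm {n : ℕ} {F : Type*} [NormedAddCommGroup F] (p : ℝ≥0∞) (a : ℝ)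
    (f : Eu n → F) : ℝ≥0∞ :=
  if p = ∞ then essSup (fun x => (‖f x‖₊ : ℝ≥0∞)) volume
  else (∫⁻ x, (‖f x‖₊ : ℝ≥0∞) ^ p.toReal * jweight a x) ^ (1 / p.toReal)

/-- The Fourier transform `f̂(ξ) = ∫ f(x) e^{-i x·ξ} dx`. -/
def FT {n : ℕ} (f : Eu n → ℂ) (ξ : Eu n) : ℂ :=
  ∫ x, f x * Complex.exp (-(Complex.I * ((⟪x, ξ⟫ : ℝ) : ℂ)))

/-- The inhomogeneous fractional derivative (Bessel potential) `J^s`. -/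
def Js {n : ℕ} (s : ℝ) (f : Eu n → ℂ) (x : Eu n) : ℂ :=
  ((((2 * Real.pi) ^ n)⁻¹ : ℝ) : ℂ) *
    ∫ ξ, (((1 + ‖ξ‖ ^ 2) ^ (s / 2) : ℝ) : ℂ) * FT f ξ *
      Complex.exp (Complex.I * ((⟪x, ξ⟫ : ℝ) : ℂ))

/-- The Euclidean norm `|∇f|(x)` of the gradient of a complex-valued function. -/
def gradNorm {n : ℕ} (f : Eu n → ℂ) (x : Eu n) : ℝ :=
  Real.sqrt (∑ j : Fin n, ‖fderiv ℝ f x (EuclideanSpace.single j 1)‖ ^ 2)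

/-- The "dot product" of gradients `∇f·∇g = Σ_j (∂_j f)(∂_j g)`. -/
def gradDot {n : ℕ} (f g : Eu n → ℂ) (x : Eu n) : ℂ :=
  ∑ j : Fin n, fderiv ℝ f x (EuclideanSpace.single j 1) *
    fderiv ℝ g x (EuclideanSpace.single j 1)


namespace KP
abbrev Sw (n : ℕ) := SchwartzMap (Eu n) ℂ
theorem rpl {a b : ℝ≥0∞} {z : ℝ} (h : a ≤ b) (hz : 0 ≤ z) : a ^ z ≤ b ^ z := ENNReal.rpow_le_rpow h hz
theorem rpm (x y : ℝ≥0∞) {z : ℝ} (hz : 0 ≤ z) : (x * y) ^ z = x ^ z * y ^ z := ENNReal.mul_rpow_of_nonneg x y hz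
end KP

namespace KP

lemma jensen_lintegral {α : Type*} [MeasurableSpace α] (μ : Measure α) {p : ℝ} (hp : 1 ≤ p)
    {k u : α → ℝ≥0∞} (hk : AEMeasurable k μ) (hu : AEMeasurable u μ) :
    (∫⁻ y, k y * u y ∂μ) ^ p ≤ (∫⁻ y, k y ∂μ) ^ (p - 1) * ∫⁻ y, k y * u y ^ p ∂μ := by
  rcases eq_or_lt_of_le hp with h1 | h1
  · subst h1; simp
  have hpq : (p.HolderConjugate (p / (p - 1))) := Real.HolderConjugate.conjExponent h1
  have hp0 : 0 < p := by linarith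
  have hp1 : 0 < p - 1 := by linarith
  have h := ENNReal.lintegral_mul_le_Lp_mul_Lq μ hpq.symm (f := fun y => k y ^ ((p-1)/p))
    (g := fun y => k y ^ (1/p) * u y) (hk.pow_const _) ((hk.pow_const _).mul hu)
  have e1 : ∀ y, (fun y => k y ^ ((p-1)/p)) y * (fun y => k y ^ (1/p) * u y) y = k y * u y := by
    intro y
    simp only
    rw [← mul_assoc, ← ENNReal.rpow_add_of_nonneg _ _ (by positivity) (by positivity)]
    congr 1
    rw [show (p-1)/p + 1/p = 1 by field_simp; ring]
    simp
  have e2 : ∀ y, (k y ^ ((p-1)/p)) ^ (p / (p-1)) = k y := by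
    intro y
    rw [← ENNReal.rpow_mul, show (p-1)/p * (p/(p-1)) = 1 by field_simp]; simp
  have e3 : ∀ y, (k y ^ (1/p) * u y) ^ p = k y * u y ^ p := by
    intro y
    rw [rpm _ _ hp0.le, ← ENNReal.rpow_mul,
      show 1/p * p = 1 by field_simp]; simp
  simp only [Pi.mul_apply] at h
  simp_rw [e1, e2, e3] at h
  calc _ ≤ ((∫⁻ y, k y ∂μ) ^ (1 / (p / (p-1))) * (∫⁻ y, k y * u y ^ p ∂μ) ^ (1/p)) ^ p :=
        rpl h hp0.le
    _ = _ := by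
        rw [rpm _ _ hp0.le, ← ENNReal.rpow_mul, ← ENNReal.rpow_mul,
          show 1/p * p = 1 by field_simp, show 1 / (p / (p-1)) * p = p - 1 by field_simp]
        simp

lemma young_gen {α G : Type*} [MeasurableSpace α] [MeasurableSpace G] [AddCommGroup G]
    [MeasurableAdd₂ G] [MeasurableNeg G] (ν : Measure α) [SFinite ν]
    (μ : Measure G) [SFinite μ] [μ.IsAddLeftInvariant]
    {p : ℝ} (hp : 1 ≤ p) {k : α → ℝ≥0∞} {T : α → G} {u : G → ℝ≥0∞} (hk : Measurable k)
    (hT : Measurable T) (hu : Measurable u) :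
    ∫⁻ x, (∫⁻ y, k y * u (x - T y) ∂ν) ^ p ∂μ ≤ (∫⁻ y, k y ∂ν) ^ p * ∫⁻ y, u y ^ p ∂μ := by
  calc _ ≤ ∫⁻ x, (∫⁻ y, k y ∂ν) ^ (p - 1) * ∫⁻ y, k y * u (x - T y) ^ p ∂ν ∂μ := by
        refine lintegral_mono fun x => jensen_lintegral ν hp hk.aemeasurable ?_
        fun_prop
    _ = (∫⁻ y, k y ∂ν) ^ (p - 1) * ∫⁻ x, ∫⁻ y, k y * u (x - T y) ^ p ∂ν ∂μ := by
        rw [lintegral_const_mul]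
        exact Measurable.lintegral_prod_right (by fun_prop)
    _ = (∫⁻ y, k y ∂ν) ^ (p - 1) * ((∫⁻ y, k y ∂ν) * ∫⁻ y, u y ^ p ∂μ) := by
        congr 1
        rw [lintegral_lintegral_swap (by fun_prop), ← lintegral_mul_const _ hk]
        refine lintegral_congr fun y => ?_
        rw [lintegral_const_mul _ (by fun_prop), lintegral_sub_right_eq_self (fun x => u x ^ p) (T y)]
    _ = _ := by
        rw [← mul_assoc]; congr 1
        rcases eq_or_lt_of_le hp with h | h
        · subst h; simp
        · nth_rewrite 2 [← ENNReal.rpow_one (∫⁻ y, k y ∂ν)]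
          rw [← ENNReal.rpow_add_of_nonneg _ _ (by linarith) zero_le_one]; congr 1; ring

lemma riesz_trig {p : ℝ} (hp : 1 < p) (hp2 : p ≤ 2) : ∃ α β : ℝ, 0 ≤ α ∧ 0 ≤ β ∧
    ∀ w : ℂ, 0 < w.re → |w.im| ^ p ≤ α * w.re ^ p - β * ((w ^ (p : ℂ)).re) := by
  have hpi := Real.pi_pos
  set θ₀ := (π / (2 * p) + π / 2) / 2 with hθ₀
  have h1 : π / (2 * p) < π / 2 := by
    apply div_lt_div_of_pos_left hpi (by norm_num) (by linarith)
  have hl : π / (2 * p) < θ₀ := by rw [hθ₀]; linarith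
  have hr : θ₀ < π / 2 := by rw [hθ₀]; linarith
  have h0 : 0 < θ₀ := lt_trans (by positivity) hl
  have hpl : π / 2 < p * θ₀ := by
    have : p * (π / (2 * p)) = π / 2 := by field_simp
    rw [← this]; exact mul_lt_mul_of_pos_left hl (by linarith)
  have hpr : p * θ₀ ≤ π := by nlinarith
  have hc : Real.cos (p * θ₀) < 0 := Real.cos_neg_of_pi_div_two_lt_of_lt hpl (by linarith)
  have hcos : 0 < Real.cos θ₀ := Real.cos_pos_of_mem_Ioo ⟨by linarith, hr⟩
  set β := 1 / (-Real.cos (p * θ₀)) with hβ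
  have hβ0 : 0 < β := by rw [hβ]; apply one_div_pos.2; linarith
  refine ⟨(1 + β) / (Real.cos θ₀) ^ p, β, by positivity, hβ0.le, ?_⟩
  intro w hw
  have hw0 : w ≠ 0 := by rintro rfl; simp at hw
  have hn : 0 < ‖w‖ := norm_pos_iff.2 hw0
  set θ := Complex.arg w with hθ
  have hre : w.re = ‖w‖ * Real.cos θ := by rw [hθ, Complex.norm_mul_cos_arg]
  have him : w.im = ‖w‖ * Real.sin θ := by rw [hθ, Complex.norm_mul_sin_arg]
  have habs : |θ| < π / 2 := Complex.abs_arg_lt_pi_div_two_iff.2 (Or.inl hw)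
  have hpow : (w ^ (p : ℂ)).re = ‖w‖ ^ p * Real.cos (p * |θ|) := by
    rw [Complex.cpow_ofReal_re, ← hθ]
    congr 1
    rw [← Real.cos_abs (θ * p), abs_mul, abs_of_pos (by linarith : 0 < p), mul_comm]
  have hcosabs : Real.cos θ = Real.cos |θ| := (Real.cos_abs θ).symm
  have hcp : 0 < Real.cos |θ| := by
    rw [← hcosabs]; by_contra h; push Not at h
    rw [hre] at hw; nlinarith
  rw [hpow, him, hre, abs_mul, abs_of_pos hn, Real.mul_rpow hn.le (abs_nonneg _),
    Real.mul_rpow hn.le (by rw [hcosabs]; exact hcp.le), hcosabs]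
  have key : |Real.sin θ| ^ p ≤ (1 + β) / (Real.cos θ₀) ^ p * (Real.cos |θ|) ^ p
      - β * Real.cos (p * |θ|) := by
    have hs1 : |Real.sin θ| ^ p ≤ 1 :=
      Real.rpow_le_one (abs_nonneg _) (Real.abs_sin_le_one _) (by linarith)
    rcases le_total θ₀ |θ| with h | h
    · have : Real.cos (p * |θ|) ≤ Real.cos (p * θ₀) := by
        apply Real.cos_le_cos_of_nonneg_of_le_pi (by positivity) _ (by gcongr)
        nlinarith
      have h2 : β * Real.cos (p * |θ|) ≤ -1 := by
        calc _ ≤ β * Real.cos (p * θ₀) := by gcongr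
          _ = -1 := by rw [hβ, one_div, inv_neg, neg_mul, inv_mul_cancel₀ hc.ne]
      have : 0 ≤ (1 + β) / (Real.cos θ₀) ^ p * (Real.cos |θ|) ^ p := by positivity
      linarith
    · have : Real.cos θ₀ ≤ Real.cos |θ| :=
        Real.cos_le_cos_of_nonneg_of_le_pi (abs_nonneg _) (by linarith) h
      have h3 : (Real.cos θ₀) ^ p ≤ (Real.cos |θ|) ^ p :=
        Real.rpow_le_rpow hcos.le this (by linarith)
      have h4 : 1 + β ≤ (1 + β) / (Real.cos θ₀) ^ p * (Real.cos |θ|) ^ p := by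
        rw [div_mul_eq_mul_div, le_div_iff₀ (by positivity)]
        gcongr
      have h5 : β * Real.cos (p * |θ|) ≤ β := by nlinarith [Real.cos_le_one (p * |θ|)]
      linarith
  have hnp : 0 < ‖w‖ ^ p := by positivity
  nlinarith [mul_le_mul_of_nonneg_left key hnp.le]

end KP

namespace KP
open Set Filter Topology

def cauF (h : ℝ → ℝ) (w : ℂ) : ℂ := ∫ t, (h t : ℂ) * (I / (w - t))

lemma im_le_norm_sub (w : ℂ) (t : ℝ) : w.im ≤ ‖w - t‖ := by
  have := Complex.abs_im_le_norm (w - t)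
  simp at this
  exact (le_abs_self _).trans this

lemma cauF_kernel_re (w : ℂ) (t : ℝ) :
    (I / (w - t)).re = w.im / ((w.re - t) ^ 2 + w.im ^ 2) := by
  rw [Complex.div_re]; simp [Complex.normSq_apply]; ring_nf
lemma cauF_kernel_im (w : ℂ) (t : ℝ) :
    (I / (w - t)).im = (w.re - t) / ((w.re - t) ^ 2 + w.im ^ 2) := by
  rw [Complex.div_im]; simp [Complex.normSq_apply]; ring_nf

lemma cauF_integrable {h : ℝ → ℝ} (hi : Integrable h) {w : ℂ} (hw : 0 < w.im) :
    Integrable (fun t : ℝ => (h t : ℂ) * (I / (w - t))) := by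
  refine hi.ofReal.mul_bdd (c := 1 / w.im) ?_ ?_
  · exact (by fun_prop : Measurable (fun t : ℝ => I / (w - t))).aestronglyMeasurable
  · refine Eventually.of_forall fun t => ?_
    rw [norm_div, Complex.norm_I]
    exact one_div_le_one_div_of_le hw (im_le_norm_sub w t)

lemma cauF_re {h : ℝ → ℝ} (hi : Integrable h) {w : ℂ} (hw : 0 < w.im) :
    (cauF h w).re = ∫ t, h t * (w.im / ((w.re - t) ^ 2 + w.im ^ 2)) := by
  rw [cauF, ← RCLike.re_eq_complex_re, ← integral_re (cauF_integrable hi hw)]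
  refine integral_congr_ae (Eventually.of_forall fun t => ?_)
  simp only [RCLike.re_eq_complex_re, Complex.re_ofReal_mul, cauF_kernel_re]

lemma cauF_im {h : ℝ → ℝ} (hi : Integrable h) {w : ℂ} (hw : 0 < w.im) :
    (cauF h w).im = ∫ t, h t * ((w.re - t) / ((w.re - t) ^ 2 + w.im ^ 2)) := by
  rw [cauF, ← RCLike.im_eq_complex_im, ← integral_im (cauF_integrable hi hw)]
  refine integral_congr_ae (Eventually.of_forall fun t => ?_)
  simp only [RCLike.im_eq_complex_im, Complex.im_ofReal_mul, cauF_kernel_im]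

lemma cauF_diff {h : ℝ → ℝ} (hi : Integrable h) {w : ℂ} (hw : 0 < w.im) :
    DifferentiableAt ℂ (cauF h) w := by
  have hb : ∀ x ∈ Metric.ball w (w.im / 2), w.im / 2 ≤ x.im := by
    intro x hx
    have h1 := Complex.abs_im_le_norm (x - w)
    rw [Metric.mem_ball, dist_eq_norm] at hx
    have h2 := (abs_le.1 h1).1
    simp at h2; linarith
  have := hasDerivAt_integral_of_dominated_loc_of_deriv_le (μ := volume) (𝕜 := ℂ)
    (F := fun (w : ℂ) (t : ℝ) => (h t : ℂ) * (I / (w - t)))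
    (F' := fun (w : ℂ) (t : ℝ) => (h t : ℂ) * (-I / (w - t) ^ 2)) (x₀ := w)
    (s := Metric.ball w (w.im / 2))
    (bound := fun t => ‖h t‖ * (1 / (w.im / 2) ^ 2)) (Metric.ball_mem_nhds w (by positivity))
    ?_ (cauF_integrable hi hw) ?_ ?_ ?_ ?_
  · exact this.2.differentiableAt
  · filter_upwards [Metric.ball_mem_nhds w (by positivity : 0 < w.im / 2)] with x hx
    exact (cauF_integrable hi (lt_of_lt_of_le (by positivity) (hb x hx))).aestronglyMeasurable
  · exact hi.ofReal.aestronglyMeasurable.mul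
      (by fun_prop : Measurable (fun t : ℝ => -I / (w - t) ^ 2)).aestronglyMeasurable
  · refine Eventually.of_forall fun t x hx => ?_
    rw [norm_mul, norm_div, norm_neg, Complex.norm_I, norm_pow, Complex.norm_real]
    have h1 := (hb x hx).trans (im_le_norm_sub x t)
    have h2 : 0 < w.im / 2 := by positivity
    gcongr
  · exact hi.norm.mul_const _
  · refine Eventually.of_forall fun t x hx => ?_
    have h1 := (hb x hx).trans (im_le_norm_sub x t)
    have hne : x - t ≠ 0 := norm_pos_iff.1 (lt_of_lt_of_le (by positivity) h1)
    have h3 : HasDerivAt (fun w : ℂ => w - t) 1 x := (hasDerivAt_id x).sub_const _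
    have := ((hasDerivAt_const x I).div h3 hne).const_mul (h t : ℂ)
    refine this.congr_deriv ?_
    ring

lemma cauF_bound {h : ℝ → ℝ} (hi : Integrable h) (h0 : ∀ t, 0 ≤ h t) {B : ℝ}
    (hB : ∀ t, B < |t| → h t = 0) {w : ℂ} {d : ℝ} (hd : 0 < d)
    (hw : d ≤ w.im ∨ d + B ≤ |w.re|) : ‖cauF h w‖ ≤ (∫ t, h t) / d := by
  calc _ ≤ ∫ t, h t / d := by
        refine norm_integral_le_of_norm_le (hi.div_const d) (Eventually.of_forall fun t => ?_)
        by_cases ht : B < |t|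
        · simp [hB t ht]
        rw [norm_mul, norm_div, Complex.norm_I, Complex.norm_real, Real.norm_of_nonneg (h0 t),
          mul_one_div]
        apply div_le_div_of_nonneg_left (h0 t) hd
        rcases hw with hw | hw
        · exact hw.trans (im_le_norm_sub w t)
        · push Not at ht
          have h1 := Complex.abs_re_le_norm (w - t)
          simp at h1
          have h2 := abs_sub_abs_le_abs_sub w.re t
          linarith
    _ = _ := integral_div d h

lemma cauF_contour {h : ℝ → ℝ} (hi : Integrable h) (h0 : ∀ t, 0 ≤ h t) {B : ℝ} (hB0 : 0 < B)
    (hB : ∀ t, B < |t| → h t = 0) {p : ℝ} (hp : 1 < p) {y : ℝ} (hy : 0 < y)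
    (hpos : ∀ w : ℂ, 0 < w.im → 0 < (cauF h w).re) :
    Tendsto (fun Y : ℝ => ∫ x in (-Y)..Y, (cauF h (x + y * I)) ^ (p : ℂ)) atTop (𝓝 0) := by
  set H := ∫ t, h t with hH
  have hH0 : 0 ≤ H := integral_nonneg h0
  have hbd : ∀ᶠ Y : ℝ in atTop, ‖∫ x in (-Y)..Y, (cauF h (x + y * I)) ^ (p : ℂ)‖ ≤
      (4 * (2 * H) ^ p) * Y ^ (-(p - 1)) := by
    filter_upwards [eventually_ge_atTop (2 * B), eventually_ge_atTop y, eventually_gt_atTop 0]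
      with Y hY1 hY2 hY3
    have key := Complex.integral_boundary_rect_eq_zero_of_differentiableOn
      (fun w => (cauF h w) ^ (p : ℂ)) (-Y + y * I) (Y + Y * I) ?_
    · simp only [add_re, neg_re, ofReal_re, mul_re, I_re, mul_zero, ofReal_im, I_im, mul_one,
        sub_self, add_zero, add_im, neg_im, neg_zero, mul_im, zero_add] at key
      set a := ∫ x in (-Y)..Y, (cauF h (x + y * I)) ^ (p : ℂ)
      have hb : ∀ w : ℂ, 0 < w.im → (Y ≤ w.im ∨ Y ≤ |w.re|) →
          ‖(cauF h w) ^ (p : ℂ)‖ ≤ (2 * H / Y) ^ p := by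
        intro w hw hw'
        have hne : cauF h w ≠ 0 := by
          intro h; have := hpos w hw; rw [h] at this; simp at this
        rw [Complex.norm_cpow_real]
        refine Real.rpow_le_rpow (norm_nonneg _) ?_ (by linarith)
        have := cauF_bound hi h0 hB (w := w) (d := Y / 2) (by positivity)
          (hw'.imp (fun h => by linarith) (fun h => by linarith))
        rw [← hH] at this
        calc _ ≤ _ := this
          _ = _ := by field_simp
      have n1 : ‖∫ x in (-Y)..Y, (cauF h (x + Y * I)) ^ (p : ℂ)‖ ≤ (2 * H / Y) ^ p * |Y - -Y| := by
        apply intervalIntegral.norm_integral_le_of_norm_le_const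
        intro x _
        apply hb <;> simp [hY3]
      have hvert : ∀ t ∈ Set.uIoc y Y, 0 < t := by
        intro t ht
        rw [Set.uIoc_of_le hY2] at ht
        linarith [ht.1]
      have n2 : ‖∫ t in y..Y, (cauF h (Y + t * I)) ^ (p : ℂ)‖ ≤ (2 * H / Y) ^ p * |Y - y| := by
        apply intervalIntegral.norm_integral_le_of_norm_le_const
        intro t ht
        apply hb
        · simpa using hvert t ht
        · right; simp [abs_of_pos hY3]
      have n3 : ‖∫ t in y..Y, (cauF h ((-Y : ℝ) + t * I)) ^ (p : ℂ)‖ ≤ (2 * H / Y) ^ p * |Y - y| := by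
        apply intervalIntegral.norm_integral_le_of_norm_le_const
        intro t ht
        apply hb
        · simpa using hvert t ht
        · right; simp [abs_of_pos hY3]
      have e1 : |Y - -Y| = 2 * Y := by rw [abs_of_pos (by linarith)]; ring
      have e2 : |Y - y| ≤ Y := by rw [abs_of_nonneg (by linarith)]; linarith
      rw [e1] at n1
      have hq : 0 ≤ (2 * H / Y) ^ p := by positivity
      have n2' := n2.trans (mul_le_mul_of_nonneg_left e2 hq)
      have n3' := n3.trans (mul_le_mul_of_nonneg_left e2 hq)
      set b := ∫ x in (-Y)..Y, (cauF h (x + Y * I)) ^ (p : ℂ)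
      set c := ∫ t in y..Y, (cauF h (Y + t * I)) ^ (p : ℂ)
      set d := ∫ t in y..Y, (cauF h ((-Y : ℝ) + t * I)) ^ (p : ℂ)
      have ea : a = b - I • c + I • d := by linear_combination key
      have : ‖a‖ ≤ ‖b‖ + ‖c‖ + ‖d‖ := by
        rw [ea]
        refine (norm_add_le _ _).trans ?_
        refine (add_le_add (norm_sub_le _ _) le_rfl).trans ?_
        simp
      calc ‖a‖ ≤ (2 * H / Y) ^ p * (4 * Y) := by linarith
        _ = _ := by
          rw [Real.div_rpow (by positivity) hY3.le, neg_sub, Real.rpow_sub hY3, Real.rpow_one]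
          field_simp
    · intro w hw
      have hwim : 0 < w.im := by
        have := hw.2
        simp [Set.uIcc_of_le hY2] at this
        linarith [this.1]
      apply DifferentiableAt.differentiableWithinAt
      apply (cauF_diff hi hwim).cpow_const
      left; exact hpos w hwim
  have hlim : Tendsto (fun Y : ℝ => (4 * (2 * H) ^ p) * Y ^ (-(p - 1))) atTop (𝓝 0) := by
    have := (tendsto_rpow_neg_atTop (y := p - 1) (by linarith)).const_mul (4 * (2 * H) ^ p)
    simpa using this
  exact squeeze_zero_norm' hbd hlim

end KP

namespace KP
open Set Filter Topology

def Qk (y r : ℝ) : ℝ := r / (r ^ 2 + y ^ 2)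

def Qy (y : ℝ) (h : ℝ → ℝ) (x : ℝ) : ℝ := ∫ t, h t * Qk y (x - t)

lemma Qk_meas (y : ℝ) : Measurable (Qk y) := by unfold Qk; fun_prop

lemma Qk_bd {y : ℝ} (hy : 0 < y) (r : ℝ) : ‖Qk y r‖ ≤ 1 / y := by
  rw [Qk, norm_div, Real.norm_eq_abs, Real.norm_of_nonneg (by positivity),
    div_le_div_iff₀ (by positivity) hy]
  nlinarith [sq_nonneg (|r| - y), sq_abs r, abs_nonneg r]

lemma poisson_mass {y : ℝ} (hy : 0 < y) :
    ∫⁻ r : ℝ, ENNReal.ofReal (y / (r ^ 2 + y ^ 2)) = ENNReal.ofReal π := by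
  have e : ∀ r : ℝ, y / (r ^ 2 + y ^ 2) = y⁻¹ * (1 + (r / y) ^ 2)⁻¹ := by
    intro r; field_simp; ring
  rw [← ofReal_integral_eq_lintegral_ofReal]
  · simp_rw [e]
    rw [integral_const_mul, Measure.integral_comp_div (fun r : ℝ => (1 + r ^ 2)⁻¹) y,
      integral_univ_inv_one_add_sq, abs_of_pos hy, smul_eq_mul]
    congr 1; field_simp
  · simp_rw [e]
    exact (integrable_inv_one_add_sq.comp_div hy.ne').const_mul _
  · exact Eventually.of_forall fun r => by positivity

lemma riesz_pos {p : ℝ} (hp : 1 < p) (hp2 : p ≤ 2) : ∃ C : ℝ≥0∞, C ≠ ∞ ∧ ∀ y : ℝ, 0 < y →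
    ∀ h : ℝ → ℝ, Measurable h → Integrable h → (∀ t, 0 ≤ h t) → ∀ B : ℝ, 0 < B →
    (∀ t, B < |t| → h t = 0) →
    ∫⁻ x, ‖Qy y h x‖ₑ ^ p ≤ C * ∫⁻ x, ‖h x‖ₑ ^ p := by
  obtain ⟨α, β, hα, hβ, key⟩ := riesz_trig hp hp2
  refine ⟨ENNReal.ofReal α * ENNReal.ofReal π ^ p + 1,
    ENNReal.add_ne_top.2 ⟨ENNReal.mul_ne_top ENNReal.ofReal_ne_top
      (ENNReal.rpow_ne_top_of_nonneg (by linarith) ENNReal.ofReal_ne_top), by simp⟩, ?_⟩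
  intro y hy h hm hi h0 B hB0 hB
  by_cases hz : h =ᵐ[volume] 0
  · have : ∀ x, Qy y h x = 0 := fun x => by
      rw [Qy]; apply integral_eq_zero_of_ae
      filter_upwards [hz] with t ht; simp [ht]
    simp [this, ENNReal.zero_rpow_of_pos (by linarith : 0 < p)]
  by_cases htop : ∫⁻ x, ‖h x‖ₑ ^ p = ∞
  · rw [htop, ENNReal.mul_top (by simp)]; exact le_top
  have hpos : ∀ w : ℂ, 0 < w.im → 0 < (cauF h w).re := by
    intro w hw
    rw [cauF_re hi hw]
    have hk : ∀ t : ℝ, 0 < w.im / ((w.re - t) ^ 2 + w.im ^ 2) := fun t => by positivity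
    rw [integral_pos_iff_support_of_nonneg (fun t => mul_nonneg (h0 t) (hk t).le)]
    · have : (Function.support fun t => h t * (w.im / ((w.re - t) ^ 2 + w.im ^ 2))) =
          Function.support h := by
        ext t
        rw [Function.mem_support, Function.mem_support]
        exact mul_ne_zero_iff_right (hk t).ne'
      rw [this]
      refine pos_iff_ne_zero.2 fun h' => hz ?_
      rw [Filter.EventuallyEq, ae_iff]; exact h'
    · have := (cauF_integrable hi hw).re
      simpa only [RCLike.re_eq_complex_re, Complex.re_ofReal_mul, cauF_kernel_re] using this
  set F : ℝ → ℂ := fun x => cauF h (x + y * I) with hF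
  have him : ∀ x : ℝ, ((x : ℂ) + y * I).im = y := by simp
  have hre : ∀ x : ℝ, ((x : ℂ) + y * I).re = x := by simp
  have hFc : Continuous F := continuous_iff_continuousAt.2 fun x =>
    ContinuousAt.comp (f := fun x : ℝ => (x : ℂ) + y * I)
      (cauF_diff hi (by rw [him]; exact hy)).continuousAt (by fun_prop)
  have hFre : ∀ x, 0 < (F x).re := fun x => hpos _ (by rw [him]; exact hy)
  have hv : ∀ x, Qy y h x = (F x).im := fun x => by
    rw [hF]; simp only; rw [cauF_im hi (by rw [him]; exact hy), Qy]; simp only [him, hre, Qk]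
  have hu : ∀ x, ENNReal.ofReal (F x).re ≤
      ∫⁻ t, ENNReal.ofReal (y / (t ^ 2 + y ^ 2)) * ‖h (x - t)‖ₑ := fun x => by
    rw [hF]; simp only; rw [cauF_re hi (by rw [him]; exact hy)]; simp only [him, hre]
    rw [← lintegral_sub_left_eq_self _ x]
    refine (ENNReal.ofReal_le_ofReal (le_abs_self _)).trans ?_
    rw [← Real.enorm_eq_ofReal_abs]
    refine (enorm_integral_le_lintegral_enorm _).trans (lintegral_mono fun t => ?_)
    rw [enorm_mul, mul_comm, sub_sub_cancel,
      Real.enorm_of_nonneg (by positivity : 0 ≤ y / ((x - t) ^ 2 + y ^ 2))]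
  have hU : ∫⁻ x, ENNReal.ofReal ((F x).re ^ p) ≤ ENNReal.ofReal π ^ p * ∫⁻ x, ‖h x‖ₑ ^ p := by
    have hy' := young_gen (volume : Measure ℝ) (volume : Measure ℝ) hp.le
      (T := fun t => t) (k := fun t => ENNReal.ofReal (y / (t ^ 2 + y ^ 2))) (u := fun t => ‖h t‖ₑ)
      (by fun_prop) (by fun_prop) (by fun_prop)
    rw [poisson_mass hy] at hy'
    refine le_trans (lintegral_mono fun x => ?_) hy'
    rw [← ENNReal.ofReal_rpow_of_nonneg (hFre x).le (by linarith)]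
    exact rpl (hu x) (by linarith)
  have hcF : Continuous fun x => (F x) ^ (p : ℂ) := by
    refine continuous_iff_continuousAt.2 fun x => ?_
    exact ContinuousAt.comp (g := fun z : ℂ => z ^ (p : ℂ))
      (continuousAt_cpow_const (Or.inl (hFre x))) hFc.continuousAt
  have hlim := cauF_contour hi h0 hB0 hB hp hy hpos
  have hbd : ∀ᶠ Y : ℝ in atTop, ∫⁻ x in Ioc (-Y) Y, ‖Qy y h x‖ₑ ^ p ≤
      ENNReal.ofReal α * (ENNReal.ofReal π ^ p * ∫⁻ x, ‖h x‖ₑ ^ p) +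
      ENNReal.ofReal (-β * (∫ x in (-Y)..Y, (F x) ^ (p : ℂ)).re) := by
    filter_upwards [eventually_ge_atTop 0] with Y hY
    have c1 : Continuous fun x => |(F x).im| ^ p := by fun_prop (disch := linarith)
    have c2 : Continuous fun x => (F x).re ^ p := by fun_prop (disch := linarith)
    have e1 : ∫⁻ x in Ioc (-Y) Y, ‖Qy y h x‖ₑ ^ p =
        ENNReal.ofReal (∫ x in (-Y)..Y, |(F x).im| ^ p) := by
      rw [intervalIntegral.integral_of_le (by linarith), ofReal_integral_eq_lintegral_ofReal]
      · refine lintegral_congr fun x => ?_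
        rw [hv, Real.enorm_eq_ofReal_abs, ENNReal.ofReal_rpow_of_nonneg (abs_nonneg _) (by linarith)]
      · exact (c1.integrableOn_Icc).mono_set Ioc_subset_Icc_self
      · exact Eventually.of_forall fun x => by positivity
    have e2 : ∫ x in (-Y)..Y, |(F x).im| ^ p ≤
        α * (∫ x in (-Y)..Y, (F x).re ^ p) + -β * (∫ x in (-Y)..Y, (F x) ^ (p : ℂ)).re := by
      have : (∫ x in (-Y)..Y, (F x) ^ (p : ℂ)).re = ∫ x in (-Y)..Y, ((F x) ^ (p : ℂ)).re := by
        rw [intervalIntegral.integral_of_le (by linarith),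
          intervalIntegral.integral_of_le (by linarith), ← RCLike.re_eq_complex_re, ← integral_re]
        · exact (hcF.integrableOn_Icc).mono_set Ioc_subset_Icc_self
      rw [this, ← intervalIntegral.integral_const_mul, ← intervalIntegral.integral_const_mul,
        ← intervalIntegral.integral_add]
      · refine intervalIntegral.integral_mono_on (by linarith) (c1.intervalIntegrable _ _)
          (Continuous.intervalIntegrable (by fun_prop) _ _) fun x _ => ?_
        have := key (F x) (hFre x)
        linarith
      · exact Continuous.intervalIntegrable (by fun_prop) _ _
      · exact Continuous.intervalIntegrable (by fun_prop) _ _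
    rw [e1]
    refine (ENNReal.ofReal_le_ofReal e2).trans (ENNReal.ofReal_add_le.trans ?_)
    gcongr
    rw [ENNReal.ofReal_mul hα]
    gcongr
    rw [intervalIntegral.integral_of_le (by linarith), ofReal_integral_eq_lintegral_ofReal]
    · exact (setLIntegral_le_lintegral _ _).trans hU
    · exact (c2.integrableOn_Icc).mono_set Ioc_subset_Icc_self
    · exact Eventually.of_forall fun x => Real.rpow_nonneg (hFre x).le _
  have hmeas : Measurable fun x => ‖Qy y h x‖ₑ ^ p := by
    simp_rw [hv]; fun_prop
  have hl1 := (aecover_Ioc (μ := (volume : Measure ℝ)) tendsto_neg_atTop_atBot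
    (tendsto_id (x := atTop (α := ℝ)))).lintegral_tendsto_of_countably_generated hmeas.aemeasurable
  have hl2 : Tendsto (fun Y : ℝ => ENNReal.ofReal α * (ENNReal.ofReal π ^ p * ∫⁻ x, ‖h x‖ₑ ^ p) +
      ENNReal.ofReal (-β * (∫ x in (-Y)..Y, (F x) ^ (p : ℂ)).re)) atTop
      (𝓝 (ENNReal.ofReal α * (ENNReal.ofReal π ^ p * ∫⁻ x, ‖h x‖ₑ ^ p) + 0)) := by
    refine tendsto_const_nhds.add ?_
    have := (ENNReal.continuous_ofReal.tendsto _).comp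
      (((Complex.continuous_re.tendsto _).comp hlim).const_mul (-β))
    simpa [Function.comp_def] using this
  refine (le_of_tendsto_of_tendsto hl1 hl2 hbd).trans ?_
  rw [add_zero, ← mul_assoc]
  gcongr
  exact le_self_add

end KP

namespace KP
open Set Filter Topology

lemma Qy_int {y : ℝ} (hy : 0 < y) {h : ℝ → ℝ} (hi : Integrable h) (x : ℝ) :
    Integrable fun t => h t * Qk y (x - t) :=
  hi.mul_bdd (c := 1 / y) ((Qk_meas y).comp (by fun_prop)).aestronglyMeasurable
    (Eventually.of_forall fun t => Qk_bd hy _)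

lemma Qy_meas {y : ℝ} {h : ℝ → ℝ} (hm : Measurable h) : Measurable (Qy y h) := by
  have : StronglyMeasurable (fun z : ℝ × ℝ => h z.2 * Qk y (z.1 - z.2)) :=
    ((hm.comp measurable_snd).mul ((Qk_meas y).comp (by fun_prop))).stronglyMeasurable
  exact this.integral_prod_right.measurable

lemma riesz_low {p : ℝ} (hp : 1 < p) (hp2 : p ≤ 2) : ∃ C : ℝ≥0∞, C ≠ ∞ ∧ ∀ y : ℝ, 0 < y →
    ∀ h : ℝ → ℝ, Measurable h → Integrable h →
    ∫⁻ x, ‖Qy y h x‖ₑ ^ p ≤ C * ∫⁻ x, ‖h x‖ₑ ^ p := by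
  obtain ⟨C, hC, H⟩ := riesz_pos hp hp2
  refine ⟨2 ^ (p - 1) * (C + C), ENNReal.mul_ne_top
    (ENNReal.rpow_ne_top_of_nonneg (by linarith) (by simp)) (by simp [hC]), ?_⟩
  intro y hy h hm hi
  set S : ℕ → Set ℝ := fun N => {t | |t| ≤ N + 1} with hS
  have hSm : ∀ N, MeasurableSet (S N) := fun N => measurableSet_le (by fun_prop) (by fun_prop)
  set u : ℕ → ℝ → ℝ := fun N => (S N).indicator (fun t => max (h t) 0) with hu
  set v : ℕ → ℝ → ℝ := fun N => (S N).indicator (fun t => max (-h t) 0) with hv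
  have hum : ∀ N, Measurable (u N) := fun N => (by fun_prop : Measurable _).indicator (hSm N)
  have hvm : ∀ N, Measurable (v N) := fun N => (by fun_prop : Measurable _).indicator (hSm N)
  have hub : ∀ N t, 0 ≤ u N t ∧ |u N t| ≤ |h t| := fun N t => by
    simp only [hu, indicator]; split_ifs <;> simp [abs_nonneg]
    rw [abs_of_nonneg (le_max_right _ _)]; exact max_le (le_abs_self _) (abs_nonneg _)
  have hvb : ∀ N t, 0 ≤ v N t ∧ |v N t| ≤ |h t| := fun N t => by
    simp only [hv, indicator]; split_ifs <;> simp [abs_nonneg]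
    rw [abs_of_nonneg (le_max_right _ _)]; exact max_le (neg_le_abs _) (abs_nonneg _)
  have hui : ∀ N, Integrable (u N) := fun N => hi.mono (hum N).aestronglyMeasurable
    (Eventually.of_forall fun t => (hub N t).2)
  have hvi : ∀ N, Integrable (v N) := fun N => hi.mono (hvm N).aestronglyMeasurable
    (Eventually.of_forall fun t => (hvb N t).2)
  have hlim : ∀ x, Tendsto (fun N => Qy y (u N) x - Qy y (v N) x) atTop (𝓝 (Qy y h x)) := by
    intro x
    have e : ∀ N, Qy y (u N) x - Qy y (v N) x = ∫ t, (u N t - v N t) * Qk y (x - t) := fun N => by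
      rw [Qy, Qy, ← integral_sub (Qy_int hy (hui N) x) (Qy_int hy (hvi N) x)]
      simp_rw [sub_mul]
    simp_rw [e]
    have e2 : ∀ N t, u N t - v N t = (S N).indicator h t := fun N t => by
      simp only [hu, hv, indicator]; split_ifs <;> simp
    simp_rw [e2]
    refine tendsto_integral_of_dominated_convergence (fun t => ‖h t * Qk y (x - t)‖)
      (fun N => ((hm.indicator (hSm N)).mul ((Qk_meas y).comp (by fun_prop))).aestronglyMeasurable)
      (Qy_int hy hi x).norm (fun N => Eventually.of_forall fun t => ?_)
      (Eventually.of_forall fun t => ?_)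
    · rw [norm_mul, norm_mul]; gcongr; exact norm_indicator_le_norm_self _ _
    · obtain ⟨N₀, hN₀⟩ := exists_nat_ge |t|
      refine tendsto_const_nhds.congr' ?_
      filter_upwards [eventually_ge_atTop N₀] with N hN
      rw [indicator_of_mem]
      have : (N₀ : ℝ) ≤ N := by exact_mod_cast hN
      change |t| ≤ N + 1; linarith
  have hN : ∀ N, ∫⁻ x, ‖Qy y (u N) x - Qy y (v N) x‖ₑ ^ p ≤
      2 ^ (p - 1) * (C + C) * ∫⁻ x, ‖h x‖ₑ ^ p := by
    intro N
    have h1 := H y hy (u N) (hum N) (hui N) (fun t => (hub N t).1) (N + 1) (by positivity)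
      (fun t ht => indicator_of_notMem (by simpa [hS] using ht) _)
    have h2 := H y hy (v N) (hvm N) (hvi N) (fun t => (hvb N t).1) (N + 1) (by positivity)
      (fun t ht => indicator_of_notMem (by simpa [hS] using ht) _)
    have hle : ∀ w : ℝ → ℝ, (∀ t, |w t| ≤ |h t|) → ∫⁻ x, ‖w x‖ₑ ^ p ≤ ∫⁻ x, ‖h x‖ₑ ^ p :=
      fun w hw => lintegral_mono fun t => ENNReal.rpow_le_rpow
        (by rw [enorm_le_iff_norm_le]; exact hw t) (by linarith)
    calc _ ≤ ∫⁻ x, 2 ^ (p - 1) * (‖Qy y (u N) x‖ₑ ^ p + ‖Qy y (v N) x‖ₑ ^ p) :=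
          lintegral_mono fun x => (rpl enorm_sub_le (by linarith)).trans
            (ENNReal.rpow_add_le_mul_rpow_add_rpow _ _ hp.le)
      _ = 2 ^ (p - 1) * ((∫⁻ x, ‖Qy y (u N) x‖ₑ ^ p) + ∫⁻ x, ‖Qy y (v N) x‖ₑ ^ p) := by
          have m1 := Qy_meas (y := y) (hum N)
          rw [lintegral_const_mul' _ _ (ENNReal.rpow_ne_top_of_nonneg (by linarith) (by simp)),
            lintegral_add_left (by fun_prop)]
      _ ≤ 2 ^ (p - 1) * (C * (∫⁻ x, ‖h x‖ₑ ^ p) + C * ∫⁻ x, ‖h x‖ₑ ^ p) := by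
          gcongr
          · exact h1.trans (by gcongr 1; exact hle _ fun t => (hub N t).2)
          · exact h2.trans (by gcongr 1; exact hle _ fun t => (hvb N t).2)
      _ = _ := by ring
  calc ∫⁻ x, ‖Qy y h x‖ₑ ^ p
      = ∫⁻ x, liminf (fun N => ‖Qy y (u N) x - Qy y (v N) x‖ₑ ^ p) atTop := by
        refine lintegral_congr fun x => ?_
        exact (((hlim x).enorm).ennrpow_const p).liminf_eq.symm
    _ ≤ liminf (fun N => ∫⁻ x, ‖Qy y (u N) x - Qy y (v N) x‖ₑ ^ p) atTop := by
        refine lintegral_liminf_le fun N => ?_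
        have m1 := Qy_meas (y := y) (hum N)
        have m2 := Qy_meas (y := y) (hvm N)
        fun_prop
    _ ≤ _ := liminf_le_of_frequently_le' (Frequently.of_forall hN)

lemma riesz_dual {y : ℝ} (hy : 0 < y) {h g : ℝ → ℝ} (hi : Integrable h) (gi : Integrable g) :
    ∫ x, Qy y h x * g x = - ∫ t, h t * Qy y g t := by
  have hodd : ∀ a b : ℝ, Qk y (a - b) = - Qk y (b - a) := fun a b => by
    rw [Qk, Qk, ← neg_div]; congr 1 <;> ring
  simp_rw [Qy, ← integral_mul_const, ← integral_const_mul]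
  rw [integral_integral_swap, ← integral_neg]
  · simp_rw [← integral_neg]
    refine integral_congr_ae (Eventually.of_forall fun t => ?_)
    refine integral_congr_ae (Eventually.of_forall fun x => ?_)
    simp only; rw [hodd]; ring
  · have := (gi.mul_prod hi).mul_bdd (c := 1 / y) (g := fun z : ℝ × ℝ => Qk y (z.1 - z.2))
      ((Qk_meas y).comp (by fun_prop)).aestronglyMeasurable
      (Eventually.of_forall fun t => Qk_bd hy _)
    refine this.congr (Eventually.of_forall fun z => ?_)
    simp [Function.uncurry]; ring

lemma riesz_real {p : ℝ} (hp : 1 < p) : ∃ C : ℝ≥0∞, C ≠ ∞ ∧ ∀ y : ℝ, 0 < y →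
    ∀ h : ℝ → ℝ, Measurable h → Integrable h →
    ∫⁻ x, ‖Qy y h x‖ₑ ^ p ≤ C * ∫⁻ x, ‖h x‖ₑ ^ p := by
  rcases le_or_gt p 2 with hp2 | hp2
  · exact riesz_low hp hp2
  set p' := p / (p - 1) with hp'
  have hpq : p.HolderConjugate p' := Real.HolderConjugate.conjExponent hp
  have hp'1 : 1 < p' := hpq.symm.lt
  have hp0 : 0 < p := by linarith
  have hp'0 : 0 < p' := by linarith
  have hp1 : 0 < p - 1 := by linarith
  obtain ⟨C, hC, H⟩ := riesz_low hp'1 (by rw [hp', div_le_iff₀ hp1]; linarith)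
  refine ⟨(C ^ (1 / p')) ^ p, ENNReal.rpow_ne_top_of_nonneg hp0.le
    (ENNReal.rpow_ne_top_of_nonneg (by positivity) hC), ?_⟩
  intro y hy h hm hi
  have hVm := Qy_meas (y := y) hm
  set V := Qy y h with hV
  have hVb : ∀ x, |V x| ≤ (∫ t, |h t|) * (1 / y) := fun x => by
    rw [← integral_mul_const (1 / y) fun t => |h t|]
    change ‖∫ t, h t * Qk y (x - t)‖ ≤ _
    refine norm_integral_le_of_norm_le (hi.abs.mul_const _) (Eventually.of_forall fun t => ?_)
    rw [norm_mul, Real.norm_eq_abs]; gcongr; exact Qk_bd hy _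
  set M := (∫ t, |h t|) * (1 / y)
  have hN : ∀ N : ℕ, ∫⁻ x in Icc (-(N:ℝ)) N, ‖V x‖ₑ ^ p ≤ (C ^ (1 / p')) ^ p * ∫⁻ x, ‖h x‖ₑ ^ p := by
    intro N
    set G : ℝ → ℝ := (Icc (-(N:ℝ)) N).indicator fun x => |V x| ^ (p - 2) * V x with hG
    have hGm : Measurable G := (by fun_prop : Measurable _).indicator measurableSet_Icc
    have hGi : Integrable G := by
      rw [hG, integrable_indicator_iff measurableSet_Icc]
      refine Measure.integrableOn_of_bounded (M := M ^ (p - 2) * M) (by simp) (by fun_prop)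
        (Eventually.of_forall fun x => ?_)
      rw [norm_mul, Real.norm_of_nonneg (by positivity), Real.norm_eq_abs]
      have := hVb x
      have := (abs_nonneg _).trans this
      gcongr
    have hGn : ∀ x, ‖G x‖ₑ ^ p' = (Icc (-(N:ℝ)) N).indicator (fun x => ‖V x‖ₑ ^ p) x := fun x => by
      rw [hG]; simp only [indicator]; split_ifs
      · have : ‖|V x| ^ (p - 2) * V x‖ₑ = ‖V x‖ₑ ^ (p - 1) := by
          rw [Real.enorm_eq_ofReal_abs, Real.enorm_eq_ofReal_abs,
            ENNReal.ofReal_rpow_of_nonneg (abs_nonneg _) hp1.le, abs_mul,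
            abs_of_nonneg (by positivity : 0 ≤ |V x| ^ (p-2))]
          rcases eq_or_ne (V x) 0 with h0 | h0
          · simp [h0, Real.zero_rpow hp1.ne']
          · congr 1; nth_rewrite 2 [← Real.rpow_one |V x|]
            rw [← Real.rpow_add (abs_pos.2 h0)]; congr 1; ring
        rw [this, ← ENNReal.rpow_mul, hp']; congr 1; field_simp
      · simp [hp'0]
    set X := ∫⁻ x in Icc (-(N:ℝ)) N, ‖V x‖ₑ ^ p with hX
    have hXG : ∫⁻ x, ‖G x‖ₑ ^ p' = X := by
      simp_rw [hGn]; rw [lintegral_indicator measurableSet_Icc]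
    have hXtop : X ≠ ∞ := by
      refine ne_of_lt (lt_of_le_of_lt (lintegral_mono (g := fun _ => ENNReal.ofReal M ^ p)
        fun x => ?_) ?_)
      · refine rpl ?_ hp0.le
        rw [Real.enorm_eq_ofReal_abs]; exact ENNReal.ofReal_le_ofReal (hVb x)
      · rw [lintegral_const]
        exact ENNReal.mul_lt_top (ENNReal.rpow_lt_top_of_nonneg hp0.le (by simp)) (by simp)
    have hVG : ∫ x, V x * G x = ∫ x in Icc (-(N:ℝ)) N, |V x| ^ p := by
      rw [← integral_indicator measurableSet_Icc]
      congr 1; ext x; rw [hG]; simp only [indicator]; split_ifs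
      · rcases eq_or_ne (V x) 0 with h0 | h0
        · simp [h0, Real.zero_rpow hp0.ne']
        · have : V x * V x = |V x| ^ (2:ℝ) := by rw [Real.rpow_two, sq_abs, sq]
          rw [mul_left_comm, this, ← Real.rpow_add (abs_pos.2 h0)]; congr 1; ring
      · simp
    have hX1 : X = ENNReal.ofReal (∫ x in Icc (-(N:ℝ)) N, |V x| ^ p) := by
      rw [ofReal_integral_eq_lintegral_ofReal]
      · refine lintegral_congr fun x => ?_
        rw [Real.enorm_eq_ofReal_abs, ENNReal.ofReal_rpow_of_nonneg (abs_nonneg _) hp0.le]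
      · refine Measure.integrableOn_of_bounded (M := M ^ p) (by simp)
          (by fun_prop (disch := linarith))
          (Eventually.of_forall fun x => ?_)
        rw [Real.norm_of_nonneg (by positivity)]
        exact Real.rpow_le_rpow (abs_nonneg _) (hVb x) hp0.le
      · exact Eventually.of_forall fun x => by positivity
    have hX2 : X ≤ (∫⁻ x, ‖h x‖ₑ ^ p) ^ (1 / p) * (C * X) ^ (1 / p') := by
      calc X ≤ ‖∫ x, V x * G x‖ₑ := by
            rw [hX1, hVG, Real.enorm_eq_ofReal_abs]; exact ENNReal.ofReal_le_ofReal (le_abs_self _)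
        _ = ‖∫ t, h t * Qy y G t‖ₑ := by rw [hV, riesz_dual hy hi hGi, enorm_neg]
        _ ≤ ∫⁻ t, ‖h t‖ₑ * ‖Qy y G t‖ₑ :=
            (enorm_integral_le_lintegral_enorm _).trans_eq (by simp_rw [enorm_mul])
        _ ≤ (∫⁻ x, ‖h x‖ₑ ^ p) ^ (1 / p) * (∫⁻ x, ‖Qy y G x‖ₑ ^ p') ^ (1 / p') := by
            have := Qy_meas (y := y) hGm
            exact ENNReal.lintegral_mul_le_Lp_mul_Lq _ hpq (by fun_prop) (by fun_prop)
        _ ≤ _ := by gcongr; rw [← hXG]; exact H y hy G hGm hGi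
    rcases eq_or_ne X 0 with h0 | h0
    · rw [h0]; simp
    have e1 : X = X ^ (1 / p) * X ^ (1 / p') := by
      rw [← ENNReal.rpow_add _ _ h0 hXtop, one_div, one_div, hpq.inv_add_inv_eq_one, ENNReal.rpow_one]
    have hX3 : X ^ (1 / p) ≤ C ^ (1 / p') * (∫⁻ x, ‖h x‖ₑ ^ p) ^ (1 / p) := by
      have h3 : X ^ (1 / p') ≠ 0 := by simp [h0, hXtop]
      have h4 : X ^ (1 / p') ≠ ∞ := ENNReal.rpow_ne_top_of_nonneg (by positivity) hXtop
      rw [← ENNReal.mul_le_mul_iff_left h3 h4, ← e1]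
      refine hX2.trans_eq ?_
      rw [rpm _ _ (by positivity)]; ring
    have := rpl hX3 hp0.le
    rwa [rpm _ _ hp0.le, ← ENNReal.rpow_mul, ← ENNReal.rpow_mul _ (1 / p) p,
      one_div_mul_cancel hp0.ne', ENNReal.rpow_one, ENNReal.rpow_one] at this
  have hl1 := (aecover_Icc (μ := (volume : Measure ℝ)) (l := atTop) (a := fun N : ℕ => -(N:ℝ))
    (b := fun N : ℕ => (N:ℝ)) (tendsto_neg_atTop_atBot.comp tendsto_natCast_atTop_atTop)
    tendsto_natCast_atTop_atTop).lintegral_tendsto_of_countably_generated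
    (f := fun x => ‖V x‖ₑ ^ p) (by fun_prop)
  exact le_of_tendsto hl1 (Eventually.of_forall hN)

lemma riesz_cplx {p : ℝ} (hp : 1 < p) : ∃ C : ℝ≥0∞, C ≠ ∞ ∧ ∀ y : ℝ, 0 < y →
    ∀ h : ℝ → ℂ, Measurable h → Integrable h →
    ∫⁻ x, ‖∫ r, (Qk y r : ℂ) * h (x - r)‖ₑ ^ p ≤ C * ∫⁻ x, ‖h x‖ₑ ^ p := by
  obtain ⟨C, hC, H⟩ := riesz_real hp
  refine ⟨2 ^ (p - 1) * (C + C), ENNReal.mul_ne_top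
    (ENNReal.rpow_ne_top_of_nonneg (by linarith) (by simp)) (by simp [hC]), ?_⟩
  intro y hy h hm hi
  have e : ∀ x, ∫ r, (Qk y r : ℂ) * h (x - r) =
      (Qy y (fun t => (h t).re) x : ℂ) + Qy y (fun t => (h t).im) x * I := fun x => by
    have i1 : Integrable fun t => (h t) * (Qk y (x - t) : ℂ) :=
      hi.mul_bdd (c := 1 / y) (by
          have := Qk_meas y
          exact (by fun_prop : Measurable _).aestronglyMeasurable)
        (Eventually.of_forall fun t => by rw [Complex.norm_real]; exact Qk_bd hy _)
    rw [← integral_sub_left_eq_self _ _ x]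
    simp_rw [sub_sub_cancel, mul_comm _ (h _)]
    rw [← integral_re_add_im i1, Qy, Qy]
    simp
  have m1 := Qy_meas (y := y) (Complex.measurable_re.comp hm)
  calc _ ≤ ∫⁻ x, 2 ^ (p - 1) * (‖Qy y (fun t => (h t).re) x‖ₑ ^ p +
        ‖Qy y (fun t => (h t).im) x‖ₑ ^ p) := lintegral_mono fun x => by
        rw [e]
        refine (rpl (enorm_add_le _ _) (by linarith)).trans
            ((ENNReal.rpow_add_le_mul_rpow_add_rpow _ _ hp.le).trans_eq ?_)
        simp [← ofReal_norm]
    _ = 2 ^ (p - 1) * ((∫⁻ x, ‖Qy y (fun t => (h t).re) x‖ₑ ^ p) +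
        ∫⁻ x, ‖Qy y (fun t => (h t).im) x‖ₑ ^ p) := by
        rw [lintegral_const_mul' _ _ (ENNReal.rpow_ne_top_of_nonneg (by linarith) (by simp)),
            lintegral_add_left (by exact (m1.enorm).pow_const p)]
    _ ≤ 2 ^ (p - 1) * (C * (∫⁻ x, ‖h x‖ₑ ^ p) + C * ∫⁻ x, ‖h x‖ₑ ^ p) := by
        gcongr
        · refine (H y hy _ (by fun_prop) hi.re).trans ?_
          gcongr; rw [enorm_le_iff_norm_le]; exact Complex.abs_re_le_norm _
        · refine (H y hy _ (by fun_prop) hi.im).trans ?_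
          gcongr; rw [enorm_le_iff_norm_le]; exact Complex.abs_im_le_norm _
    _ = _ := by ring

end KP

namespace KP
open Set Filter Topology

lemma rp_ne {C : ℝ≥0∞} (hC : C ≠ ∞) {p : ℝ} (hp : 0 ≤ p) : C ^ p ≠ ∞ :=
  ENNReal.rpow_ne_top_of_nonneg hp hC

def kk (ε r : ℝ) : ℝ := Real.exp (-(r ^ 2 / 2)) * Qk ε r

lemma kk_meas (ε : ℝ) : Measurable (kk ε) := by
  have := Qk_meas ε; unfold kk; fun_prop

lemma rneg_exp_le (r : ℝ) : Real.exp (-(r ^ 2 / 2)) ≤ 2 / (2 + r ^ 2) := by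
  have h := Real.add_one_le_exp (r ^ 2 / 2)
  rw [Real.exp_neg, show 2 / (2 + r ^ 2) = (r ^ 2 / 2 + 1)⁻¹ by field_simp; ring]
  exact inv_anti₀ (by positivity) h

lemma kk_diff {ε : ℝ} (h0 : 0 < ε) (h1 : ε ≤ 1) (r : ℝ) :
    |kk ε r - Qk ε r + Qk 1 r| ≤ 4 * (1 + r ^ 2)⁻¹ := by
  have he := rneg_exp_le r
  have he0 := Real.exp_pos (-(r ^ 2 / 2))
  have he1 : 1 - r ^ 2 / 2 ≤ Real.exp (-(r ^ 2 / 2)) := by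
    have := Real.add_one_le_exp (-(r ^ 2 / 2)); linarith
  set e := Real.exp (-(r ^ 2 / 2)) with hedef
  have hle : e ≤ 1 := he.trans (by rw [div_le_one (by positivity)]; nlinarith [sq_nonneg r])
  rw [show kk ε r - Qk ε r + Qk 1 r = r / (r ^ 2 + 1 ^ 2) - (1 - e) * (r / (r ^ 2 + ε ^ 2)) by
    rw [kk, Qk, Qk]; ring]
  have hee : ε ^ 2 ≤ 1 := by nlinarith
  rcases le_or_gt |r| 1 with hr | hr
  · have h2 : r ^ 2 ≤ 1 := by rw [← sq_abs]; nlinarith [abs_nonneg r]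
    have a1 : |r / (r ^ 2 + 1 ^ 2)| ≤ 1 := by
      rw [abs_div, abs_of_pos (by positivity : 0 < r ^ 2 + 1 ^ 2), div_le_one (by positivity)]
      nlinarith [sq_nonneg r]
    have a2 : |(1 - e) * (r / (r ^ 2 + ε ^ 2))| ≤ 1 := by
      rw [abs_mul, abs_of_nonneg (by linarith), abs_div,
        abs_of_pos (by positivity : 0 < r ^ 2 + ε ^ 2), ← mul_div_assoc, div_le_one (by positivity)]
      nlinarith [abs_nonneg r, sq_nonneg r, sq_nonneg ε]
    have a3 : 2 ≤ 4 * (1 + r ^ 2)⁻¹ := by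
      rw [← div_eq_mul_inv, le_div_iff₀ (by positivity)]; linarith
    linarith [abs_sub (r / (r ^ 2 + 1 ^ 2)) ((1 - e) * (r / (r ^ 2 + ε ^ 2)))]
  · have h2 : 1 < r ^ 2 := by rw [← sq_abs]; nlinarith
    rw [show r / (r ^ 2 + 1 ^ 2) - (1 - e) * (r / (r ^ 2 + ε ^ 2)) =
      -(r * (1 - ε ^ 2) / ((r ^ 2 + 1) * (r ^ 2 + ε ^ 2))) + e * (r / (r ^ 2 + ε ^ 2)) by
      field_simp; ring]
    have b0 : |r| ≤ r ^ 2 := by rw [← sq_abs]; nlinarith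
    have b1 : |r * (1 - ε ^ 2) / ((r ^ 2 + 1) * (r ^ 2 + ε ^ 2))| ≤ (1 + r ^ 2)⁻¹ := by
      rw [abs_div, abs_of_pos (by positivity : 0 < (r ^ 2 + 1) * (r ^ 2 + ε ^ 2)), abs_mul,
        abs_of_nonneg (by linarith : 0 ≤ 1 - ε ^ 2), ← one_div,
        div_le_div_iff₀ (by positivity) (by positivity)]
      have : |r| * (1 - ε ^ 2) ≤ r ^ 2 + ε ^ 2 := by nlinarith [sq_nonneg ε, abs_nonneg r]
      nlinarith [sq_nonneg r]
    have b2 : |e * (r / (r ^ 2 + ε ^ 2))| ≤ 2 * (1 + r ^ 2)⁻¹ := by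
      rw [abs_mul, abs_of_pos he0, abs_div, abs_of_pos (by positivity : 0 < r ^ 2 + ε ^ 2)]
      have c1 : |r| / (r ^ 2 + ε ^ 2) ≤ 1 := by
        rw [div_le_one (by positivity)]; nlinarith [sq_nonneg ε]
      have c2 : e ≤ 2 * (1 + r ^ 2)⁻¹ := he.trans (by
        rw [← div_eq_mul_inv]; gcongr; linarith)
      nlinarith [abs_nonneg r]
    have b3 := abs_add_le (-(r * (1 - ε ^ 2) / ((r ^ 2 + 1) * (r ^ 2 + ε ^ 2))))
      (e * (r / (r ^ 2 + ε ^ 2)))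
    rw [abs_neg] at b3
    have : 0 < (1 + r ^ 2)⁻¹ := by positivity
    linarith

lemma kk_bd {ε : ℝ} (h0 : 0 < ε) (r : ℝ) : ‖kk ε r‖ ≤ Real.exp (-(r ^ 2 / 2)) * (1 / ε) := by
  rw [kk, norm_mul, Real.norm_of_nonneg (Real.exp_pos _).le]
  gcongr; exact Qk_bd h0 r

lemma kk_lp {p : ℝ} (hp : 1 < p) : ∃ C : ℝ≥0∞, C ≠ ∞ ∧ ∀ ε : ℝ, 0 < ε → ε ≤ 1 →
    ∀ h : ℝ → ℂ, Continuous h → Integrable h →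
    ∫⁻ x, ‖∫ r, (kk ε r : ℂ) * h (x - r)‖ₑ ^ p ≤ C * ∫⁻ x, ‖h x‖ₑ ^ p := by
  obtain ⟨C, hC, H⟩ := riesz_cplx hp
  set k : ℝ → ℝ≥0∞ := fun r => ENNReal.ofReal (4 * (1 + r ^ 2)⁻¹)
  have hk : Measurable k := by fun_prop
  have hK : (∫⁻ r, k r) ≠ ∞ := ne_of_lt <| by
    have := (integrable_inv_one_add_sq.const_mul 4).lintegral_lt_top
    exact this
  have hp0 : 0 ≤ p := by linarith
  refine ⟨2 ^ (p - 1) * (2 ^ (p - 1) * (C + C) + (∫⁻ r, k r) ^ p), ENNReal.mul_ne_top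
    (rp_ne (by simp) (by linarith)) (ENNReal.add_ne_top.2 ⟨ENNReal.mul_ne_top
    (rp_ne (by simp) (by linarith)) (by simp [hC]), rp_ne hK hp0⟩), ?_⟩
  intro ε h0 h1 h hc hi
  have hm := hc.measurable
  have qm := Qk_meas ε
  have qm1 := Qk_meas 1
  have km := kk_meas ε
  have i1 : ∀ y : ℝ, 0 < y → ∀ x, Integrable fun r => (Qk y r : ℂ) * h (x - r) := fun y hy x =>
    (hi.comp_sub_left x).bdd_mul (c := 1 / y) (by
      have := Qk_meas y; exact (by fun_prop : Measurable _).aestronglyMeasurable)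
      (Eventually.of_forall fun t => by rw [Complex.norm_real]; exact Qk_bd hy _)
  have i2 : ∀ x, Integrable fun r => ((kk ε r - Qk ε r + Qk 1 r : ℝ) : ℂ) * h (x - r) := fun x =>
    (hi.comp_sub_left x).bdd_mul (c := 4) (by
      exact (by fun_prop : Measurable _).aestronglyMeasurable)
      (Eventually.of_forall fun t => by
        rw [Complex.norm_real]
        refine (kk_diff h0 h1 t).trans ?_
        have : (1 + t ^ 2)⁻¹ ≤ 1 := inv_le_one_of_one_le₀ (by nlinarith [sq_nonneg t])
        linarith)
  have e : ∀ x, ∫ r, (kk ε r : ℂ) * h (x - r) = ((∫ r, (Qk ε r : ℂ) * h (x - r)) -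
      ∫ r, (Qk 1 r : ℂ) * h (x - r)) +
      ∫ r, ((kk ε r - Qk ε r + Qk 1 r : ℝ) : ℂ) * h (x - r) := fun x => by
    rw [← integral_sub (i1 ε h0 x) (i1 1 one_pos x),
      ← integral_add (by exact (i1 ε h0 x).sub (i1 1 one_pos x)) (i2 x)]
    congr 1; ext r; push_cast; ring
  have mm : ∀ g : ℝ → ℝ, Measurable g → Measurable fun x => ∫ r, (g r : ℂ) * h (x - r) := by
    intro g hg
    have : StronglyMeasurable (fun z : ℝ × ℝ => (g z.2 : ℂ) * h (z.1 - z.2)) :=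
      (by fun_prop : Measurable _).stronglyMeasurable
    exact this.integral_prod_right.measurable
  have m1 := mm _ qm
  have m2 := mm _ qm1
  set X := ∫⁻ x, ‖h x‖ₑ ^ p
  have t2 : ∀ a b : ℂ, ‖a + b‖ₑ ^ p ≤ 2 ^ (p - 1) * (‖a‖ₑ ^ p + ‖b‖ₑ ^ p) := fun a b =>
    (rpl (enorm_add_le _ _) hp0).trans
      (ENNReal.rpow_add_le_mul_rpow_add_rpow _ _ hp.le)
  calc _ ≤ ∫⁻ x, 2 ^ (p - 1) * (2 ^ (p - 1) * (‖∫ r, (Qk ε r : ℂ) * h (x - r)‖ₑ ^ p +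
        ‖∫ r, (Qk 1 r : ℂ) * h (x - r)‖ₑ ^ p) + (∫⁻ r, k r * ‖h (x - r)‖ₑ) ^ p) :=
        lintegral_mono fun x => by
          rw [e]
          refine (t2 _ _).trans ?_
          gcongr
          · have := t2 (∫ r, (Qk ε r : ℂ) * h (x - r)) (-∫ r, (Qk 1 r : ℂ) * h (x - r))
            rwa [enorm_neg, ← sub_eq_add_neg] at this
          · refine (enorm_integral_le_lintegral_enorm _).trans (lintegral_mono fun r => ?_)
            rw [enorm_mul]; gcongr
            rw [← ofReal_norm, Complex.norm_real]
            exact ENNReal.ofReal_le_ofReal (kk_diff h0 h1 r)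
    _ = 2 ^ (p - 1) * (2 ^ (p - 1) * ((∫⁻ x, ‖∫ r, (Qk ε r : ℂ) * h (x - r)‖ₑ ^ p) +
        ∫⁻ x, ‖∫ r, (Qk 1 r : ℂ) * h (x - r)‖ₑ ^ p) + ∫⁻ x, (∫⁻ r, k r * ‖h (x - r)‖ₑ) ^ p) := by
        have h2 : (2:ℝ≥0∞) ^ (p - 1) ≠ ∞ := rp_ne (by simp) (by linarith)
        rw [lintegral_const_mul' _ _ h2, lintegral_add_left (by fun_prop),
          lintegral_const_mul' _ _ h2, lintegral_add_left (by fun_prop)]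
    _ ≤ 2 ^ (p - 1) * (2 ^ (p - 1) * (C * X + C * X) + (∫⁻ r, k r) ^ p * X) := by
        gcongr
        · exact H ε h0 h hm hi
        · exact H 1 one_pos h hm hi
        · exact young_gen volume volume hp.le hk measurable_id (u := fun x => ‖h x‖ₑ) (by fun_prop)
    _ = _ := by ring

variable {V : Type*} [NormedAddCommGroup V] [InnerProductSpace ℝ V] [FiniteDimensional ℝ V]
  [MeasurableSpace V] [BorelSpace V]

lemma slice {z : V} (hz : z ≠ 0) {Φ : V → ℝ≥0∞} (hΦ : Measurable Φ) :
    ∫⁻ x, Φ x = ∫⁻ x, ({x : V | ⟪x, z⟫ / ‖z‖ ^ 2 ∈ Ico (0:ℝ) 1}.indicator 1 x) *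
      ∫⁻ τ : ℝ, Φ (x + τ • z) := by
  set S := {x : V | ⟪x, z⟫ / ‖z‖ ^ 2 ∈ Ico (0:ℝ) 1} with hS
  have hSm : MeasurableSet S := measurableSet_Ico.preimage (by fun_prop)
  have him : Measurable (S.indicator (1 : V → ℝ≥0∞)) := measurable_one.indicator hSm
  have h1 : ∀ x, ∫⁻ τ : ℝ, S.indicator (1 : V → ℝ≥0∞) (x - τ • z) = 1 := fun x => by
    have : ∀ τ : ℝ, S.indicator (1 : V → ℝ≥0∞) (x - τ • z) =
        (Ioc (⟪x, z⟫ / ‖z‖ ^ 2 - 1) (⟪x, z⟫ / ‖z‖ ^ 2)).indicator 1 τ := fun τ => by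
      have : ⟪x - τ • z, z⟫ / ‖z‖ ^ 2 = ⟪x, z⟫ / ‖z‖ ^ 2 - τ := by
        rw [inner_sub_left, real_inner_smul_left, real_inner_self_eq_norm_sq]
        have : ‖z‖ ≠ 0 := norm_ne_zero_iff.2 hz
        field_simp
      simp only [indicator, hS, mem_ofPred_eq, this, mem_Ico, mem_Ioc]
      congr 1; apply propext; constructor <;> rintro ⟨a, b⟩ <;> constructor <;> linarith
    simp_rw [this]
    rw [lintegral_indicator_one measurableSet_Ioc]; simp
  symm
  calc _ = ∫⁻ x, ∫⁻ τ : ℝ, S.indicator 1 x * Φ (x + τ • z) :=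
        lintegral_congr fun x => (lintegral_const_mul _ (by fun_prop)).symm
    _ = ∫⁻ τ : ℝ, ∫⁻ x, S.indicator 1 x * Φ (x + τ • z) :=
        lintegral_lintegral_swap (by fun_prop)
    _ = ∫⁻ τ : ℝ, ∫⁻ x, S.indicator 1 (x - τ • z) * Φ x := lintegral_congr fun τ => by
        rw [← lintegral_sub_right_eq_self _ (τ • z)]; simp
    _ = ∫⁻ x, ∫⁻ τ : ℝ, S.indicator 1 (x - τ • z) * Φ x :=
        lintegral_lintegral_swap (by fun_prop)
    _ = _ := lintegral_congr fun x => by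
        rw [lintegral_mul_const _ (by fun_prop), h1, one_mul]

lemma line_int {z : V} (hz : z ≠ 0) (h : SchwartzMap V ℂ) (x : V) :
    Integrable fun τ : ℝ => h (x + τ • z) := by
  obtain ⟨C, hC⟩ := h.decay 2 0
  obtain ⟨C0, hC0⟩ := h.decay 0 0
  simp only [norm_iteratedFDeriv_zero, pow_zero, one_mul] at hC hC0
  set c := ⟪x, z⟫ / ‖z‖ ^ 2
  have hzn : 0 < ‖z‖ := norm_pos_iff.2 hz
  refine ((integrable_inv_one_add_sq.comp_add_right c).const_mul (C0 + C / ‖z‖ ^ 2)).mono'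
    (by fun_prop) (Eventually.of_forall fun τ => ?_)
  rw [← div_eq_mul_inv, le_div_iff₀ (by positivity), mul_add, mul_one]
  refine add_le_add (hC0.2 _) ?_
  rw [le_div_iff₀ (by positivity)]
  refine le_trans ?_ (hC.2 (x + τ • z))
  rw [mul_assoc, mul_comm]
  gcongr
  rw [← mul_pow]
  have : |(τ + c) * ‖z‖| ≤ ‖x + τ • z‖ := by
    have := abs_real_inner_le_norm (x + τ • z) z
    rw [inner_add_left, real_inner_smul_left, real_inner_self_eq_norm_sq] at this
    rw [← mul_le_mul_iff_left₀ hzn, ← abs_of_pos hzn, ← abs_mul, abs_of_pos hzn]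
    refine le_trans (le_of_eq ?_) this
    congr 1; simp only [c]; field_simp; ring
  rw [← sq_abs]; gcongr

lemma dir_lp {p : ℝ} (hp : 1 < p) : ∃ C : ℝ≥0∞, C ≠ ∞ ∧ ∀ ε : ℝ, 0 < ε → ε ≤ 1 →
    ∀ h : SchwartzMap V ℂ, ∀ z : V, z ≠ 0 →
    ∫⁻ x, ‖∫ r : ℝ, (kk ε r : ℂ) * h (x - r • z)‖ₑ ^ p ≤ C * ∫⁻ x, ‖h x‖ₑ ^ p := by
  obtain ⟨C, hC, H⟩ := kk_lp hp
  refine ⟨C, hC, fun ε h0 h1 h z hz => ?_⟩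
  have km := kk_meas ε
  have hm : Measurable h := h.continuous.measurable
  have mm : Measurable fun x => ∫ r : ℝ, (kk ε r : ℂ) * h (x - r • z) := by
    have : StronglyMeasurable (fun w : V × ℝ => (kk ε w.2 : ℂ) * h (w.1 - w.2 • z)) :=
      (by fun_prop : Measurable _).stronglyMeasurable
    exact this.integral_prod_right.measurable
  rw [slice hz (by fun_prop), slice hz (Φ := fun x => ‖h x‖ₑ ^ p) (by fun_prop),
    ← lintegral_const_mul' _ _ hC]
  refine lintegral_mono fun x => ?_
  rw [mul_left_comm]
  gcongr
  have := H ε h0 h1 (fun τ => h (x + τ • z)) (by fun_prop) (line_int hz h x)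
  refine le_trans (le_of_eq ?_) this
  simp_rw [sub_smul, add_sub_assoc]

end KP

namespace KP
open Set Filter Topology

lemma gauss_bd (M : ℕ) : ∃ K : ℝ, ∀ t : ℝ, 0 ≤ t → (1 + t) ^ M * Real.exp (-(t ^ 2 / 2)) ≤ K := by
  refine ⟨4 ^ M * M.factorial * Real.exp (1 / 2), fun t ht => ?_⟩
  have h1 : (1 + t) ^ M ≤ 4 ^ M * (1 / 2 + t ^ 2 / 2) ^ M := by
    rw [← mul_pow]; refine pow_le_pow_left₀ (by positivity) ?_ _
    nlinarith [sq_nonneg (t - 1)]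
  have h2 := Real.pow_div_factorial_le_exp (x := 1 / 2 + t ^ 2 / 2) (by positivity) M
  rw [div_le_iff₀ (by positivity), Real.exp_add] at h2
  rw [Real.exp_neg, ← div_eq_mul_inv, div_le_iff₀ (Real.exp_pos _)]
  refine h1.trans ?_
  calc _ ≤ 4 ^ M * (Real.exp (1 / 2) * Real.exp (t ^ 2 / 2) * M.factorial) := by gcongr
    _ = _ := by ring

lemma gauss_int (V : Type*) [NormedAddCommGroup V] [InnerProductSpace ℝ V] [FiniteDimensional ℝ V]
    [MeasurableSpace V] [BorelSpace V] (m : ℕ) :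
    Integrable fun z : V => (1 + ‖z‖) ^ m * Real.exp (-(‖z‖ ^ 2 / 2)) := by
  set d := Module.finrank ℝ V + 1
  obtain ⟨K, hK⟩ := gauss_bd (m + d)
  refine ((integrable_one_add_norm (μ := (volume : Measure V)) (r := d) (by simp [d])).const_mul
    K).mono' (by fun_prop) (Eventually.of_forall fun z => ?_)
  have := hK ‖z‖ (norm_nonneg z)
  rw [Real.norm_of_nonneg (by positivity), Real.rpow_neg (by positivity), ← div_eq_mul_inv,
    le_div_iff₀ (by positivity), Real.rpow_natCast]
  rw [pow_add] at this; linarith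

def jw {n : ℕ} (b : ℝ) (x : Eu n) : ℝ := (1 + ‖x‖ ^ 2) ^ (b / 2)

variable {n : ℕ}

lemma jw_pos (b : ℝ) (x : Eu n) : 0 < jw b x := by unfold jw; positivity

lemma jw_cont (b : ℝ) : Continuous (jw (n := n) b) := by
  unfold jw
  exact Continuous.rpow_const (by fun_prop) fun x => Or.inl (by positivity)

lemma jw_eq (b : ℝ) (x : Eu n) : jw b x = (√(1 + ‖x‖ ^ 2)) ^ b := by
  rw [jw, Real.sqrt_eq_rpow, ← Real.rpow_mul (by positivity)]; congr 1; ring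

lemma jb_le (x v : Eu n) : √(1 + ‖x‖ ^ 2) ≤ √(1 + ‖x - v‖ ^ 2) + ‖v‖ := by
  have h1 : ‖x‖ ≤ ‖x - v‖ + ‖v‖ := by simpa using norm_add_le (x - v) v
  rw [Real.sqrt_le_left (by positivity)]
  have h2 : ‖x - v‖ ≤ √(1 + ‖x - v‖ ^ 2) := Real.le_sqrt_of_sq_le (by linarith)
  have h3 := Real.sq_sqrt (by positivity : 0 ≤ 1 + ‖x - v‖ ^ 2)
  nlinarith [norm_nonneg x, norm_nonneg v, norm_nonneg (x - v)]

lemma jb_one (x : Eu n) : 1 ≤ √(1 + ‖x‖ ^ 2) :=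
  Real.one_le_sqrt.2 (by nlinarith [norm_nonneg x])

lemma jw_le {b : ℝ} (hb : 0 ≤ b) (x v : Eu n) : jw b x ≤ (1 + ‖v‖) ^ b * jw b (x - v) := by
  rw [jw_eq, jw_eq, ← Real.mul_rpow (by positivity) (by positivity)]
  refine Real.rpow_le_rpow (by positivity) ?_ hb
  nlinarith [jb_le x v, jb_one (x - v), norm_nonneg v]

lemma jw_diff {b : ℝ} (hb : 0 ≤ b) (x v : Eu n) :
    |jw b x - jw b (x - v)| ≤ ⌈b⌉₊ * ‖v‖ * (1 + ‖v‖) ^ ⌈b⌉₊ * jw b (x - v) := by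
  set m := ⌈b⌉₊
  have hm : b ≤ m := Nat.le_ceil b
  set t := √(1 + ‖x‖ ^ 2)
  set t' := √(1 + ‖x - v‖ ^ 2)
  have ht : 1 ≤ t := jb_one x
  have ht' : 1 ≤ t' := jb_one (x - v)
  have hv := norm_nonneg v
  have l1 : t ≤ t' + ‖v‖ := jb_le x v
  have l2 : t' ≤ t + ‖v‖ := by simpa [t, t'] using jb_le (x - v) (-v)
  set ρ := t / t' with hρ
  have hρ0 : 0 < ρ := by positivity
  have hj : jw b x = ρ ^ b * jw b (x - v) := by
    rw [jw_eq, jw_eq, ← Real.mul_rpow (by positivity) (by positivity), hρ,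
      div_mul_cancel₀ _ (by positivity)]
  have key : |ρ ^ b - 1| ≤ m * ‖v‖ * (1 + ‖v‖) ^ m := by
    have hone : 1 ≤ (1 + ‖v‖) ^ m := one_le_pow₀ (by linarith)
    rcases le_total 1 ρ with h | h
    · have h1 : ρ ^ b ≤ (1 + ‖v‖) ^ m := by
        refine (Real.rpow_le_rpow_of_exponent_le h hm).trans ?_
        rw [Real.rpow_natCast]
        refine pow_le_pow_left₀ hρ0.le ?_ _
        rw [hρ, div_le_iff₀ (by positivity)]; nlinarith
      have h2 : 1 ≤ ρ ^ b := Real.one_le_rpow h hb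
      rw [abs_of_nonneg (by linarith)]
      have h3 := one_add_mul_le_pow (a := -(‖v‖ / (1 + ‖v‖))) (by
        have : ‖v‖ / (1 + ‖v‖) ≤ 1 := (div_le_one (by positivity)).2 (by linarith)
        linarith) m
      have h4 : 1 + -(‖v‖ / (1 + ‖v‖)) = (1 + ‖v‖)⁻¹ := by field_simp; ring
      have h6 : ‖v‖ / (1 + ‖v‖) ≤ ‖v‖ := div_le_self hv (by linarith)
      rw [h4, inv_pow] at h3
      have h7 := mul_le_mul_of_nonneg_right h3 (by positivity : 0 ≤ (1 + ‖v‖) ^ m)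
      rw [inv_mul_cancel₀ (by positivity)] at h7
      have h8 := mul_le_mul_of_nonneg_left h6
        (by positivity : 0 ≤ (m : ℝ) * (1 + ‖v‖) ^ m)
      nlinarith
    · have h1 : ρ ^ b ≤ 1 := Real.rpow_le_one hρ0.le h hb
      have h2 : ρ ^ m ≤ ρ ^ b := by
        rw [← Real.rpow_natCast]; exact Real.rpow_le_rpow_of_exponent_ge hρ0 h hm
      have h3 := one_add_mul_le_pow (a := ρ - 1) (by linarith) m
      rw [add_sub_cancel] at h3
      have h4 : 1 - ρ ≤ ‖v‖ := by
        rw [hρ, sub_le_iff_le_add, ← sub_le_iff_le_add', le_div_iff₀ (by positivity)]; nlinarith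
      rw [abs_of_nonpos (by linarith)]
      have h5 := mul_le_mul_of_nonneg_left h4 (Nat.cast_nonneg (α := ℝ) m)
      have h6 : 0 ≤ (m:ℝ) * ‖v‖ := by positivity
      nlinarith
  rw [hj, ← sub_one_mul, abs_mul, abs_of_pos (jw_pos b _)]
  exact mul_le_mul_of_nonneg_right key (jw_pos b _).le

def Tav (l : Fin n) (ε : ℝ) (h : Eu n → ℂ) (x : Eu n) : ℂ :=
  ∫ z : Eu n, ((z l * Real.exp (-(‖z‖ ^ 2 / 2)) : ℝ) : ℂ) * ∫ r : ℝ, (kk ε r : ℂ) * h (x - r • z)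

lemma gk_bd (l : Fin n) (z : Eu n) : ‖((z l * Real.exp (-(‖z‖ ^ 2 / 2)) : ℝ) : ℂ)‖ ≤
    (1 + ‖z‖) ^ 1 * Real.exp (-(‖z‖ ^ 2 / 2)) := by
  rw [Complex.norm_real, norm_mul, Real.norm_of_nonneg (Real.exp_pos _).le]
  gcongr
  rw [pow_one]
  have := EuclideanSpace.norm_eq z
  have h := PiLp.norm_apply_le z l
  linarith

lemma kk_int {ε : ℝ} (h0 : 0 < ε) : Integrable fun r : ℝ => (kk ε r : ℂ) := by
  have := (gauss_int ℝ 0).mul_const (1 / ε)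
  refine this.mono' (by have := kk_meas ε; exact (by fun_prop : Measurable _).aestronglyMeasurable)
    (Eventually.of_forall fun r => ?_)
  rw [Complex.norm_real]; simpa using kk_bd h0 r

lemma inner_meas {ε : ℝ} {h : Eu n → ℂ} (hm : Measurable h) :
    Measurable fun w : Eu n × Eu n => ∫ r : ℝ, (kk ε r : ℂ) * h (w.1 - r • w.2) := by
  have km := kk_meas ε
  have : StronglyMeasurable (fun w : (Eu n × Eu n) × ℝ => (kk ε w.2 : ℂ) * h (w.1.1 - w.2 • w.1.2)) :=
    (by fun_prop : Measurable _).stronglyMeasurable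
  exact this.integral_prod_right.measurable

lemma Tav_lp (l : Fin n) {p : ℝ} (hp : 1 < p) : ∃ C : ℝ≥0∞, C ≠ ∞ ∧ ∀ ε : ℝ, 0 < ε → ε ≤ 1 →
    ∀ h : Sw n, ∫⁻ x, ‖Tav l ε h x‖ₑ ^ p ≤ C * ∫⁻ x, ‖h x‖ₑ ^ p := by
  obtain ⟨C, hC, H⟩ := dir_lp (V := Eu n) hp
  set k : Eu n → ℝ≥0∞ := fun z => ‖((z l * Real.exp (-(‖z‖ ^ 2 / 2)) : ℝ) : ℂ)‖ₑ with hkdef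
  have hk : Measurable k := by fun_prop
  have hK : (∫⁻ z, k z) ≠ ∞ := by
    refine ne_of_lt (lt_of_le_of_lt (lintegral_mono fun z => ?_) (gauss_int (Eu n) 1).lintegral_lt_top)
    rw [hkdef]; simp only; rw [← ofReal_norm]; exact ENNReal.ofReal_le_ofReal (gk_bd l z)
  refine ⟨(∫⁻ z, k z) ^ (p - 1) * ((∫⁻ z, k z) * C), ENNReal.mul_ne_top (rp_ne hK (by linarith))
    (ENNReal.mul_ne_top hK hC), fun ε h0 h1 h => ?_⟩
  have hm := h.continuous.measurable
  have im := inner_meas (ε := ε) hm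
  calc _ ≤ ∫⁻ x, (∫⁻ z, k z) ^ (p - 1) * ∫⁻ z, k z *
          ‖∫ r : ℝ, (kk ε r : ℂ) * h (x - r • z)‖ₑ ^ p := lintegral_mono fun x => by
        refine le_trans (rpl ((enorm_integral_le_lintegral_enorm _).trans_eq
          (by simp_rw [enorm_mul]; rfl)) (by linarith)) (jensen_lintegral _ hp.le hk.aemeasurable ?_)
        exact ((im.comp measurable_prodMk_left).enorm).aemeasurable
    _ = (∫⁻ z, k z) ^ (p - 1) * ∫⁻ z, k z * ∫⁻ x, ‖∫ r : ℝ, (kk ε r : ℂ) * h (x - r • z)‖ₑ ^ p := by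
        rw [lintegral_const_mul' _ _ (rp_ne hK (by linarith)), lintegral_lintegral_swap]
        · congr 1; refine lintegral_congr fun z => lintegral_const_mul _ ?_
          exact (im.comp measurable_prodMk_right).enorm.pow_const p
        · exact ((hk.comp measurable_snd).mul (im.enorm.pow_const p)).aemeasurable
    _ ≤ (∫⁻ z, k z) ^ (p - 1) * ∫⁻ z, k z * (C * ∫⁻ x, ‖h x‖ₑ ^ p) := by
        refine mul_le_mul_right (lintegral_mono fun z => ?_) _
        rcases eq_or_ne z 0 with hz | hz
        · simp [hkdef, hz]
        · exact mul_le_mul_right (H ε h0 h1 h z hz) _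
    _ = _ := by rw [lintegral_mul_const _ hk]; ring

lemma kk_mul_bd {ε : ℝ} (h0 : 0 < ε) (r : ℝ) : ‖kk ε r‖ * |r| ≤ Real.exp (-(r ^ 2 / 2)) := by
  rw [kk, norm_mul, Real.norm_of_nonneg (Real.exp_pos _).le, mul_assoc]
  refine mul_le_of_le_one_right (Real.exp_pos _).le ?_
  rw [Qk, norm_div, Real.norm_eq_abs, Real.norm_of_nonneg (by positivity), div_mul_eq_mul_div,
    div_le_one (by positivity), abs_mul_abs_self]
  nlinarith [sq_nonneg ε]

lemma Tav_int (l : Fin n) {ε : ℝ} (h0 : 0 < ε) {h : Eu n → ℂ} (hc : Continuous h) {M : ℝ}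
    (hM : ∀ x, ‖h x‖ ≤ M) (x : Eu n) :
    (∀ z, Integrable fun r : ℝ => (kk ε r : ℂ) * h (x - r • z)) ∧
    Integrable fun z : Eu n => ((z l * Real.exp (-(‖z‖ ^ 2 / 2)) : ℝ) : ℂ) *
      ∫ r : ℝ, (kk ε r : ℂ) * h (x - r • z) := by
  refine ⟨fun z => (kk_int h0).mul_bdd (c := M) (by fun_prop)
    (Eventually.of_forall fun r => hM _), ?_⟩
  refine Integrable.mul_bdd (c := (∫ r : ℝ, ‖(kk ε r : ℂ)‖ * M)) ?_ ?_ (Eventually.of_forall fun z => ?_)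
  · refine (gauss_int (Eu n) 1).mono' (by fun_prop) (Eventually.of_forall fun z => gk_bd l z)
  · exact ((inner_meas hc.measurable).comp measurable_prodMk_left).aestronglyMeasurable
  · refine norm_integral_le_of_norm_le ((kk_int h0).norm.mul_const M) (Eventually.of_forall fun r => ?_)
    rw [norm_mul]; gcongr; exact hM _

lemma Tav_wlp (l : Fin n) {p : ℝ} (hp : 1 < p) {b : ℝ} (hb : 0 ≤ b) :
    ∃ C : ℝ≥0∞, C ≠ ∞ ∧ ∀ ε : ℝ, 0 < ε → ε ≤ 1 → ∀ h : Sw n,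
    ∫⁻ x, ‖(jw b x : ℂ) * Tav l ε h x‖ₑ ^ p ≤ C * ∫⁻ x, ‖(jw b x : ℂ) * h x‖ₑ ^ p := by
  obtain ⟨C, hC, H⟩ := Tav_lp l hp
  set m := ⌈b⌉₊ with hm
  set k : Eu n × ℝ → ℝ≥0∞ := fun w => ENNReal.ofReal (((1 + ‖w.1‖) ^ (m + 2) *
    Real.exp (-(‖w.1‖ ^ 2 / 2))) * (m * ((1 + ‖w.2‖) ^ m * Real.exp (-(‖w.2‖ ^ 2 / 2))))) with hkdef
  have hk : Measurable k := by fun_prop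
  have hK : (∫⁻ w, k w ∂(volume.prod volume)) ≠ ∞ :=
    ((gauss_int (Eu n) (m + 2)).mul_prod ((gauss_int ℝ m).const_mul m)).lintegral_lt_top.ne
  have hp0 : 0 ≤ p := by linarith
  refine ⟨2 ^ (p - 1) * (C + (∫⁻ w, k w ∂(volume.prod volume)) ^ p), ENNReal.mul_ne_top
    (rp_ne (by simp) (by linarith)) (ENNReal.add_ne_top.2 ⟨hC, rp_ne hK hp0⟩), fun ε h0 h1 h => ?_⟩
  have km := kk_meas ε
  set g : Sw n := SchwartzMap.smulLeftCLM ℂ (fun x : Eu n => (jw b x : ℝ)) h with hg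
  have htg : (jw (n := n) b).HasTemperateGrowth := by
    unfold jw; exact Function.hasTemperateGrowth_one_add_norm_sq_rpow _ _
  have hgx : ∀ x, g x = (jw b x : ℂ) * h x := fun x => by
    rw [hg, SchwartzMap.smulLeftCLM_apply_apply htg]; simp
  obtain ⟨M, hM⟩ := h.decay 0 0
  obtain ⟨M', hM'⟩ := g.decay 0 0
  simp only [norm_iteratedFDeriv_zero, pow_zero, one_mul] at hM hM'
  have jc := jw_cont (n := n) b
  have hbd : ∀ x, ‖(jw b x : ℂ) * Tav l ε h x‖ₑ ≤ ‖Tav l ε g x‖ₑ +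
      ∫⁻ w, k w * ‖g (x - w.2 • w.1)‖ₑ ∂(volume.prod volume) := by
    intro x
    obtain ⟨a1, a2⟩ := Tav_int l h0 h.continuous hM.2 x
    obtain ⟨b1, b2⟩ := Tav_int l h0 g.continuous hM'.2 x
    have e : (jw b x : ℂ) * Tav l ε h x = Tav l ε g x + ∫ z : Eu n,
        ((z l * Real.exp (-(‖z‖ ^ 2 / 2)) : ℝ) : ℂ) *
        ∫ r : ℝ, (kk ε r : ℂ) * ((jw b x - jw b (x - r • z) : ℝ) * h (x - r • z)) := by
      have e1 : ∀ z, ∫ r : ℝ, (kk ε r : ℂ) * ((jw b x - jw b (x - r • z) : ℝ) * h (x - r • z)) =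
          (jw b x : ℂ) * (∫ r : ℝ, (kk ε r : ℂ) * h (x - r • z)) -
          ∫ r : ℝ, (kk ε r : ℂ) * g (x - r • z) := fun z => by
        rw [← integral_const_mul, ← integral_sub ((a1 z).const_mul _) (b1 z)]
        congr 1; ext r; rw [hgx]; push_cast; ring
      simp_rw [e1, mul_sub, mul_left_comm _ (jw b x : ℂ)]
      rw [integral_sub (a2.const_mul _) b2, integral_const_mul, Tav, Tav]; ring
    rw [e]
    refine (enorm_add_le _ _).trans (add_le_add le_rfl ?_)
    rw [lintegral_prod _ (by
      have := h.continuous.measurable; have := g.continuous.measurable; fun_prop)]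
    refine (enorm_integral_le_lintegral_enorm _).trans (lintegral_mono fun z => ?_)
    rw [enorm_mul]
    have : ‖((z l * Real.exp (-(‖z‖ ^ 2 / 2)) : ℝ) : ℂ)‖ₑ *
      ‖∫ r : ℝ, (kk ε r : ℂ) * ((jw b x - jw b (x - r • z) : ℝ) * h (x - r • z))‖ₑ ≤ ∫⁻ r : ℝ,
      ‖((z l * Real.exp (-(‖z‖ ^ 2 / 2)) : ℝ) : ℂ)‖ₑ *
      ‖(kk ε r : ℂ) * ((jw b x - jw b (x - r • z) : ℝ) * h (x - r • z))‖ₑ := by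
        rw [lintegral_const_mul' _ _ enorm_ne_top]
        gcongr; exact enorm_integral_le_lintegral_enorm _
    refine this.trans (lintegral_mono fun r => ?_)
    rw [← enorm_mul, hkdef]; simp only
    rw [← ofReal_norm, ← ofReal_norm (g _), ← ENNReal.ofReal_mul (by positivity)]
    refine ENNReal.ofReal_le_ofReal ?_
    rw [hgx, norm_mul, norm_mul, norm_mul, norm_mul, Complex.norm_real (kk ε r),
      Complex.norm_real (_ - _), Complex.norm_real (jw b _), Real.norm_of_nonneg (jw_pos b _).le, Real.norm_eq_abs (_ - _)]
    have q1 := gk_bd l z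
    have q2 := kk_mul_bd h0 r
    have q3 := jw_diff hb x (r • z)
    rw [norm_smul, Real.norm_eq_abs] at q3
    have q4 : (1 + |r| * ‖z‖) ^ m ≤ ((1 + |r|) * (1 + ‖z‖)) ^ m := by
      gcongr; nlinarith [abs_nonneg r, norm_nonneg z]
    have q5 := jw_pos b (x - r • z)
    have q6 := norm_nonneg z
    calc _ ≤ ((1 + ‖z‖) ^ 1 * Real.exp (-(‖z‖ ^ 2 / 2))) * (‖kk ε r‖ * ((m * (|r| * ‖z‖) *
          ((1 + |r|) * (1 + ‖z‖)) ^ m * jw b (x - r • z)) * ‖h (x - r • z)‖)) := by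
          gcongr; exact q3.trans (by gcongr)
      _ = (‖kk ε r‖ * |r|) * (‖z‖ * (((1 + ‖z‖) ^ 1 * Real.exp (-(‖z‖ ^ 2 / 2))) * (m *
          ((1 + |r|) * (1 + ‖z‖)) ^ m * jw b (x - r • z) * ‖h (x - r • z)‖))) := by ring
      _ ≤ Real.exp (-(r ^ 2 / 2)) * ((1 + ‖z‖) * (((1 + ‖z‖) ^ 1 * Real.exp (-(‖z‖ ^ 2 / 2))) * (m *
          ((1 + |r|) * (1 + ‖z‖)) ^ m * jw b (x - r • z) * ‖h (x - r • z)‖))) := by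
          gcongr; linarith
      _ = _ := by rw [Real.norm_eq_abs, sq_abs, mul_pow]; ring
  have gm := g.continuous.measurable
  calc _ ≤ ∫⁻ x, 2 ^ (p - 1) * (‖Tav l ε g x‖ₑ ^ p +
        (∫⁻ w, k w * ‖g (x - w.2 • w.1)‖ₑ ∂(volume.prod volume)) ^ p) := lintegral_mono fun x =>
        (rpl (hbd x) hp0).trans (ENNReal.rpow_add_le_mul_rpow_add_rpow _ _ hp.le)
    _ = 2 ^ (p - 1) * ((∫⁻ x, ‖Tav l ε g x‖ₑ ^ p) +
        ∫⁻ x, (∫⁻ w, k w * ‖g (x - w.2 • w.1)‖ₑ ∂(volume.prod volume)) ^ p) := by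
        rw [lintegral_const_mul' _ _ (rp_ne (by simp) (by linarith)), lintegral_add_right]
        refine Measurable.pow_const ?_ p
        exact Measurable.lintegral_prod_right' (f := fun w : Eu n × (Eu n × ℝ) =>
          k w.2 * ‖g (w.1 - w.2.2 • w.2.1)‖ₑ) (by fun_prop)
    _ ≤ 2 ^ (p - 1) * (C * (∫⁻ x, ‖g x‖ₑ ^ p) +
        (∫⁻ w, k w ∂(volume.prod volume)) ^ p * ∫⁻ x, ‖g x‖ₑ ^ p) := by
        gcongr
        · exact H ε h0 h1 g
        · exact young_gen (volume.prod volume) volume hp.le (k := k) (u := fun x => ‖g x‖ₑ)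
            (T := fun w => w.2 • w.1) hk (by fun_prop) (by fun_prop)
    _ = _ := by simp_rw [hgx]; ring

end KP

namespace KP
open Set Filter Topology FourierTransform
variable {n : ℕ}

def ee (t : ℝ) : ℂ := Complex.exp ((2 * π * t : ℝ) * I)

lemma ee_add (s t : ℝ) : ee (s + t) = ee s * ee t := by
  rw [ee, ee, ee, ← Complex.exp_add]; congr 1; push_cast; ring

@[simp] lemma ee_norm (t : ℝ) : ‖ee t‖ = 1 := Complex.norm_exp_ofReal_mul_I _

@[fun_prop] lemma ee_cont : Continuous ee := by unfold ee; fun_prop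

abbrev Fm (m : Eu n → ℂ) (f : Sw n) : Sw n :=
  SchwartzMap.fourierMultiplierCLM ℂ m f

lemma inv_apply (u : Sw n) (x : Eu n) : (𝓕⁻ u) x = ∫ ζ, ee ⟪ζ, x⟫ * u ζ := by
  rw [SchwartzMap.fourierInv_coe, Real.fourierInv_eq']; rfl

lemma hat_apply (u : Sw n) (ζ : Eu n) : (𝓕 u) ζ = ∫ x, ee (-⟪x, ζ⟫) * u x := by
  rw [SchwartzMap.fourier_coe, Real.fourier_eq']; congr 1; ext x; rw [ee, smul_eq_mul]; congr 4; ring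

lemma self_apply (u : Sw n) (x : Eu n) : u x = ∫ ζ, ee ⟪ζ, x⟫ * (𝓕 u) ζ := by
  rw [← inv_apply, FourierTransform.fourierInv_fourier_eq]

lemma Fm_hat {m : Eu n → ℂ} (hm : m.HasTemperateGrowth) (f : Sw n) (ζ : Eu n) :
    (𝓕 (Fm m f)) ζ = m ζ * (𝓕 f) ζ := by
  rw [Fm, SchwartzMap.fourierMultiplierCLM_apply, FourierTransform.fourier_fourierInv_eq,
    SchwartzMap.smulLeftCLM_apply_apply hm]; rfl

lemma Fm_apply {m : Eu n → ℂ} (hm : m.HasTemperateGrowth) (f : Sw n) (x : Eu n) :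
    Fm m f x = ∫ ζ, ee ⟪ζ, x⟫ * (m ζ * (𝓕 f) ζ) := by
  rw [self_apply]; simp_rw [Fm_hat hm]

def bes (τ : ℝ) (ζ : Eu n) : ℝ := (1 + ‖(2 * π) • ζ‖ ^ 2) ^ (τ / 2)

def rz (l : Fin n) (ζ : Eu n) : ℂ := (2 * π * I) * (ζ l * bes (-1) ζ : ℝ)

lemma bes_tg (τ : ℝ) : (bes (n := n) τ).HasTemperateGrowth := by
  have h := Function.hasTemperateGrowth_one_add_norm_sq_rpow (Eu n) (τ / 2)
  have h2 : (fun ζ : Eu n => (2 * π) • ζ).HasTemperateGrowth := by fun_prop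
  exact h.comp h2

lemma coord_tg (l : Fin n) : (fun ζ : Eu n => ζ l).HasTemperateGrowth :=
  (EuclideanSpace.proj (𝕜 := ℝ) l : Eu n →L[ℝ] ℝ).hasTemperateGrowth

lemma ofReal_tg {u : Eu n → ℝ} (hu : u.HasTemperateGrowth) :
    (fun x => (u x : ℂ)).HasTemperateGrowth :=
  (Complex.ofRealCLM.hasTemperateGrowth).comp hu

lemma rz_tg (l : Fin n) : (rz l).HasTemperateGrowth := by
  have h := ofReal_tg ((coord_tg l).mul (bes_tg (-1)))
  unfold rz
  have h2 : (fun _ : Eu n => (2 * π * I : ℂ)).HasTemperateGrowth := by fun_prop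
  exact h2.mul h

def gau (v : Eu n) : ℂ := Complex.exp (-(1/2) * ‖v‖ ^ 2)

lemma gau_r (v : Eu n) : gau v = (Real.exp (-(‖v‖ ^ 2 / 2)) : ℝ) := by
  rw [gau]; push_cast; congr 1; ring

lemma gau_d (v : Eu n) : HasFDerivAt gau (-(innerSL ℝ v).smulRight (gau v)) v := by
  have h1 : HasFDerivAt (fun v : Eu n => -(1 / 2) * ‖v‖ ^ 2) (-(innerSL ℝ v)) v :=
    ((hasStrictFDerivAt_norm_sq v).hasFDerivAt.const_mul (-(1/2) : ℝ)).congr_fderiv (by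
      ext; simp)
  have h2 := (Complex.ofRealCLM.hasFDerivAt (x := _)).comp v h1.exp
  have h3 : gau (n := n) = (Complex.ofRealCLM ∘ fun v : Eu n => Real.exp (-(1 / 2) * ‖v‖ ^ 2)) := by
    ext v; simp [gau]
  rw [h3]
  refine h2.congr_fderiv ?_
  ext w; simp; ring

lemma in_single (l : Fin n) (z : Eu n) : ⟪z, EuclideanSpace.single l (1:ℝ)⟫ = z l := by
  rw [real_inner_comm, EuclideanSpace.inner_single_left]; simp

lemma gauss_moment (l : Fin n) (η : Eu n) : ∫ z : Eu n,
    ((z l * Real.exp (-(‖z‖ ^ 2 / 2)) : ℝ) : ℂ) * ee (-⟪η, z⟫) =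
    -(2 * π * I) * η l * ((2 * π) ^ (n / 2 : ℂ) * Complex.exp (-2 * π ^ 2 * ‖η‖ ^ 2)) := by
  have gc : Continuous (gau (n := n)) := by unfold gau; fun_prop
  have i0 : Integrable (gau (n := n)) := by
    refine (gauss_int (Eu n) 0).mono' gc.aestronglyMeasurable (Eventually.of_forall fun z => ?_)
    rw [gau_r, Complex.norm_real, Real.norm_of_nonneg (Real.exp_pos _).le]; simp
  have hfd : fderiv ℝ (gau (n := n)) = fun v => -(innerSL ℝ v).smulRight (gau v) :=
    funext fun v => (gau_d v).fderiv
  have i1 : Integrable (fderiv ℝ (gau (n := n))) := by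
    rw [hfd]
    refine (gauss_int (Eu n) 1).mono' ?_ (Eventually.of_forall fun z => ?_)
    · exact Continuous.aestronglyMeasurable (by fun_prop)
    · rw [norm_neg, ContinuousLinearMap.norm_smulRight_apply, innerSL_apply_norm, gau_r, Complex.norm_real,
        Real.norm_of_nonneg (Real.exp_pos _).le]
      gcongr; linarith [norm_nonneg z]
  have h := congrFun (Real.fourier_fderiv i0 (fun v => (gau_d v).differentiableAt) i1) η
  rw [Real.fourier_eq'] at h
  have i2 : Integrable fun v : Eu n => Complex.exp (↑(-2 * π * ⟪v, η⟫) * I) • fderiv ℝ gau v :=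
    i1.mono (Continuous.aestronglyMeasurable (by rw [hfd]; fun_prop))
      (Eventually.of_forall fun v => by rw [norm_smul, Complex.norm_exp_ofReal_mul_I, one_mul])
  have h2 := DFunLike.congr_fun h (EuclideanSpace.single l 1)
  rw [ContinuousLinearMap.integral_apply i2, VectorFourier.fourierSMulRight_apply] at h2
  have g : 𝓕 (gau (n := n)) η = (2 * π) ^ (n / 2 : ℂ) * Complex.exp (-2 * π ^ 2 * ‖η‖ ^ 2) := by
    have := fourier_gaussian_innerProductSpace (V := Eu n) (b := 1/2) (by norm_num) η
    have e1 : (π / (1 / 2) : ℂ) = 2 * π := by ring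
    have e2 : (-π ^ 2 * ‖η‖ ^ 2 / (1 / 2) : ℂ) = -2 * π ^ 2 * ‖η‖ ^ 2 := by ring
    rw [e1, e2, finrank_euclideanSpace, Fintype.card_fin] at this
    exact this
  rw [g] at h2
  have e3 : ∀ z : Eu n, ((z l * Real.exp (-(‖z‖ ^ 2 / 2)) : ℝ) : ℂ) * ee (-⟪η, z⟫) =
    -((Complex.exp (↑(-2 * π * ⟪z, η⟫) * I) • fderiv ℝ gau z) (EuclideanSpace.single l 1)) := by
    intro z
    have : Complex.exp (↑(-2 * π * ⟪z, η⟫) * I) = ee (-⟪η, z⟫) := by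
      rw [ee, real_inner_comm]; congr 3; ring
    rw [this, hfd]
    simp [gau_r, in_single]; ring
  simp_rw [e3]
  rw [integral_neg, h2]
  have e5 : (innerSL ℝ η) (EuclideanSpace.single l 1) = η l := in_single l η
  simp [e5, mul_assoc]

def rad (n : ℕ) (ε : ℝ) (ζ : Eu n) : ℝ :=
  ∫ r : ℝ, Real.exp (-(r ^ 2 / 2)) * (r ^ 2 / (r ^ 2 + ε ^ 2)) * Real.exp (-2 * π ^ 2 * (r ^ 2 * ‖ζ‖ ^ 2))

lemma Tav_rep (l : Fin n) {ε : ℝ} (h0 : 0 < ε) (h : Sw n) (x : Eu n) :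
    Tav l ε h x = -(2 * π) ^ (n / 2 : ℂ) * ∫ ζ : Eu n,
      ee ⟪ζ, x⟫ * ((2 * π * I) * ζ l * rad n ε ζ * (𝓕 h) ζ) := by
  have km := kk_meas ε
  set F : Eu n × (ℝ × Eu n) → ℂ := fun w => (((w.1 l * Real.exp (-(‖w.1‖ ^ 2 / 2)) : ℝ) : ℂ) *
    ((kk ε w.2.1 : ℂ) * (𝓕 h) w.2.2)) * ee ⟪w.2.2, x - w.2.1 • w.1⟫ with hF
  have iz : Integrable fun z : Eu n => ((z l * Real.exp (-(‖z‖ ^ 2 / 2)) : ℝ) : ℂ) :=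
    (gauss_int (Eu n) 1).mono' (by fun_prop) (Eventually.of_forall fun z => gk_bd l z)
  have iF : Integrable F (volume.prod (volume.prod volume)) :=
    (iz.mul_prod ((kk_int h0).mul_prod (𝓕 h).integrable)).mul_bdd (c := 1)
      (by fun_prop) (Eventually.of_forall fun w => by simp)
  have s1 : Tav l ε h x = ∫ z, ∫ w, F (z, w) ∂(volume.prod volume) := by
    refine integral_congr_ae ?_
    filter_upwards [iF.prod_right_ae] with z hz
    rw [integral_prod _ hz, ← integral_const_mul]
    refine integral_congr_ae (Eventually.of_forall fun r => ?_)
    simp only [hF]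
    rw [self_apply h, ← integral_const_mul, ← integral_const_mul]
    refine integral_congr_ae (Eventually.of_forall fun ζ => ?_)
    simp only; ring
  have s2 : ∀ w : ℝ × Eu n, ∫ z, F (z, w) = -(2 * π) ^ (n / 2 : ℂ) * (ee ⟪w.2, x⟫ * ((2 * π * I) * w.2 l *
     (Real.exp (-(w.1 ^ 2 / 2)) * (w.1 ^ 2 / (w.1 ^ 2 + ε ^ 2)) *
      Real.exp (-2 * π ^ 2 * (w.1 ^ 2 * ‖w.2‖ ^ 2)) : ℝ) * (𝓕 h) w.2)) := fun w => by
    have e1 : ∀ z, F (z, w) = ((kk ε w.1 : ℂ) * (𝓕 h) w.2 * ee ⟪w.2, x⟫) *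
        (((z l * Real.exp (-(‖z‖ ^ 2 / 2)) : ℝ) : ℂ) * ee (-⟪w.1 • w.2, z⟫)) := fun z => by
      simp only [hF]
      rw [inner_sub_right, sub_eq_add_neg, ee_add, inner_smul_right, real_inner_smul_left]; ring
    simp_rw [e1]
    rw [integral_const_mul, gauss_moment]
    have e2 : Complex.exp (-2 * π ^ 2 * ‖w.1 • w.2‖ ^ 2) =
        ((Real.exp (-2 * π ^ 2 * (w.1 ^ 2 * ‖w.2‖ ^ 2)) : ℝ) : ℂ) := by
      rw [norm_smul, Real.norm_eq_abs, ← sq_abs w.1]; push_cast; congr 1; ring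
    rw [e2, kk, Qk]
    simp only [PiLp.smul_apply, smul_eq_mul]
    push_cast
    ring
  rw [s1, integral_integral_swap iF, integral_prod_symm _ iF.integral_prod_right, ← integral_const_mul]
  refine integral_congr_ae (Eventually.of_forall fun ζ => ?_)
  simp only [s2]
  rw [integral_const_mul, integral_const_mul, integral_mul_const, integral_const_mul, integral_complex_ofReal]
  rfl

lemma rad_lim (ζ : Eu n) : Tendsto (fun ε => rad n ε ζ) (𝓝[>] 0) (𝓝 (√(2 * π) * bes (-1) ζ)) := by
  have e : √(2 * π) * bes (-1) ζ = ∫ r : ℝ, Real.exp (-((1 + ‖(2 * π) • ζ‖ ^ 2) / 2) * r ^ 2) := by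
    rw [integral_gaussian, bes, Real.sqrt_eq_rpow, Real.sqrt_eq_rpow, div_div_eq_mul_div,
      Real.div_rpow (by positivity) (by positivity), neg_div, Real.rpow_neg (by positivity),
      ← div_eq_mul_inv, mul_comm π]
  rw [e]
  refine tendsto_integral_filter_of_dominated_convergence (fun r => (1 + ‖r‖) ^ 0 * Real.exp (-(‖r‖ ^ 2 / 2)))
    (Eventually.of_forall fun ε => (by fun_prop : Measurable _).aestronglyMeasurable) ?_ (gauss_int ℝ 0) ?_
  · refine Eventually.of_forall fun ε => Eventually.of_forall fun r => ?_
    rw [Real.norm_of_nonneg (by positivity), pow_zero, one_mul, Real.norm_eq_abs, sq_abs, mul_assoc]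
    refine mul_le_of_le_one_right (Real.exp_pos _).le (mul_le_one₀ (div_le_one_of_le₀ (by nlinarith [sq_nonneg ε])
      (by positivity)) (Real.exp_pos _).le (Real.exp_le_one_iff.2 ?_))
    have : 0 ≤ π ^ 2 * (r ^ 2 * ‖ζ‖ ^ 2) := by positivity
    linarith
  · filter_upwards [compl_mem_ae_iff.2 (measure_singleton (0 : ℝ))] with r hr
    have hr : r ≠ 0 := hr
    have h1 : Tendsto (fun ε : ℝ => Real.exp (-(r ^ 2 / 2)) * (r ^ 2 / (r ^ 2 + ε ^ 2)) *
        Real.exp (-2 * π ^ 2 * (r ^ 2 * ‖ζ‖ ^ 2))) (𝓝 0) (𝓝 (Real.exp (-(r ^ 2 / 2)) * (r ^ 2 / (r ^ 2 + 0 ^ 2)) *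
        Real.exp (-2 * π ^ 2 * (r ^ 2 * ‖ζ‖ ^ 2)))) := by
      refine Continuous.tendsto' ?_ _ _ rfl
      have : ∀ ε : ℝ, r ^ 2 + ε ^ 2 ≠ 0 := fun ε => by positivity
      fun_prop (disch := assumption)
    convert h1.mono_left nhdsWithin_le_nhds using 2
    rw [zero_pow two_ne_zero, add_zero, div_self (by positivity), mul_one, ← Real.exp_add, norm_smul,
      Real.norm_of_nonneg (by positivity)]
    congr 1; ring

lemma rad_bd (ε : ℝ) (ζ : Eu n) : ‖rad n ε ζ‖ ≤ ∫ r : ℝ, (1 + ‖r‖) ^ 0 * Real.exp (-(‖r‖ ^ 2 / 2)) := by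
  refine norm_integral_le_of_norm_le (gauss_int ℝ 0) (Eventually.of_forall fun r => ?_)
  rw [Real.norm_of_nonneg (by positivity), pow_zero, one_mul, Real.norm_eq_abs, sq_abs, mul_assoc]
  refine mul_le_of_le_one_right (Real.exp_pos _).le (mul_le_one₀ (div_le_one_of_le₀ (by nlinarith [sq_nonneg ε])
    (by positivity)) (Real.exp_pos _).le (Real.exp_le_one_iff.2 ?_))
  have : 0 ≤ π ^ 2 * (r ^ 2 * ‖ζ‖ ^ 2) := by positivity
  linarith

lemma rad_meas (ε : ℝ) : Measurable (rad n ε) := by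
  have : StronglyMeasurable (fun w : Eu n × ℝ => Real.exp (-(w.2 ^ 2 / 2)) * (w.2 ^ 2 / (w.2 ^ 2 + ε ^ 2)) *
    Real.exp (-2 * π ^ 2 * (w.2 ^ 2 * ‖w.1‖ ^ 2))) := (by fun_prop : Measurable _).stronglyMeasurable
  exact this.integral_prod_right.measurable

lemma Tav_lim (l : Fin n) (h : Sw n) (x : Eu n) :
    Tendsto (fun ε => Tav l ε h x) (𝓝[>] 0)
      (𝓝 (-(2 * π) ^ (n / 2 : ℂ) * (√(2 * π) * Fm (rz l) h x))) := by
  have : ∀ᶠ ε in 𝓝[>] (0:ℝ), -(2 * π) ^ (n / 2 : ℂ) * ∫ ζ : Eu n,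
      ee ⟪ζ, x⟫ * ((2 * π * I) * ζ l * rad n ε ζ * (𝓕 h) ζ) = Tav l ε h x := by
    filter_upwards [self_mem_nhdsWithin] with ε hε
    rw [Tav_rep l hε]
  refine Tendsto.congr' this (Tendsto.const_mul _ ?_)
  rw [Fm_apply (rz_tg l), ← integral_const_mul]
  set K := ∫ r : ℝ, (1 + ‖r‖) ^ 0 * Real.exp (-(‖r‖ ^ 2 / 2))
  refine tendsto_integral_filter_of_dominated_convergence (fun ζ => 2 * π * K * (‖ζ‖ ^ 1 * ‖(𝓕 h) ζ‖)) ?_ ?_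
    (((𝓕 h).integrable_pow_mul volume 1).const_mul _) ?_
  · have m := rad_meas (n := n)
    refine Eventually.of_forall fun ε => (by fun_prop : Measurable _).aestronglyMeasurable
  · refine Eventually.of_forall fun ε => Eventually.of_forall fun ζ => ?_
    rw [norm_mul, ee_norm, one_mul, norm_mul, norm_mul, norm_mul, norm_mul, norm_mul, Complex.norm_I,
      Complex.norm_real, Complex.norm_real, Complex.norm_real, Complex.norm_ofNat, Real.norm_of_nonneg pi_pos.le,
      pow_one]
    have h1 := PiLp.norm_apply_le ζ l
    have h2 := rad_bd ε ζ
    calc _ ≤ 2 * π * 1 * ‖ζ‖ * K * ‖(𝓕 h) ζ‖ := by gcongr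
      _ = _ := by ring
  · refine Eventually.of_forall fun ζ => ?_
    have h1 := (Complex.continuous_ofReal.tendsto _).comp (rad_lim ζ)
    have h2 := ((h1.const_mul ((2 * π * I) * ζ l)).mul_const ((𝓕 h) ζ)).const_mul (ee ⟪ζ, x⟫)
    have e : (√(2 * π) : ℂ) * (ee ⟪ζ, x⟫ * (rz l ζ * (𝓕 h) ζ)) =
        ee ⟪ζ, x⟫ * (2 * π * I * ζ l * ((√(2 * π) * bes (-1) ζ : ℝ) : ℂ) * (𝓕 h) ζ) := by
      simp only [rz]; push_cast; ring
    rw [e]; exact h2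

lemma riesz_wlp (l : Fin n) {p : ℝ} (hp : 1 < p) {b : ℝ} (hb : 0 ≤ b) :
    ∃ C : ℝ≥0∞, C ≠ ∞ ∧ ∀ h : Sw n,
    ∫⁻ x, ‖(jw b x : ℂ) * Fm (rz l) h x‖ₑ ^ p ≤ C * ∫⁻ x, ‖(jw b x : ℂ) * h x‖ₑ ^ p := by
  obtain ⟨C, hC, H⟩ := Tav_wlp l hp hb
  set c : ℂ := -(2 * π) ^ (n / 2 : ℂ) * √(2 * π) with hc
  have hc0 : c ≠ 0 := by
    have h1 : (2 * π : ℂ) ≠ 0 := by exact_mod_cast (by positivity : (2 * π : ℝ) ≠ 0)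
    have h2 : (√(2 * π) : ℂ) ≠ 0 := by exact_mod_cast (by positivity : √(2 * π : ℝ) ≠ 0)
    exact mul_ne_zero (neg_ne_zero.2 (by simp [Complex.cpow_eq_zero_iff, h1])) h2
  have hp0 : 0 ≤ p := by linarith
  refine ⟨‖c⁻¹‖ₑ ^ p * C, ENNReal.mul_ne_top (rp_ne enorm_ne_top hp0) hC, fun h => ?_⟩
  set e : ℕ → ℝ := fun k => 1 / ((k : ℝ) + 1)
  have he0 : ∀ k, 0 < e k := fun k => Nat.one_div_pos_of_nat
  have he : Tendsto e atTop (𝓝[>] 0) := tendsto_nhdsWithin_iff.2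
    ⟨tendsto_one_div_add_atTop_nhds_zero_nat, Eventually.of_forall he0⟩
  have l1 : ∀ x, Tendsto (fun k => ‖(jw b x : ℂ) * Tav l (e k) h x‖ₑ ^ p) atTop
      (𝓝 (‖(jw b x : ℂ) * (c * Fm (rz l) h x)‖ₑ ^ p)) := fun x => by
    have := ((Tav_lim l h x).comp he).const_mul (jw b x : ℂ)
    rw [← mul_assoc (-(2 * π : ℂ) ^ (n / 2 : ℂ))] at this
    exact (ENNReal.continuous_rpow_const.tendsto _).comp ((continuous_enorm.tendsto _).comp this)
  have jc := jw_cont (n := n) b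
  have fat : ∫⁻ x, ‖(jw b x : ℂ) * (c * Fm (rz l) h x)‖ₑ ^ p ≤ C * ∫⁻ x, ‖(jw b x : ℂ) * h x‖ₑ ^ p := by
    calc _ = ∫⁻ x, liminf (fun k => ‖(jw b x : ℂ) * Tav l (e k) h x‖ₑ ^ p) atTop :=
          lintegral_congr fun x => (l1 x).liminf_eq.symm
      _ ≤ liminf (fun k => ∫⁻ x, ‖(jw b x : ℂ) * Tav l (e k) h x‖ₑ ^ p) atTop := by
          refine lintegral_liminf_le' fun k => ?_
          have : StronglyMeasurable (Tav l (e k) h) := by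
            have im := inner_meas (ε := e k) h.continuous.measurable
            refine StronglyMeasurable.integral_prod_right' (f := fun w : Eu n × Eu n =>
              ((w.2 l * Real.exp (-(‖w.2‖ ^ 2 / 2)) : ℝ) : ℂ) * ∫ r : ℝ, (kk (e k) r : ℂ) * h (w.1 - r • w.2)) ?_
            exact (Measurable.mul (by fun_prop) im).stronglyMeasurable
          have := this.measurable
          fun_prop
      _ ≤ _ := by
          refine liminf_le_of_le (by isBoundedDefault) fun B hB => ?_
          obtain ⟨k, hk⟩ := hB.exists
          refine hk.trans (H (e k) (he0 k) ?_ h)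
          exact div_le_one_of_le₀ (by linarith [Nat.cast_nonneg (α := ℝ) k]) (by positivity)
  rw [mul_assoc]
  refine le_trans ?_ (mul_le_mul_right fat _)
  rw [← lintegral_const_mul' _ _ (rp_ne enorm_ne_top hp0)]
  refine lintegral_mono fun x => ?_
  rw [← rpm _ _ hp0, ← enorm_mul]
  refine le_of_eq ?_
  congr 2; field_simp

end KP

namespace KP
open Set Filter Topology
set_option linter.unusedSectionVars false
section ker
variable {V : Type*} [NormedAddCommGroup V] [NormedSpace ℝ V] [FiniteDimensional ℝ V]
  [MeasurableSpace V] [BorelSpace V] (μ : Measure V) [μ.IsAddHaarMeasure] (L : V →L[ℝ] V →L[ℝ] ℝ)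

lemma cov (D : V ≃L[ℝ] V) : ∃ c : ℝ, 0 < c ∧ ∀ g : V → ℂ, ∫ v, g (D v) ∂μ = c • ∫ v, g v ∂μ := by
  have h0 : LinearMap.det (D : V →ₗ[ℝ] V) ≠ 0 := D.toLinearEquiv.isUnit_det'.ne_zero
  refine ⟨|(LinearMap.det (D : V →ₗ[ℝ] V))⁻¹|, abs_pos.2 (inv_ne_zero h0), fun g => ?_⟩
  have h1 := Measure.map_linearMap_addHaar_eq_smul_addHaar μ h0
  have h2 : ∫ v, g v ∂(μ.map D) = ∫ v, g (D v) ∂μ :=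
    D.toHomeomorph.measurableEmbedding.integral_map g
  rw [← h2, show (⇑D : V → V) = ⇑(D : V →ₗ[ℝ] V) from rfl, h1, integral_smul_measure,
    ENNReal.toReal_ofReal (abs_nonneg _)]

def kk' (N : V → ℂ) (Y : V) : ℂ := ∫ ξ, ee (L ξ Y) * N ξ ∂μ

lemma gen_bd {N U : V → ℂ} (hN : Continuous N) (hc : HasCompactSupport N)
    (hU : Continuous U) (hUi : Integrable U μ) (D : V ≃L[ℝ] V) (hD : ∀ ξ Y, L (D ξ) Y = L ξ (D Y)) (X : V) :
    ‖∫ ξ, N (D ξ) * (ee (L ξ X) * ∫ Y, ee (-L ξ Y) * U Y ∂μ) ∂μ‖ₑ ≤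
      ∫⁻ Y, ‖kk' μ L N Y‖ₑ * ‖U (X - D Y)‖ₑ ∂μ := by
  obtain ⟨c, hc0, h⟩ := cov μ D
  have e1 : ∀ ξ, ee (L ξ X) * ∫ Y, ee (-L ξ Y) * U Y ∂μ =
      (c⁻¹ : ℝ) • ∫ Y, ee (L (D ξ) Y) * U (X - D Y) ∂μ := by
    intro ξ
    have := h fun Y => ee (L ξ Y) * U (X - Y)
    simp only [hD]
    rw [this, smul_smul, inv_mul_cancel₀ hc0.ne', one_smul, ← integral_const_mul,
      ← integral_sub_left_eq_self _ μ X]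
    congr 1; ext Y
    rw [← mul_assoc, ← ee_add]; simp
  simp only [e1]
  have e2 := h fun ξ => N ξ * ((c⁻¹ : ℝ) • ∫ Y, ee (L ξ Y) * U (X - D Y) ∂μ)
  rw [e2]
  have e3 : c • ∫ ξ, N ξ * ((c⁻¹ : ℝ) • ∫ Y, ee (L ξ Y) * U (X - D Y) ∂μ) ∂μ =
      ∫ ξ, ∫ Y, N ξ * (ee (L ξ Y) * U (X - D Y)) ∂μ ∂μ := by
    rw [← integral_smul]; congr 1; ext ξ
    rw [integral_const_mul, mul_smul_comm, smul_smul, mul_inv_cancel₀ hc0.ne', one_smul]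
  rw [e3, integral_integral_swap]
  · refine (enorm_integral_le_lintegral_enorm _).trans (lintegral_mono fun Y => le_of_eq ?_)
    rw [← enorm_mul, kk', ← integral_mul_const]
    congr 2; ext ξ; ring
  · have hU' : Integrable (fun Y => U (X - D Y)) μ := by
      have := (hUi.comp_sub_left X)
      have h5 : Integrable (fun v => U (X - v)) (μ.map D) := by
        rw [show (⇑D : V → V) = ⇑(D : V →ₗ[ℝ] V) from rfl,
          Measure.map_linearMap_addHaar_eq_smul_addHaar μ D.toLinearEquiv.isUnit_det'.ne_zero]
        exact this.smul_measure ENNReal.ofReal_ne_top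
      exact (D.toHomeomorph.measurableEmbedding.integrable_map_iff).1 h5
    refine ((hN.integrable_of_hasCompactSupport hc).mul_prod hU').mono ?_ (ae_of_all _ fun z => ?_)
    · refine Continuous.aestronglyMeasurable ?_
      have : Continuous fun z : V × V => L z.1 z.2 := L.continuous₂
      simp only [Function.uncurry_def]; fun_prop
    · simp [Function.uncurry]

variable {P : Type*} [NormedAddCommGroup P] [NormedSpace ℝ P]

lemma slice_bd {Ψ : P × V → ℂ} (hΨ : ContDiff ℝ (⊤ : ℕ∞) Ψ) {K : Set P} (hK : IsCompact K) (R : ℝ) (i : ℕ) :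
    ∃ C, 0 ≤ C ∧ ∀ q ∈ K, ∀ v, ‖v‖ ≤ R → ‖iteratedFDeriv ℝ i (fun v => Ψ (q, v)) v‖ ≤ C := by
  have hc : Continuous fun z => ‖iteratedFDeriv ℝ i Ψ z‖ :=
    (hΨ.continuous_iteratedFDeriv (by exact_mod_cast le_top)).norm
  obtain ⟨C, hC⟩ := (hK.prod (isCompact_closedBall (0 : V) R)).exists_bound_of_continuousOn hc.continuousOn
  refine ⟨|C| * ∏ _i : Fin i, ‖ContinuousLinearMap.inr ℝ P V‖, by positivity, fun q hq v hv => ?_⟩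
  have h1 : (fun v => Ψ (q, v)) = (fun z => Ψ ((q, 0) + z)) ∘ ContinuousLinearMap.inr ℝ P V := by
    ext v; simp
  have h2 : ContDiff ℝ (⊤ : ℕ∞) (fun z => Ψ ((q, 0) + z)) := hΨ.comp (contDiff_const.add contDiff_id)
  rw [h1, ContinuousLinearMap.iteratedFDeriv_comp_right _ h2 _ (i := i) (by exact_mod_cast le_top)]
  refine (ContinuousMultilinearMap.norm_compContinuousLinearMap_le _ _).trans ?_
  gcongr
  rw [iteratedFDeriv_comp_add_left]
  have := hC (q, v) ⟨hq, by simpa using hv⟩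
  simp only [norm_norm] at this
  refine le_trans ?_ (this.trans (le_abs_self C))
  simp

lemma ker_pow (hL : ∀ w, ‖w‖ ^ 2 ≤ L w w) {Ψ : P × V → ℂ} (hΨ : ContDiff ℝ (⊤ : ℕ∞) Ψ) {K : Set P}
    (hK : IsCompact K) {R : ℝ} (hR : ∀ q ∈ K, ∀ v, R ≤ ‖v‖ → Ψ (q, v) = 0) (m : ℕ) :
    ∃ C, 0 ≤ C ∧ ∀ q ∈ K, ∀ Y, ‖Y‖ ^ m * ‖kk' μ L (fun v => Ψ (q, v)) Y‖ ≤ C := by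
  choose B hB0 hB using fun i => slice_bd hΨ hK R i
  set W := (2 : ℝ) ^ m * ∑ i ∈ Finset.range (m + 1), B i * μ.real (Metric.closedBall 0 R) with hW
  have hW0 : 0 ≤ W := mul_nonneg (by positivity)
    (Finset.sum_nonneg fun i _ => mul_nonneg (hB0 i) measureReal_nonneg)
  refine ⟨W, hW0, fun q hq Y => ?_⟩
  have hs : ContDiff ℝ (⊤ : ℕ∞) (fun v => Ψ (q, v)) := hΨ.comp (contDiff_const.prodMk contDiff_id)
  have hcs : HasCompactSupport (fun v => Ψ (q, v)) := by
    refine HasCompactSupport.intro (isCompact_closedBall (0 : V) R) fun v hv => hR q hq v ?_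
    simp at hv; exact hv.le
  have hsi : ∀ i : ℕ, ∀ v, R < ‖v‖ → iteratedFDeriv ℝ i (fun v => Ψ (q, v)) v = 0 := by
    intro i v hv
    have : (fun v => Ψ (q, v)) =ᶠ[𝓝 v] fun _ => 0 := by
      filter_upwards [continuous_norm.continuousAt.eventually (lt_mem_nhds hv)] with u hu using hR q hq u hu.le
    rw [this.iteratedFDeriv ℝ i |>.self_of_nhds]
    exact congrFun (iteratedFDeriv_fun_zero) v
  have hci : ∀ i : ℕ, Continuous fun v => ‖iteratedFDeriv ℝ i (fun v => Ψ (q, v)) v‖ := fun i =>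
    (hs.continuous_iteratedFDeriv (by exact_mod_cast le_top)).norm
  have hint : ∀ k i : ℕ, Integrable (fun v => ‖v‖ ^ k * ‖iteratedFDeriv ℝ i (fun v => Ψ (q, v)) v‖) μ := by
    intro k i
    refine Continuous.integrable_of_hasCompactSupport ((continuous_norm.pow k).mul (hci i)) ?_
    refine HasCompactSupport.intro (isCompact_closedBall (0 : V) R) fun v hv => ?_
    rw [hsi i v (by simpa using hv)]; simp
  have key := VectorFourier.pow_mul_norm_iteratedFDeriv_fourierIntegral_le (μ := μ) L (K := ⊤) (N := ⊤) hs
    (fun k i _ _ => hint k i) (k := 0) (n := m) le_top le_top (-Y) (-Y)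
  have h2 : VectorFourier.fourierIntegral Real.fourierChar μ L.toLinearMap₁₂ (fun v => Ψ (q, v)) (-Y) =
      kk' μ L (fun v => Ψ (q, v)) Y := by
    rw [VectorFourier.fourierIntegral, kk']; congr 1; ext ξ
    rw [Circle.smul_def, Real.fourierChar_apply, ee, smul_eq_mul]; simp
  rw [norm_iteratedFDeriv_zero, h2] at key
  simp only [map_neg, neg_apply, neg_neg, norm_neg, pow_zero, mul_one, zero_add, Finset.range_one,
    Finset.singleton_product, Finset.sum_map, Function.Embedding.coeFn_mk, one_mul, Nat.cast_zero, mul_zero] at key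
  have h3 : ∑ i ∈ Finset.range (m + 1), ∫ v, ‖iteratedFDeriv ℝ i (fun v => Ψ (q, v)) v‖ ∂μ ≤
      ∑ i ∈ Finset.range (m + 1), B i * μ.real (Metric.closedBall 0 R) := by
    refine Finset.sum_le_sum fun i _ => ?_
    rw [← setIntegral_eq_integral_of_forall_compl_eq_zero (s := Metric.closedBall 0 R)]
    · refine (Real.le_norm_self _).trans ((norm_setIntegral_le_of_norm_le_const (C := B i) measure_closedBall_lt_top
        fun v hv => ?_).trans le_rfl)
      rw [norm_norm]; exact hB i q hq v (by simpa using hv)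
    · intro v hv; rw [hsi i v (by simpa using hv)]; simp
  have h4 : (‖Y‖ ^ 2) ^ m * ‖kk' μ L (fun v => Ψ (q, v)) Y‖ ≤ ‖Y‖ ^ m * W := by
    calc _ ≤ |L Y Y| ^ m * ‖kk' μ L (fun v => Ψ (q, v)) Y‖ := by
          gcongr; exact (hL Y).trans (le_abs_self _)
      _ ≤ _ := key
      _ ≤ _ := by rw [mul_assoc, hW]; gcongr
  rcases eq_or_ne (‖Y‖ ^ m) 0 with h0 | h0
  · rw [h0, zero_mul]; exact hW0
  · have h0' : 0 < ‖Y‖ ^ m := lt_of_le_of_ne (by positivity) h0.symm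
    refine le_of_mul_le_mul_left ?_ h0'
    calc _ = (‖Y‖ ^ 2) ^ m * ‖kk' μ L (fun v => Ψ (q, v)) Y‖ := by ring
      _ ≤ _ := h4

lemma ker_bd (hL : ∀ w, ‖w‖ ^ 2 ≤ L w w) {Ψ : P × V → ℂ} (hΨ : ContDiff ℝ (⊤ : ℕ∞) Ψ) {K : Set P}
    (hK : IsCompact K) {R : ℝ} (hR : ∀ q ∈ K, ∀ v, R ≤ ‖v‖ → Ψ (q, v) = 0) (m : ℕ) :
    ∃ C, 0 ≤ C ∧ ∀ q ∈ K, ∀ Y, ‖kk' μ L (fun v => Ψ (q, v)) Y‖ₑ ≤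
      ENNReal.ofReal C * ENNReal.ofReal ((1 + ‖Y‖) ^ m)⁻¹ := by
  obtain ⟨C0, hC0, h0⟩ := ker_pow μ L hL hΨ hK hR 0
  obtain ⟨C1, hC1, h1⟩ := ker_pow μ L hL hΨ hK hR m
  refine ⟨2 ^ m * (C0 + C1), by positivity, fun q hq Y => ?_⟩
  rw [← ENNReal.ofReal_mul (by positivity), ← ofReal_norm]
  refine ENNReal.ofReal_le_ofReal ?_
  rw [← div_eq_mul_inv, le_div_iff₀ (by positivity), mul_comm]
  have h3 : (1 + ‖Y‖) ^ m ≤ 2 ^ m * (1 + ‖Y‖ ^ m) := by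
    rcases le_total ‖Y‖ 1 with h | h
    · calc _ ≤ (2 : ℝ) ^ m := by gcongr; linarith
        _ ≤ _ := le_mul_of_one_le_right (by positivity) (by linarith [pow_nonneg (norm_nonneg Y) m])
    · calc _ ≤ (2 * ‖Y‖) ^ m := by gcongr; linarith
        _ ≤ _ := by rw [mul_pow]; gcongr; linarith
  calc _ ≤ 2 ^ m * (1 + ‖Y‖ ^ m) * ‖kk' μ L (fun v => Ψ (q, v)) Y‖ := by gcongr
    _ = 2 ^ m * (‖Y‖ ^ 0 * ‖kk' μ L (fun v => Ψ (q, v)) Y‖ + ‖Y‖ ^ m * ‖kk' μ L (fun v => Ψ (q, v)) Y‖) := by ring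
    _ ≤ _ := by gcongr; exacts [h0 q hq Y, h1 q hq Y]
end ker
end KP

namespace KP
open Set Filter Topology
section je
variable {V : Type*} [NormedAddCommGroup V]

def je (y : V) : ℝ≥0∞ := 1 + ‖y‖ₑ

lemma je_ne0 (y : V) : je y ≠ 0 := by simp [je]
lemma je_net (y : V) : je y ≠ ∞ := by simp [je]
lemma je_one (y : V) : 1 ≤ je y := by simp [je]
lemma je_add (y : V) (s t : ℝ) : je y ^ (s + t) = je y ^ s * je y ^ t :=
  ENNReal.rpow_add _ _ (je_ne0 y) (je_net y)
lemma je_mono (y : V) {s t : ℝ} (h : s ≤ t) : je y ^ s ≤ je y ^ t :=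
  ENNReal.rpow_le_rpow_of_exponent_le (je_one y) h
lemma je_eq (y : V) : je y = ENNReal.ofReal (1 + ‖y‖) := by
  rw [je, ENNReal.ofReal_add zero_le_one (norm_nonneg _), ofReal_norm]; simp
lemma je_mul (y z : V) : je (y + z) ≤ je y * je z := by
  rw [je, je, je]
  calc 1 + ‖y + z‖ₑ ≤ 1 + (‖y‖ₑ + ‖z‖ₑ) := by gcongr; exact enorm_add_le _ _
    _ ≤ (1 + (‖y‖ₑ + ‖z‖ₑ)) + ‖y‖ₑ * ‖z‖ₑ := le_self_add
    _ = _ := by ring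
@[fun_prop] lemma je_meas [MeasurableSpace V] [BorelSpace V] : Measurable (je : V → ℝ≥0∞) := by
  unfold je; fun_prop
lemma je_real (y : V) (t : ℝ) : je y ^ t = ENNReal.ofReal ((1 + ‖y‖) ^ t) := by
  rw [je_eq, ENNReal.ofReal_rpow_of_pos (by positivity)]
lemma je_int [NormedSpace ℝ V] [FiniteDimensional ℝ V] [MeasurableSpace V] [BorelSpace V] (μ : Measure V)
    [μ.IsAddHaarMeasure] {t : ℝ} (ht : Module.finrank ℝ V < t) : ∫⁻ y : V, je y ^ (-t) ∂μ ≠ ∞ := by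
  simp only [je_real]; exact (finite_integral_one_add_norm ht).ne
end je
variable {n : ℕ}

def Av (j : ℕ) (m : ℝ) (F : Eu n → ℝ≥0∞) (x : Eu n) : ℝ≥0∞ :=
  ∫⁻ y, je y ^ (-m) * F (x - ((2:ℝ) ^ j)⁻¹ • y)

def Slow (j : ℕ) (m : ℝ) (Φ : Eu n → ℝ≥0∞) : Prop := ∀ x y, Φ (x - ((2:ℝ) ^ j)⁻¹ • y) ≤ je y ^ m * Φ x

lemma Av_meas (j : ℕ) (m : ℝ) {F : Eu n → ℝ≥0∞} (hF : Measurable F) : Measurable (Av j m F) := by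
  unfold Av; apply Measurable.lintegral_prod_right'
    (f := fun z : Eu n × Eu n => je z.2 ^ (-m) * F (z.1 - ((2:ℝ) ^ j)⁻¹ • z.2)); fun_prop

lemma Av_slow (j : ℕ) {m : ℝ} (hm : 0 ≤ m) (F : Eu n → ℝ≥0∞) : Slow j m (Av j m F) := by
  intro x z
  rw [Av, Av, ← lintegral_const_mul' _ _ (ENNReal.rpow_ne_top_of_nonneg hm (je_net z)),
    ← lintegral_sub_right_eq_self _ z]
  refine lintegral_mono fun y => ?_
  rw [← mul_assoc, show x - ((2:ℝ) ^ j)⁻¹ • z - ((2:ℝ) ^ j)⁻¹ • (y - z) = x - ((2:ℝ) ^ j)⁻¹ • y by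
    rw [smul_sub]; abel]
  gcongr
  have h1 : je y ^ m ≤ je (y - z) ^ m * je z ^ m := by
    rw [← rpm _ _ hm]; gcongr; simpa using je_mul (y - z) z
  calc je (y - z) ^ (-m) = je (y - z) ^ (-m) * (je y ^ m * je y ^ (-m)) := by rw [← je_add]; simp
    _ ≤ je (y - z) ^ (-m) * ((je (y - z) ^ m * je z ^ m) * je y ^ (-m)) := by gcongr
    _ = (je (y - z) ^ (-m) * je (y - z) ^ m) * (je z ^ m * je y ^ (-m)) := by ring
    _ = _ := by rw [← je_add]; simp

lemma Slow.min {j : ℕ} {m : ℝ} {Φ Γ : Eu n → ℝ≥0∞} (h : Slow j m Φ) (h' : Slow j m Γ) :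
    Slow j m fun x => min (Φ x) (Γ x) := by
  intro x y
  rw [mul_min]; exact min_le_min (h x y) (h' x y)

lemma Slow.cmul {j : ℕ} {m : ℝ} {Φ : Eu n → ℝ≥0∞} (h : Slow j m Φ) (c : ℝ≥0∞) :
    Slow j m fun x => c * Φ x := by
  intro x y
  calc _ ≤ c * (je y ^ m * Φ x) := mul_le_mul_right (h x y) _
    _ = _ := by ring

def we (b : ℝ) (x : Eu n) : ℝ≥0∞ := ENNReal.ofReal (jw b x)

@[fun_prop] lemma we_meas (b : ℝ) : Measurable (we (n := n) b) := (jw_cont b).measurable.ennreal_ofReal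

lemma we_le {b : ℝ} (hb : 0 ≤ b) (x v : Eu n) : we b x ≤ je v ^ b * we b (x - v) := by
  rw [we, we, je_real, ← ENNReal.ofReal_mul (by positivity)]
  exact ENNReal.ofReal_le_ofReal (jw_le hb x v)

lemma cj_le (j : ℕ) (y : Eu n) : je (((2:ℝ) ^ j)⁻¹ • y) ≤ je y := by
  rw [je, je]; gcongr
  rw [enorm_smul]
  refine mul_le_of_le_one_left (by positivity) ?_
  rw [← ofReal_norm, ENNReal.ofReal_le_one, norm_inv, norm_pow, Real.norm_ofNat]
  exact inv_le_one_of_one_le₀ (one_le_pow₀ one_le_two)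

def Wn (p : ℝ≥0∞) (b : ℝ) (u : Eu n → ℝ≥0∞) : ℝ≥0∞ := eLpNorm (fun x => we b x * u x) p volume

lemma Wn_mono (p : ℝ≥0∞) (b : ℝ) {u v : Eu n → ℝ≥0∞} (h : ∀ x, u x ≤ v x) : Wn p b u ≤ Wn p b v :=
  eLpNorm_mono_enorm fun x => by simp only [enorm_eq_self]; gcongr; exact h x

lemma Wn_fin {p : ℝ} (hp : 0 < p) (b : ℝ) (u : Eu n → ℝ≥0∞) :
    Wn (ENNReal.ofReal p) b u = (∫⁻ x, (we b x * u x) ^ p) ^ (1 / p) := by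
  rw [Wn, eLpNorm_eq_lintegral_rpow_enorm_toReal (by simpa using hp) (by simp), ENNReal.toReal_ofReal hp.le]
  simp

lemma Wn_top (b : ℝ) (u : Eu n → ℝ≥0∞) : Wn ∞ b u = essSup (fun x => we b x * u x) volume := by
  rw [Wn, eLpNorm_exponent_top, eLpNormEssSup]; simp

lemma Wn_cmul (p : ℝ≥0∞) (b : ℝ) {C : ℝ≥0∞} (hC : C ≠ ∞) (u : Eu n → ℝ≥0∞) :
    Wn p b (fun x => C * u x) ≤ C * Wn p b u := by
  lift C to ℝ≥0 using hC
  exact eLpNorm_le_nnreal_smul_eLpNorm_of_ae_le_mul' (ae_of_all _ fun x => by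
    simp only [enorm_eq_self]; exact le_of_eq (by ring)) p

lemma Av_we {b m : ℝ} (hb : 0 ≤ b) (j : ℕ) (F : Eu n → ℝ≥0∞) (x : Eu n) : we b x * Av j m F x ≤
    ∫⁻ y, je y ^ (-(m - b)) * (we b (x - ((2:ℝ) ^ j)⁻¹ • y) * F (x - ((2:ℝ) ^ j)⁻¹ • y)) := by
  rw [Av, ← lintegral_const_mul' _ _ (by simp [we])]
  refine lintegral_mono fun y => ?_
  have h1 := (we_le hb x (((2:ℝ) ^ j)⁻¹ • y)).trans (mul_le_mul_left (rpl (cj_le j y) hb) _)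
  calc _ ≤ (je y ^ b * we b (x - ((2:ℝ) ^ j)⁻¹ • y)) * (je y ^ (-m) * F (x - ((2:ℝ) ^ j)⁻¹ • y)) := by gcongr
    _ = (je y ^ b * je y ^ (-m)) * (we b (x - ((2:ℝ) ^ j)⁻¹ • y) * F (x - ((2:ℝ) ^ j)⁻¹ • y)) := by ring
    _ = _ := by rw [← je_add]; congr 2; ring

lemma Av_lp {b m : ℝ} (hb : 0 ≤ b) (hm : n + b < m) : ∃ C : ℝ≥0∞, C ≠ ∞ ∧ ∀ (p : ℝ≥0∞), 1 ≤ p →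
    ∀ (j : ℕ) (F : Eu n → ℝ≥0∞), Measurable F → Wn p b (Av j m F) ≤ C * Wn p b F := by
  refine ⟨∫⁻ y : Eu n, je y ^ (-(m - b)), je_int _ (by simp; linarith), fun p hp j F hF => ?_⟩
  rcases eq_or_ne p ∞ with rfl | hpt
  · rw [Wn_top, Wn_top]
    refine essSup_le_of_ae_le _ (ae_of_all _ fun x => (Av_we hb j F x).trans ?_)
    rw [← lintegral_mul_const _ (by fun_prop)]
    refine lintegral_mono_ae ?_
    have h1 := ENNReal.ae_le_essSup (μ := volume) (fun x : Eu n => we b x * F x)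
    have h2 : Measure.QuasiMeasurePreserving (fun y : Eu n => x - ((2:ℝ) ^ j)⁻¹ • y) volume volume :=
      (quasiMeasurePreserving_sub_left volume x).comp
        (Measure.quasiMeasurePreserving_smul volume (by positivity))
    filter_upwards [h2.ae h1] with y hy
    gcongr
  · obtain ⟨q, rfl⟩ : ∃ q : ℝ, p = ENNReal.ofReal q := ⟨p.toReal, (ENNReal.ofReal_toReal hpt).symm⟩
    have hq : 1 ≤ q := by simpa using hp
    have hq0 : 0 < q := by linarith
    rw [Wn_fin hq0, Wn_fin hq0]
    have := young_gen (volume : Measure (Eu n)) (volume : Measure (Eu n)) hq (k := fun y => je y ^ (-(m - b)))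
      (T := fun y => ((2:ℝ) ^ j)⁻¹ • y) (u := fun x => we b x * F x) (by fun_prop) (by fun_prop) (by fun_prop)
    calc _ ≤ (∫⁻ x, (∫⁻ y, je y ^ (-(m - b)) * (we b (x - ((2:ℝ) ^ j)⁻¹ • y) *
          F (x - ((2:ℝ) ^ j)⁻¹ • y))) ^ q) ^ (1 / q) := by
          gcongr with x; exact Av_we hb j F x
      _ ≤ _ := rpl this (by positivity)
      _ = _ := by
          rw [rpm _ _ (by positivity), ← ENNReal.rpow_mul, mul_one_div_cancel hq0.ne',
            ENNReal.rpow_one]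

lemma Wn_holder {p p₁ p₂ : ℝ≥0∞} (hp0 : p ≠ 0) (hp1 : p₁ ≠ 0) (hp2 : p₂ ≠ 0) (hp2' : p₂ ≠ ∞)
    (hexp : 1 / p = 1 / p₁ + 1 / p₂) (b₁ b₂ : ℝ) {u v : Eu n → ℝ≥0∞} (hu : Measurable u) (hv : Measurable v) :
    Wn p (b₁ + b₂) (fun x => u x * v x) ≤ Wn p₁ b₁ u * Wn p₂ b₂ v := by
  have hw : ∀ x : Eu n, we (b₁ + b₂) x * (u x * v x) = (we b₁ x * u x) * (we b₂ x * v x) := by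
    intro x
    have : we (b₁ + b₂) x = we b₁ x * we b₂ x := by
      rw [we, we, we, ← ENNReal.ofReal_mul (jw_pos _ _).le]
      congr 1; rw [jw, jw, jw, ← Real.rpow_add (by positivity)]; congr 1; ring
    rw [this]; ring
  obtain ⟨r, rfl⟩ : ∃ r : ℝ, p₂ = ENNReal.ofReal r := ⟨p₂.toReal, (ENNReal.ofReal_toReal hp2').symm⟩
  have hr : 0 < r := by simpa using hp2
  rcases eq_or_ne p₁ ∞ with rfl | h1
  · have : p = ENNReal.ofReal r := by simpa using hexp
    rw [this, Wn_top, Wn_fin hr, Wn_fin hr]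
    set M := essSup (fun x => we b₁ x * u x) volume
    calc _ ≤ (∫⁻ x, M ^ r * (we b₂ x * v x) ^ r) ^ (1 / r) := by
          refine rpl (lintegral_mono_ae ?_) (by positivity)
          filter_upwards [ENNReal.ae_le_essSup (μ := volume) (fun x : Eu n => we b₁ x * u x)] with x hx
          rw [hw, ← rpm _ _ hr.le]; gcongr
      _ = _ := by
          rw [lintegral_const_mul _ (by fun_prop), rpm _ _ (by positivity),
            ← ENNReal.rpow_mul, mul_one_div_cancel hr.ne', ENNReal.rpow_one]
  · obtain ⟨q, rfl⟩ : ∃ q : ℝ, p₁ = ENNReal.ofReal q := ⟨p₁.toReal, (ENNReal.ofReal_toReal h1).symm⟩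
    have hq : 0 < q := by simpa using hp1
    have hpt : p ≠ ∞ := by
      rintro rfl; simp at hexp; have := hexp.symm; simp at this
    obtain ⟨t, rfl⟩ : ∃ t : ℝ, p = ENNReal.ofReal t := ⟨p.toReal, (ENNReal.ofReal_toReal hpt).symm⟩
    have ht : 0 < t := by simpa using hp0
    have he : 1 / t = 1 / q + 1 / r := by
      have := congrArg ENNReal.toReal hexp
      rw [ENNReal.toReal_add (by simp; exact hq) (by simp; exact hr)] at this
      simpa [ENNReal.toReal_ofReal, ht.le, hq.le, hr.le] using this
    rw [Wn_fin ht, Wn_fin hq, Wn_fin hr]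
    have hlt : t < q := by
      refine lt_of_one_div_lt_one_div hq ?_
      have : 0 < 1 / r := by positivity
      linarith
    have := ENNReal.lintegral_Lp_mul_le_Lq_mul_Lr ht hlt he volume (f := fun x : Eu n => we b₁ x * u x)
      (g := fun x => we b₂ x * v x) (by fun_prop) (by fun_prop)
    simpa only [hw, Pi.mul_apply] using this
end KP

namespace KP
open Set Filter Topology FourierTransform
variable {n : ℕ}

def ph (ζ : Eu n) : ℝ := Real.smoothTransition ((4 - ‖ζ‖ ^ 2) / 3)

lemma ph_cd : ContDiff ℝ (⊤ : ℕ∞) (ph (n := n)) :=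
  Real.smoothTransition.contDiff.comp ((contDiff_const.sub (contDiff_norm_sq ℝ)).div_const _)
lemma ph_one {ζ : Eu n} (h : ‖ζ‖ ≤ 1) : ph ζ = 1 :=
  Real.smoothTransition.one_of_one_le (by nlinarith [norm_nonneg ζ])
lemma ph_zero {ζ : Eu n} (h : 2 ≤ ‖ζ‖) : ph ζ = 0 :=
  Real.smoothTransition.zero_of_nonpos (by nlinarith [norm_nonneg ζ])
lemma ph_nn (ζ : Eu n) : 0 ≤ ph ζ := Real.smoothTransition.nonneg _
lemma ph_le (ζ : Eu n) : ph ζ ≤ 1 := Real.smoothTransition.le_one _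

def phj (j : ℕ) (ζ : Eu n) : ℝ := ph (((2:ℝ) ^ j)⁻¹ • ζ)

def pa (ζ : Eu n) : ℝ := ph ζ - ph ((2:ℝ) • ζ)

def ps : ℕ → Eu n → ℝ
  | 0 => ph
  | j + 1 => fun ζ => pa (((2:ℝ) ^ (j + 1))⁻¹ • ζ)

lemma ps_sum (J : ℕ) (ζ : Eu n) : ∑ j ∈ Finset.range (J + 1), ps j ζ = phj J ζ := by
  induction J with
  | zero => simp [ps, phj]
  | succ J ih =>
    rw [Finset.sum_range_succ, ih]; simp only [ps, pa, phj, smul_smul]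
    rw [show (2:ℝ) * (2 ^ (J + 1))⁻¹ = (2 ^ J)⁻¹ by rw [pow_succ]; field_simp]; ring

lemma pa_cd : ContDiff ℝ (⊤ : ℕ∞) (pa (n := n)) := ph_cd.sub (ph_cd.comp (contDiff_const_smul _))
lemma pa_zero {ζ : Eu n} (h : ‖ζ‖ ≤ 1 / 2 ∨ 2 ≤ ‖ζ‖) : pa ζ = 0 := by
  rw [pa]
  rcases h with h | h
  · rw [ph_one (by linarith), ph_one (by rw [norm_smul]; norm_num; linarith)]; simp
  · rw [ph_zero h, ph_zero (by rw [norm_smul]; norm_num; linarith)]; simp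

lemma ps_cd (j : ℕ) : ContDiff ℝ (⊤ : ℕ∞) (ps (n := n) j) := by
  cases j with
  | zero => exact ph_cd
  | succ j => exact pa_cd.comp (contDiff_const_smul _)

lemma nsm (j : ℕ) (ζ : Eu n) : ‖((2:ℝ) ^ j)⁻¹ • ζ‖ = ((2:ℝ) ^ j)⁻¹ * ‖ζ‖ := by
  rw [norm_smul]; norm_num

lemma ps_zero {j : ℕ} {ζ : Eu n} (h : 2 ≤ ‖((2:ℝ) ^ j)⁻¹ • ζ‖) : ps j ζ = 0 := by
  cases j with
  | zero => exact ph_zero (by simpa using h)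
  | succ j => exact pa_zero (Or.inr h)

lemma ps_cs (j : ℕ) : HasCompactSupport (ps (n := n) j) := by
  refine HasCompactSupport.intro (isCompact_closedBall (0 : Eu n) (2 * 2 ^ j)) fun v hv => ps_zero ?_
  simp at hv
  rw [nsm, inv_mul_eq_div, le_div_iff₀ (by positivity)]; exact hv.le

def rr (e r : ℝ) : ℝ := Real.smoothTransition (32 * r - 1) * r ^ e

lemma rr_cd (e : ℝ) : ContDiff ℝ (⊤ : ℕ∞) (rr e) := by
  rw [contDiff_iff_contDiffAt]; intro r
  have h1 : ContDiff ℝ (⊤ : ℕ∞) fun r : ℝ => Real.smoothTransition (32 * r - 1) :=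
    Real.smoothTransition.contDiff.comp (by fun_prop)
  rcases lt_or_ge r (1 / 32) with h | h
  · have : rr e =ᶠ[𝓝 r] fun _ => 0 := by
      filter_upwards [gt_mem_nhds h] with u hu
      rw [rr, Real.smoothTransition.zero_of_nonpos (by linarith), zero_mul]
    exact contDiffAt_const.congr_of_eventuallyEq this
  · exact h1.contDiffAt.mul (Real.contDiffAt_rpow_const_of_ne (by linarith))

lemma rr_eq (e : ℝ) {r : ℝ} (h : 1 / 16 ≤ r) : rr e r = r ^ e := by
  rw [rr, Real.smoothTransition.one_of_one_le (by linarith), one_mul]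

def Hom (τ : ℝ) (P : Eu n → ℂ) : Prop := ∃ Q : ℝ × Eu n → ℂ, ContDiff ℝ (⊤ : ℕ∞) Q ∧
  ∀ l : ℝ, 0 < l → l ≤ 1 → ∀ ζ, 1 / 2 ≤ ‖l • ζ‖ → P ζ = ((l ^ (-τ) : ℝ) : ℂ) * Q (l, l • ζ)

lemma Hom.mul {τ σ : ℝ} {P R : Eu n → ℂ} (h : Hom τ P) (h' : Hom σ R) : Hom (τ + σ) fun ζ => P ζ * R ζ := by
  obtain ⟨Q, hQ, h⟩ := h
  obtain ⟨Q', hQ', h'⟩ := h'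
  refine ⟨fun z => Q z * Q' z, hQ.mul hQ', fun l h0 h1 ζ hz => ?_⟩
  simp only
  rw [h l h0 h1 ζ hz, h' l h0 h1 ζ hz, neg_add, Real.rpow_add h0]; push_cast; ring

lemma hom_const (c : ℂ) : Hom (n := n) 0 fun _ => c :=
  ⟨fun _ => c, contDiff_const, fun l _ _ ζ _ => by simp⟩

lemma hom_coord (i : Fin n) : Hom (n := n) 1 fun ζ => ((ζ i : ℝ) : ℂ) := by
  refine ⟨fun z => ((z.2 i : ℝ) : ℂ), ?_, fun l h0 _ ζ _ => ?_⟩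
  · exact Complex.ofRealCLM.contDiff.comp ((contDiff_euclidean.1 contDiff_snd) i)
  · simp only [PiLp.smul_apply, smul_eq_mul]; push_cast
    rw [← mul_assoc, ← Complex.ofReal_mul, Real.rpow_neg_one, inv_mul_cancel₀ h0.ne']; simp

lemma hom_inv : Hom (n := n) (-2) fun ζ => (((‖ζ‖ ^ 2)⁻¹ : ℝ) : ℂ) := by
  refine ⟨fun z => ((rr (-1) (‖z.2‖ ^ 2) : ℝ) : ℂ), ?_, fun l h0 _ ζ hz => ?_⟩
  · exact Complex.ofRealCLM.contDiff.comp ((rr_cd _).comp ((contDiff_norm_sq ℝ).comp contDiff_snd))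
  · simp only
    rw [rr_eq _ (by nlinarith), ← Complex.ofReal_mul, Real.rpow_neg_one, norm_smul, Real.norm_of_nonneg h0.le, neg_neg,
      Real.rpow_two]
    congr 1; field_simp

def qb (τ l : ℝ) (ξ : Eu n) : ℝ := (l ^ 2 + ‖(2 * π) • ξ‖ ^ 2) ^ (τ / 2)

lemma bes_scale (τ : ℝ) {l : ℝ} (h0 : 0 < l) (ζ : Eu n) : bes τ ζ = l ^ (-τ) * qb τ l (l • ζ) := by
  rw [bes, qb, smul_comm, norm_smul l, Real.norm_of_nonneg h0.le,
    show l ^ 2 + (l * ‖(2 * π) • ζ‖) ^ 2 = l ^ 2 * (1 + ‖(2 * π) • ζ‖ ^ 2) by ring,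
    Real.mul_rpow (by positivity) (by positivity), ← Real.rpow_natCast l 2, ← Real.rpow_mul h0.le, ← mul_assoc,
    ← Real.rpow_add h0]
  simp [mul_div_cancel₀]

lemma qb_reg (l : ℝ) {ξ : Eu n} (h : 1 / 4 ≤ ‖ξ‖ ∨ 1 / 4 ≤ l) : 1 / 16 ≤ l ^ 2 + ‖(2 * π) • ξ‖ ^ 2 := by
  rw [norm_smul, Real.norm_of_nonneg (by positivity)]
  rcases h with h | h
  · have : ‖ξ‖ ≤ 2 * π * ‖ξ‖ := le_mul_of_one_le_left (norm_nonneg _) (by linarith [Real.pi_gt_three])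
    nlinarith
  · nlinarith [sq_nonneg (2 * π * ‖ξ‖)]

lemma hom_bes (τ : ℝ) : Hom (n := n) τ fun ζ => ((bes τ ζ : ℝ) : ℂ) := by
  refine ⟨fun z => ((rr (τ / 2) (z.1 ^ 2 + ‖(2 * π) • z.2‖ ^ 2) : ℝ) : ℂ), ?_, fun l h0 _ ζ hz => ?_⟩
  · exact Complex.ofRealCLM.contDiff.comp ((rr_cd _).comp ((contDiff_fst.pow 2).add
      ((contDiff_norm_sq ℝ).comp (contDiff_snd.const_smul _))))
  · simp only
    rw [rr_eq _ (qb_reg l (Or.inl (by linarith))), ← Complex.ofReal_mul, bes_scale τ h0]; rfl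

def dil (V : Type*) [NormedAddCommGroup V] [NormedSpace ℝ V] (j : ℕ) : V ≃L[ℝ] V :=
  ContinuousLinearEquiv.smulLeft (Units.mk0 (((2:ℝ) ^ j)⁻¹) (by positivity))

lemma dil_apply {V : Type*} [NormedAddCommGroup V] [NormedSpace ℝ V] (j : ℕ) (v : V) :
    dil V j v = ((2:ℝ) ^ j)⁻¹ • v := rfl

lemma lin_core {P : Type*} [NormedAddCommGroup P] [NormedSpace ℝ P] {Ψ : P × Eu n → ℂ}
    (hΨ : ContDiff ℝ (⊤ : ℕ∞) Ψ) {K : Set P} (hK : IsCompact K) {R : ℝ}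
    (hR : ∀ q ∈ K, ∀ v, R ≤ ‖v‖ → Ψ (q, v) = 0) (m : ℝ) :
    ∃ C : ℝ≥0∞, C ≠ ∞ ∧ ∀ q ∈ K, ∀ (j : ℕ) (F : Sw n) (x : Eu n),
      ‖∫ ζ, Ψ (q, ((2:ℝ) ^ j)⁻¹ • ζ) * (ee ⟪ζ, x⟫ * (𝓕 F) ζ)‖ₑ ≤ C * Av j m (fun x => ‖F x‖ₑ) x := by
  obtain ⟨M, hM⟩ := exists_nat_ge m
  obtain ⟨C, -, h⟩ := ker_bd (volume : Measure (Eu n)) (innerSL ℝ)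
    (fun w => by rw [innerSL_apply_apply, real_inner_self_eq_norm_sq]) hΨ hK hR M
  refine ⟨ENNReal.ofReal C, ENNReal.ofReal_ne_top, fun q hq j F x => ?_⟩
  have hs : Continuous (fun v => Ψ (q, v)) := hΨ.continuous.comp (by fun_prop)
  have hcs : HasCompactSupport (fun v => Ψ (q, v)) := by
    refine HasCompactSupport.intro (isCompact_closedBall (0 : Eu n) R) fun v hv => hR q hq v ?_
    simp at hv; exact hv.le
  have := gen_bd (volume : Measure (Eu n)) (innerSL ℝ) hs hcs F.continuous F.integrable (dil _ j)
    (fun ξ Y => by simp [dil_apply, inner_smul_left, inner_smul_right]) x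
  simp only [dil_apply] at this
  simp only [hat_apply, real_inner_comm _ _]
  refine (le_of_eq ?_).trans (this.trans ?_)
  · congr 2; ext ζ; congr 2; rw [real_inner_comm]; rfl
  · rw [Av, ← lintegral_const_mul' _ _ ENNReal.ofReal_ne_top]
    refine lintegral_mono fun y => ?_
    rw [← mul_assoc]
    gcongr
    refine (h q hq y).trans ?_
    gcongr
    rw [← Real.rpow_natCast, ← Real.rpow_neg (by positivity), ← je_real]
    exact je_mono y (by linarith)

abbrev tw (t : ℝ) : ℝ≥0∞ := (2 : ℝ≥0∞) ^ t

lemma tw_add (s t : ℝ) : tw (s + t) = tw s * tw t := ENNReal.rpow_add _ _ (by simp) (by simp)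
lemma tw_mono {s t : ℝ} (h : s ≤ t) : tw s ≤ tw t := ENNReal.rpow_le_rpow_of_exponent_le (by simp) h
lemma tw_net (t : ℝ) : tw t ≠ ∞ := ENNReal.rpow_ne_top_of_ne_zero (by simp) (by simp)
lemma tw_zero : tw 0 = 1 := ENNReal.rpow_zero

lemma LIN {τ : ℝ} {P : Eu n → ℂ} (hP : Hom τ P) (m : ℝ) : ∃ C : ℝ≥0∞, C ≠ ∞ ∧ ∀ j : ℕ, 1 ≤ j →
    ∀ (F : Sw n) (x : Eu n), ‖∫ ζ, (ps j ζ * P ζ) * (ee ⟪ζ, x⟫ * (𝓕 F) ζ)‖ₑ ≤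
      C * tw (j * τ) * Av j m (fun x => ‖F x‖ₑ) x := by
  obtain ⟨Q, hQ, h⟩ := hP
  obtain ⟨C, hC, hb⟩ := lin_core (Ψ := fun z : ℝ × Eu n => (pa z.2 : ℂ) * Q z)
    ((Complex.ofRealCLM.contDiff.comp (pa_cd.comp contDiff_snd)).mul hQ) (isCompact_Icc (a := (0:ℝ)) (b := 1))
    (R := 2) (fun q _ v hv => by simp [pa_zero (Or.inr hv)]) m
  refine ⟨C, hC, fun j hj F x => ?_⟩
  obtain ⟨k, rfl⟩ : ∃ k, j = k + 1 := ⟨j - 1, by omega⟩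
  set l : ℝ := ((2:ℝ) ^ (k + 1))⁻¹ with hl
  have h0 : 0 < l := by positivity
  have h1 : l ≤ 1 := inv_le_one_of_one_le₀ (one_le_pow₀ one_le_two)
  have e1 : ∀ ζ : Eu n, (ps (k + 1) ζ * P ζ) * (ee ⟪ζ, x⟫ * (𝓕 F) ζ) =
      ((l ^ (-τ) : ℝ) : ℂ) * (((pa (l • ζ) : ℂ) * Q (l, l • ζ)) * (ee ⟪ζ, x⟫ * (𝓕 F) ζ)) := by
    intro ζ
    rw [ps]
    rcases le_or_gt (1 / 2) ‖l • ζ‖ with hz | hz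
    · rw [h l h0 h1 ζ hz]; ring
    · have h0 := pa_zero (Or.inl hz.le)
      simp only [← hl, h0]; simp
  simp only [e1]
  rw [integral_const_mul, enorm_mul]
  have e2 : ‖((l ^ (-τ) : ℝ) : ℂ)‖ₑ = tw ((k + 1 : ℕ) * τ) := by
    rw [← ofReal_norm, Complex.norm_real, Real.norm_of_nonneg (by positivity), hl, Real.inv_rpow (by positivity),
      Real.rpow_neg (by positivity), inv_inv, ← Real.rpow_natCast, ← Real.rpow_mul (by norm_num), tw,
      ← ENNReal.ofReal_rpow_of_pos (by norm_num)]; simp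
  rw [e2, mul_comm C, mul_assoc]
  gcongr
  exact hb l ⟨h0.le, h1⟩ (k + 1) F x

lemma LIN0 {P : Eu n → ℂ} (hP : ContDiff ℝ (⊤ : ℕ∞) P) (m : ℝ) : ∃ C : ℝ≥0∞, C ≠ ∞ ∧
    ∀ (F : Sw n) (x : Eu n), ‖∫ ζ, (ps 0 ζ * P ζ) * (ee ⟪ζ, x⟫ * (𝓕 F) ζ)‖ₑ ≤
      C * Av 0 m (fun x => ‖F x‖ₑ) x := by
  obtain ⟨C, hC, hb⟩ := lin_core (Ψ := fun z : ℝ × Eu n => (ph z.2 : ℂ) * P z.2)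
    ((Complex.ofRealCLM.contDiff.comp (ph_cd.comp contDiff_snd)).mul (hP.comp contDiff_snd)) (isCompact_Icc (a := (0:ℝ)) (b := 1))
    (R := 2) (fun q _ v hv => by simp [ph_zero hv]) m
  refine ⟨C, hC, fun F x => ?_⟩
  simpa [ps] using hb 0 (by simp) 0 F x

lemma LINa {τ : ℝ} {P : Eu n → ℂ} (hP : Hom τ P) (hP' : ContDiff ℝ (⊤ : ℕ∞) P) (m : ℝ) :
    ∃ C : ℝ≥0∞, C ≠ ∞ ∧ ∀ (j : ℕ) (F : Sw n) (x : Eu n),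
      ‖∫ ζ, (ps j ζ * P ζ) * (ee ⟪ζ, x⟫ * (𝓕 F) ζ)‖ₑ ≤ C * tw (j * τ) * Av j m (fun x => ‖F x‖ₑ) x := by
  obtain ⟨C, hC, h⟩ := LIN hP m
  obtain ⟨C', hC', h'⟩ := LIN0 hP' m
  refine ⟨C + C', by simp [hC, hC'], fun j F x => ?_⟩
  rcases Nat.eq_zero_or_pos j with rfl | hj
  · refine (h' F x).trans ?_
    simp only [Nat.cast_zero, zero_mul, tw_zero, mul_one]; gcongr; exact le_add_self
  · refine (h j hj F x).trans ?_
    gcongr; exact le_self_add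
end KP

namespace KP
open Set Filter Topology FourierTransform
variable {n : ℕ}

def cl (l : Fin n) (ζ : Eu n) : ℂ := (2 * π * I) * ((ζ l : ℝ) : ℂ)
def bc (τ : ℝ) (ζ : Eu n) : ℂ := ((bes τ ζ : ℝ) : ℂ)
def pc (j : ℕ) (ζ : Eu n) : ℂ := ((ps j ζ : ℝ) : ℂ)

lemma cl_tg (l : Fin n) : (cl l).HasTemperateGrowth := by
  have h2 : (fun _ : Eu n => (2 * π * I : ℂ)).HasTemperateGrowth := by fun_prop
  exact h2.mul (ofReal_tg (coord_tg l))
lemma bc_tg (τ : ℝ) : (bc (n := n) τ).HasTemperateGrowth := ofReal_tg (bes_tg τ)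
lemma pc_cd (j : ℕ) : ContDiff ℝ (⊤ : ℕ∞) (pc (n := n) j) := Complex.ofRealCLM.contDiff.comp (ps_cd j)
lemma pc_cs (j : ℕ) : HasCompactSupport (pc (n := n) j) := (ps_cs j).comp_left rfl
lemma tg_cd {P : Eu n → ℂ} (h : P.HasTemperateGrowth) : ContDiff ℝ (⊤ : ℕ∞) P := h.1
lemma bc_mul (σ τ : ℝ) (ζ : Eu n) : bc σ ζ * bc τ ζ = bc (σ + τ) ζ := by
  rw [bc, bc, bc, bes, bes, bes, ← Complex.ofReal_mul, ← Real.rpow_add (by positivity)]; congr 2; ring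
lemma bc_zero (ζ : Eu n) : bc 0 ζ = 1 := by simp [bc, bes]
lemma hom_cl (l : Fin n) : Hom 1 (cl l) := by
  have := (hom_const (n := n) (2 * π * I)).mul (hom_coord l)
  rwa [zero_add] at this
lemma hom_bc (τ : ℝ) : Hom (n := n) τ (bc τ) := hom_bes τ
lemma pcP_tg (j : ℕ) {P : Eu n → ℂ} (h : ContDiff ℝ (⊤ : ℕ∞) P) : (fun ζ => pc j ζ * P ζ).HasTemperateGrowth :=
  (HasCompactSupport.mul_right (pc_cs j)).hasTemperateGrowth ((pc_cd j).mul h)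

def T (j : ℕ) (P : Eu n → ℂ) (F : Sw n) (x : Eu n) : ℂ :=
  ∫ ζ, (pc j ζ * P ζ) * (ee ⟪ζ, x⟫ * (𝓕 F) ζ)

lemma T_Fm (j : ℕ) {P : Eu n → ℂ} (h : ContDiff ℝ (⊤ : ℕ∞) P) (F : Sw n) (x : Eu n) :
    T j P F x = Fm (fun ζ => pc j ζ * P ζ) F x := by
  rw [Fm_apply (pcP_tg j h), T]; congr 1; ext ζ; ring

lemma T_tr (j : ℕ) {P R Q : Eu n → ℂ} (hR : R.HasTemperateGrowth) (h : ∀ ζ, P ζ = Q ζ * R ζ)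
    (F : Sw n) (x : Eu n) : T j P F x = T j Q (Fm R F) x := by
  rw [T, T]; congr 1; ext ζ; rw [Fm_hat hR, h]; ring

lemma hom_cont {τ : ℝ} {P : Eu n → ℂ} (hP : Hom τ P) {j : ℕ} (hj : 1 ≤ j) : Continuous fun ζ => pc j ζ * P ζ := by
  obtain ⟨Q, hQ, h⟩ := hP
  obtain ⟨k, rfl⟩ : ∃ k, j = k + 1 := ⟨j - 1, by omega⟩
  set l : ℝ := ((2:ℝ) ^ (k + 1))⁻¹ with hl
  have h0 : 0 < l := by positivity
  have h1 : l ≤ 1 := inv_le_one_of_one_le₀ (one_le_pow₀ one_le_two)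
  have : (fun ζ => pc (k + 1) ζ * P ζ) = fun ζ => pc (k + 1) ζ * (((l ^ (-τ) : ℝ) : ℂ) * Q (l, l • ζ)) := by
    ext ζ
    rcases le_or_gt (1 / 2) ‖l • ζ‖ with hz | hz
    · rw [h l h0 h1 ζ hz]
    · have : pc (k + 1) ζ = 0 := by
        have h0 := pa_zero (Or.inl hz.le)
        rw [pc, ps]; simp only [← hl, h0]; simp
      rw [this]; simp
  rw [this]
  have := hQ.continuous
  have := (pc_cd (n := n) (k + 1)).continuous
  fun_prop

lemma T_int {j : ℕ} {P : Eu n → ℂ} (h : Continuous fun ζ => pc j ζ * P ζ) (F : Sw n) (x : Eu n) :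
    Integrable fun ζ => (pc j ζ * P ζ) * (ee ⟪ζ, x⟫ * (𝓕 F) ζ) := by
  have := (𝓕 F).continuous
  have h2 : HasCompactSupport fun ζ => pc j ζ * P ζ := HasCompactSupport.mul_right (pc_cs j)
  have h3 : HasCompactSupport fun ζ => (pc j ζ * P ζ) * (ee ⟪ζ, x⟫ * (𝓕 F) ζ) := HasCompactSupport.mul_right h2
  have h4 : Continuous fun ζ => (pc j ζ * P ζ) * (ee ⟪ζ, x⟫ * (𝓕 F) ζ) :=
    h.mul ((ee_cont.comp (by fun_prop)).mul this)
  exact h4.integrable_of_hasCompactSupport h3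

lemma pc_ne {j : ℕ} (hj : 1 ≤ j) : pc j (0 : Eu n) = 0 := by
  obtain ⟨k, rfl⟩ : ∃ k, j = k + 1 := ⟨j - 1, by omega⟩
  rw [pc, ps]; simp [pa_zero (ζ := (0 : Eu n)) (Or.inl (by simp))]

lemma T_grad {τ : ℝ} {P : Eu n → ℂ} (hP : Hom τ P) {j : ℕ} (hj : 1 ≤ j) (f : Sw n) (x : Eu n) :
    T j P f x = ∑ l, T j (fun ζ => (P ζ * (((ζ l : ℝ) : ℂ) * (((‖ζ‖ ^ 2)⁻¹ : ℝ) : ℂ))) * (2 * π * I)⁻¹) (Fm (cl l) f) x := by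
  simp only [T]
  rw [← integral_finsetSum]
  · congr 1; ext ζ
    simp_rw [Fm_hat (cl_tg _), cl]
    rcases eq_or_ne ζ 0 with rfl | hz
    · simp [pc_ne hj]
    have h1 : ‖ζ‖ ^ 2 = ∑ l, ζ l ^ 2 := by rw [EuclideanSpace.norm_sq_eq]; simp
    have h2 : ∑ l, ((ζ l : ℝ) : ℂ) ^ 2 * (((‖ζ‖ ^ 2)⁻¹ : ℝ) : ℂ) = 1 := by
      rw [← Finset.sum_mul, ← Complex.ofReal_one]; simp_rw [← Complex.ofReal_pow]
      rw [← Complex.ofReal_sum, ← Complex.ofReal_mul, ← h1, mul_inv_cancel₀ (by simpa using hz)]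
    have h3 : (2 * π * I : ℂ)⁻¹ * (2 * π * I) = 1 := inv_mul_cancel₀ (by simp [Real.pi_ne_zero])
    calc _ = (pc j ζ * P ζ * (ee ⟪ζ, x⟫ * (𝓕 f) ζ)) *
          (∑ l, ((ζ l : ℝ) : ℂ) ^ 2 * (((‖ζ‖ ^ 2)⁻¹ : ℝ) : ℂ)) * ((2 * π * I : ℂ)⁻¹ * (2 * π * I)) := by rw [h2, h3]; ring
      _ = _ := by
        rw [Finset.mul_sum, Finset.sum_mul]; exact Finset.sum_congr rfl fun l _ => by ring
  · intro l _
    exact T_int (hom_cont ((hP.mul ((hom_coord l).mul hom_inv)).mul (hom_const _)) hj) _ _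

def gs (f : Sw n) (x : Eu n) : ℝ≥0∞ := ∑ l, ‖Fm (cl l) f x‖ₑ

def Pf (m s : ℝ) (f : Sw n) (j : ℕ) (x : Eu n) : ℝ≥0∞ :=
  min (Av j m (gs f) x) (tw (j * (1 - s)) * Av j m (fun x => ‖Fm (bc s) f x‖ₑ) x)
def Pg (m s : ℝ) (g : Sw n) (j : ℕ) (x : Eu n) : ℝ≥0∞ :=
  min (Av j m (fun x => ‖g x‖ₑ) x) (tw (j * (1 - s)) * Av j m (fun x => ‖Fm (bc (s - 1)) g x‖ₑ) x)

lemma gs_meas (f : Sw n) : Measurable (gs f) :=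
  Finset.measurable_sum _ fun l _ => (Fm (cl l) f).continuous.measurable.enorm
lemma sm_meas (f : Sw n) : Measurable fun x => ‖f x‖ₑ := f.continuous.measurable.enorm
lemma Pf_meas (m s : ℝ) (f : Sw n) (j : ℕ) : Measurable (Pf m s f j) :=
  (Av_meas j m (gs_meas f)).min ((Av_meas j m (sm_meas _)).const_mul _)
lemma Pg_meas (m s : ℝ) (f : Sw n) (j : ℕ) : Measurable (Pg m s f j) :=
  (Av_meas j m (sm_meas f)).min ((Av_meas j m (sm_meas _)).const_mul _)
lemma Pf_slow {m : ℝ} (hm : 0 ≤ m) (s : ℝ) (f : Sw n) (j : ℕ) : Slow j m (Pf m s f j) :=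
  (Av_slow j hm _).min ((Av_slow j hm _).cmul _)
lemma Pg_slow {m : ℝ} (hm : 0 ≤ m) (s : ℝ) (f : Sw n) (j : ℕ) : Slow j m (Pg m s f j) :=
  (Av_slow j hm _).min ((Av_slow j hm _).cmul _)

lemma mul_min' {a c A B : ℝ≥0∞} (h : a ≤ c * A) (h' : a ≤ c * B) : a ≤ c * min A B := by
  rcases min_choice A B with e | e <;> rwa [e]

lemma Av_mono (j : ℕ) (m : ℝ) {F G : Eu n → ℝ≥0∞} (h : ∀ x, F x ≤ G x) (x : Eu n) : Av j m F x ≤ Av j m G x :=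
  lintegral_mono fun _ => mul_le_mul_right (h _) _

lemma le_gs (f : Sw n) (l : Fin n) (x : Eu n) : ‖Fm (cl l) f x‖ₑ ≤ gs f x :=
  Finset.single_le_sum (f := fun l => ‖Fm (cl l) f x‖ₑ) (fun _ _ => zero_le) (Finset.mem_univ l)

lemma Fbd {τ : ℝ} {P : Eu n → ℂ} (hP : Hom τ P) (m s : ℝ) : ∃ C : ℝ≥0∞, C ≠ ∞ ∧ ∀ j, 1 ≤ j →
    ∀ (f : Sw n) x, ‖T j P f x‖ₑ ≤ C * tw (j * (τ - 1)) * Pf m s f j x := by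
  choose C hC h using fun l : Fin n => LIN ((hP.mul ((hom_coord l).mul hom_inv)).mul (hom_const (2 * π * I)⁻¹)) m
  obtain ⟨C', hC', h'⟩ := LIN (hP.mul (hom_bc (-s))) m
  refine ⟨∑ l, C l + C', by simp [hC, hC'], fun j hj f x => mul_min' ?_ ?_⟩
  · rw [T_grad hP hj]
    calc _ ≤ ∑ l, ‖T j (fun ζ => (P ζ * (((ζ l : ℝ) : ℂ) * (((‖ζ‖ ^ 2)⁻¹ : ℝ) : ℂ))) * (2 * π * I)⁻¹) (Fm (cl l) f) x‖ₑ :=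
          enorm_sum_le _ _
      _ ≤ ∑ l, C l * (tw (j * (τ - 1)) * Av j m (gs f) x) := by
          refine Finset.sum_le_sum fun l _ => (h l j hj (Fm (cl l) f) x).trans ?_
          rw [show τ + (1 + -2) + 0 = τ - 1 by ring, mul_assoc]
          gcongr
          exact Av_mono j m (le_gs f l) x
      _ ≤ _ := by rw [← Finset.sum_mul, mul_assoc]; gcongr; exact le_self_add
  · rw [T_tr j (bc_tg s) (Q := fun ζ => P ζ * bc (-s) ζ) (fun ζ => by rw [mul_assoc, bc_mul]; simp [bc_zero])]
    refine (h' j hj (Fm (bc s) f) x).trans ?_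
    rw [show (j:ℝ) * (τ + -s) = j * (τ - 1) + j * (1 - s) by ring, tw_add]
    calc _ = C' * (tw (j * (τ - 1)) * (tw (j * (1 - s)) * Av j m (fun x => ‖Fm (bc s) f x‖ₑ) x)) := by ring
      _ ≤ _ := by rw [mul_assoc]; gcongr; exact le_add_self

lemma F0bd {P : Eu n → ℂ} (hP : ContDiff ℝ (⊤ : ℕ∞) P) (l : Fin n) (m s : ℝ) : ∃ C : ℝ≥0∞, C ≠ ∞ ∧
    ∀ (f : Sw n) x, ‖T 0 (fun ζ => P ζ * cl l ζ) f x‖ₑ ≤ C * Pf m s f 0 x := by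
  obtain ⟨C, hC, h⟩ := LIN0 hP m
  obtain ⟨C', hC', h'⟩ := LIN0 ((hP.mul (tg_cd (cl_tg l))).mul (tg_cd (bc_tg (-s)))) m
  refine ⟨C + C', by simp [hC, hC'], fun f x => mul_min' ?_ ?_⟩
  · rw [T_tr 0 (cl_tg l) (Q := P) (fun ζ => rfl)]
    refine (h (Fm (cl l) f) x).trans (mul_le_mul' le_self_add (Av_mono 0 m (le_gs f l) x))
  · rw [T_tr 0 (bc_tg s) (Q := fun ζ => (P ζ * cl l ζ) * bc (-s) ζ) (fun ζ => by rw [mul_assoc _ _ (bc s ζ), bc_mul]; simp [bc_zero])]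
    refine (h' (Fm (bc s) f) x).trans ?_
    simp only [Nat.cast_zero, zero_mul, tw_zero, one_mul]; gcongr; exact le_add_self

lemma Gbd {τ : ℝ} {P : Eu n → ℂ} (hP : Hom τ P) (hP' : ContDiff ℝ (⊤ : ℕ∞) P) (m s : ℝ) : ∃ C : ℝ≥0∞, C ≠ ∞ ∧ ∀ j,
    ∀ (f : Sw n) x, ‖T j P f x‖ₑ ≤ C * tw (j * τ) * Pg m s f j x := by
  obtain ⟨C, hC, h⟩ := LINa hP hP' m
  obtain ⟨C', hC', h'⟩ := LINa (hP.mul (hom_bc (1 - s))) (hP'.mul (tg_cd (bc_tg (1 - s)))) m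
  refine ⟨C + C', by simp [hC, hC'], fun j f x => mul_min' ?_ ?_⟩
  · refine (h j f x).trans ?_
    gcongr; exact le_self_add
  · rw [T_tr j (bc_tg (s - 1)) (Q := fun ζ => P ζ * bc (1 - s) ζ) (fun ζ => by rw [mul_assoc, bc_mul]; simp [bc_zero])]
    refine (h' j (Fm (bc (s - 1)) f) x).trans ?_
    rw [mul_add, tw_add]
    calc _ = C' * (tw (j * τ) * (tw (j * (1 - s)) * Av j m (fun x => ‖Fm (bc (s - 1)) f x‖ₑ) x)) := by ring
      _ ≤ _ := by rw [mul_assoc]; gcongr; exact le_add_self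
end KP

namespace KP
open Set Filter Topology FourierTransform
variable {n : ℕ}

def Bil (M : Eu n × Eu n → ℂ) (u v : Sw n) (x : Eu n) : ℂ :=
  ∫ w : Eu n × Eu n, M w * (ee ⟪w.1 + w.2, x⟫ * ((𝓕 u) w.1 * (𝓕 v) w.2))

lemma bil_prod (α β : Eu n → ℂ) (u v : Sw n) (x : Eu n) :
    Bil (fun w => α w.1 * β w.2) u v x =
      (∫ ζ, α ζ * (ee ⟪ζ, x⟫ * (𝓕 u) ζ)) * ∫ ζ, β ζ * (ee ⟪ζ, x⟫ * (𝓕 v) ζ) := by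
  rw [Bil, Measure.volume_eq_prod, ← integral_prod_mul]
  congr 1; ext w; rw [inner_add_left, ee_add]; ring

lemma bil_swap (M : Eu n × Eu n → ℂ) (u v : Sw n) (x : Eu n) :
    Bil M u v x = Bil (fun w => M w.swap) v u x := by
  rw [Bil, Bil, Measure.volume_eq_prod, ← integral_prod_swap]
  congr 1; ext w; simp only [Prod.fst_swap, Prod.snd_swap]; rw [add_comm w.2]; ring

def Lp (n : ℕ) : (Eu n × Eu n) →L[ℝ] (Eu n × Eu n) →L[ℝ] ℝ :=
  (innerSL ℝ).bilinearComp (.fst ℝ _ _) (.fst ℝ _ _) + (innerSL ℝ).bilinearComp (.snd ℝ _ _) (.snd ℝ _ _)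

lemma Lp_apply (w y : Eu n × Eu n) : Lp n w y = ⟪w.1, y.1⟫ + ⟪w.2, y.2⟫ := rfl

def dd (n j k : ℕ) : (Eu n × Eu n) ≃L[ℝ] (Eu n × Eu n) := (dil _ j).prodCongr (dil _ k)

lemma dd_apply (j k : ℕ) (w : Eu n × Eu n) : dd n j k w = (((2:ℝ) ^ j)⁻¹ • w.1, ((2:ℝ) ^ k)⁻¹ • w.2) := rfl

instance hv_haar : (volume : Measure (Eu n × Eu n)).IsAddHaarMeasure := by
  rw [Measure.volume_eq_prod]; infer_instance

lemma bil_core {P : Type*} [NormedAddCommGroup P] [NormedSpace ℝ P] {Ψ : P × (Eu n × Eu n) → ℂ}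
    (hΨ : ContDiff ℝ (⊤ : ℕ∞) Ψ) {K : Set P} (hK : IsCompact K) {R : ℝ}
    (hR : ∀ q ∈ K, ∀ v, R ≤ ‖v‖ → Ψ (q, v) = 0) {m : ℝ} (hm : 0 ≤ m) :
    ∃ C : ℝ≥0∞, C ≠ ∞ ∧ ∀ q ∈ K, ∀ (j k : ℕ) (A B : Sw n) (Φ Γ : Eu n → ℝ≥0∞),
      Slow j m Φ → Slow k m Γ → (∀ y, ‖A y‖ₑ ≤ Φ y) → (∀ y, ‖B y‖ₑ ≤ Γ y) → ∀ x,
      ‖Bil (fun w => Ψ (q, dd n j k w)) A B x‖ₑ ≤ C * (Φ x * Γ x) := by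
  obtain ⟨M, hM⟩ := exists_nat_gt (2 * m + 2 * n)
  obtain ⟨C, -, h⟩ := ker_bd (volume : Measure (Eu n × Eu n)) (Lp n) (fun w => by
    rw [Lp_apply, real_inner_self_eq_norm_sq, real_inner_self_eq_norm_sq, Prod.norm_def]
    rcases max_choice ‖w.1‖ ‖w.2‖ with e | e <;> rw [e]
    · linarith [sq_nonneg ‖w.2‖]
    · linarith [sq_nonneg ‖w.1‖]) hΨ hK hR M
  have hi : ∫⁻ Y : Eu n × Eu n, je Y ^ (-(M - 2 * m)) ≠ ∞ := by
    refine je_int volume ?_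
    rw [Module.finrank_prod, finrank_euclideanSpace, Fintype.card_fin]; push_cast; linarith
  refine ⟨ENNReal.ofReal C * ∫⁻ Y : Eu n × Eu n, je Y ^ (-(M - 2 * m)), ENNReal.mul_ne_top ENNReal.ofReal_ne_top hi,
    fun q hq j k A B Φ Γ sΦ sΓ hA hB x => ?_⟩
  have hs : Continuous (fun v => Ψ (q, v)) := hΨ.continuous.comp (by fun_prop)
  have hcs : HasCompactSupport (fun v => Ψ (q, v)) := by
    refine HasCompactSupport.intro (isCompact_closedBall (0 : Eu n × Eu n) R) fun v hv => hR q hq v ?_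
    simp at hv; exact hv.le
  have hU : Continuous fun Y : Eu n × Eu n => A Y.1 * B Y.2 := by fun_prop
  have hUi : Integrable fun Y : Eu n × Eu n => A Y.1 * B Y.2 := by
    rw [Measure.volume_eq_prod]; exact A.integrable.mul_prod B.integrable
  have := gen_bd (volume : Measure (Eu n × Eu n)) (Lp n) hs hcs hU hUi (dd n j k)
    (fun ξ Y => by simp [dd_apply, Lp_apply, inner_smul_left, inner_smul_right]) (x, x)
  refine (le_of_eq ?_).trans (this.trans ?_)
  · rw [Bil]; congr 2; ext w
    rw [Lp_apply, inner_add_left, hat_apply, hat_apply, Measure.volume_eq_prod, ← integral_prod_mul]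
    congr 3; ext Y; rw [Lp_apply, neg_add, ee_add, real_inner_comm w.1, real_inner_comm w.2]; ring
  · have hm' : AEMeasurable (fun Y : Eu n × Eu n => je Y ^ (-(M - 2 * m))) volume := by unfold je; fun_prop
    rw [mul_assoc, ← lintegral_mul_const'' _ hm', ← lintegral_const_mul' _ _ ENNReal.ofReal_ne_top]
    refine lintegral_mono fun Y => ?_
    have j1 : je Y.1 ^ m ≤ je Y ^ m := rpl (by
      rw [je_eq, je_eq]; gcongr; exact norm_fst_le Y) hm
    have j2 : je Y.2 ^ m ≤ je Y ^ m := rpl (by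
      rw [je_eq, je_eq]; gcongr; exact norm_snd_le Y) hm
    have k1 := (hA (x - ((2:ℝ) ^ j)⁻¹ • Y.1)).trans ((sΦ x Y.1).trans (mul_le_mul_left j1 _))
    have k2 := (hB (x - ((2:ℝ) ^ k)⁻¹ • Y.2)).trans ((sΓ x Y.2).trans (mul_le_mul_left j2 _))
    have k3 := h q hq Y
    rw [← Real.rpow_natCast, ← Real.rpow_neg (by positivity), ← je_real] at k3
    calc _ ≤ (ENNReal.ofReal C * je Y ^ (-(M:ℝ))) * ((je Y ^ m * Φ x) * (je Y ^ m * Γ x)) := by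
          refine mul_le_mul' k3 ?_
          rw [enorm_mul]; exact mul_le_mul' k1 k2
      _ = ENNReal.ofReal C * ((je Y ^ (-(M:ℝ)) * je Y ^ m * je Y ^ m) * (Φ x * Γ x)) := by ring
      _ = _ := by rw [← je_add, ← je_add]; congr 4; ring
end KP

namespace KP
open Set Filter Topology FourierTransform
variable {n : ℕ}

lemma cd_int {H : Type} [NormedAddCommGroup H] [NormedSpace ℝ H] [ProperSpace H] (N : ℕ) :
    ∀ {E : Type} [NormedAddCommGroup E] [NormedSpace ℝ E] [CompleteSpace E] {F : H × ℝ → E}, ContDiff ℝ N F →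
      ContDiff ℝ N fun x => ∫ t in (0:ℝ)..1, F (x, t) := by
  induction N with
  | zero =>
    intro E _ _ _ F hF
    simp only [Nat.cast_zero, contDiff_zero] at hF ⊢
    exact intervalIntegral.continuous_parametric_intervalIntegral_of_continuous' (f := fun x t => F (x, t)) hF 0 1
  | succ N ih =>
    intro E _ _ _ F hF
    rw [Nat.cast_add, Nat.cast_one] at hF ⊢
    have hd := (contDiff_succ_iff_fderiv.1 hF)
    set F' : H × ℝ → H →L[ℝ] E := fun z => (fderiv ℝ F z).comp (.inl ℝ H ℝ) with hF'
    have c' : ContDiff ℝ N F' := hd.2.2.clm_comp contDiff_const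
    rw [contDiff_succ_iff_hasFDerivAt]
    refine ⟨_, ih c', fun x => ?_⟩
    obtain ⟨B, hB⟩ := ((isCompact_closedBall x 1).prod (isCompact_Icc (a := (0:ℝ)) (b := 1))).exists_bound_of_continuousOn
      c'.continuous.continuousOn
    have cF := hF.continuous
    refine intervalIntegral.hasFDerivAt_integral_of_dominated_of_fderiv_le (F := fun x t => F (x, t))
      (F' := fun x t => F' (x, t)) (bound := fun _ => B)
      (Metric.closedBall_mem_nhds x one_pos) (Eventually.of_forall fun y => ?_) ?_ ?_ ?_ (by simp) ?_
    · exact (cF.comp (by fun_prop)).aestronglyMeasurable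
    · exact (cF.comp (by fun_prop)).intervalIntegrable _ _
    · exact (c'.continuous.comp (by fun_prop)).aestronglyMeasurable
    · refine Eventually.of_forall fun t ht y hy => hB (y, t) ⟨hy, ?_⟩
      rw [uIoc_of_le zero_le_one] at ht; exact ⟨ht.1.le, ht.2⟩
    · refine Eventually.of_forall fun t _ y _ => ?_
      have h2 : HasFDerivAt (fun y : H => (y, t)) (.inl ℝ H ℝ) y := hasFDerivAt_prodMk_left y t
      exact (hd.1 (y, t)).hasFDerivAt.comp y h2

def m0 (s : ℝ) (ζ ω : Eu n) : ℝ := bes s (ζ + ω) - bes s ω - s * (4 * π ^ 2) * ⟪ζ, ω⟫ * bes (s - 2) ω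

def kn (pw : ℝ → ℝ → ℝ) (s : ℝ) (l : Fin n) (r : ℝ) (θ ζ : Eu n) : ℝ :=
  s * (4 * π ^ 2) * ζ l * pw ((s - 2) / 2) (r ^ 2 + ‖(2 * π) • θ‖ ^ 2) +
    s * (s - 2) * (16 * π ^ 4) * ⟪θ, ζ⟫ * θ l * pw ((s - 4) / 2) (r ^ 2 + ‖(2 * π) • θ‖ ^ 2)

abbrev pw (e r : ℝ) : ℝ := r ^ e

lemma tay (s : ℝ) (ζ ω : Eu n) :
    m0 s ζ ω = ∑ l, ζ l * ∫ t in (0:ℝ)..1, (1 - t) * kn pw s l 1 (ω + t • ζ) ζ := by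
  set q : ℝ → ℝ := fun t => 1 + ‖(2 * π) • (ω + t • ζ)‖ ^ 2 with hq
  have qp : ∀ t, 0 < q t := fun t => by positivity
  have qc : Continuous q := by fun_prop
  have rc : ∀ e : ℝ, Continuous fun t => q t ^ e := fun e => qc.rpow_const fun t => Or.inl (qp t).ne'
  have q1 : ∀ t, q t = 1 + 4 * π ^ 2 * (‖ω‖ ^ 2 + 2 * (t * ⟪ω, ζ⟫) + t ^ 2 * ‖ζ‖ ^ 2) := fun t => by
    simp only [hq, norm_smul, mul_pow, @norm_add_sq_real, inner_smul_right, Real.norm_eq_abs, sq_abs]; ring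
  have q2 : ∀ t, HasDerivAt q (8 * π ^ 2 * (⟪ω, ζ⟫ + t * ‖ζ‖ ^ 2)) t := fun t => by
    rw [show q = _ from funext q1]
    have := (((((hasDerivAt_id t).mul_const ⟪ω, ζ⟫).const_mul 2).const_add (‖ω‖ ^ 2)).add
      (((hasDerivAt_id t).pow 2).mul_const (‖ζ‖ ^ 2))).const_mul (4 * π ^ 2) |>.const_add 1
    refine this.congr_deriv ?_
    simp only [id]; ring
  have q3 : ∀ t (e : ℝ), HasDerivAt (fun t => q t ^ e) (8 * π ^ 2 * (⟪ω, ζ⟫ + t * ‖ζ‖ ^ 2) * e * q t ^ (e - 1)) t :=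
    fun t e => (q2 t).rpow_const (Or.inl (qp t).ne')
  have q4 : ∀ t, HasDerivAt (fun t => ⟪ω, ζ⟫ + t * ‖ζ‖ ^ 2) (‖ζ‖ ^ 2) t := fun t => by
    simpa using ((hasDerivAt_id t).mul_const (‖ζ‖ ^ 2)).const_add ⟪ω, ζ⟫
  have key : ∀ t, HasDerivAt (fun t => (1 - t) * (s * (4 * π ^ 2) * ((⟪ω, ζ⟫ + t * ‖ζ‖ ^ 2) * q t ^ ((s - 2) / 2))) + q t ^ (s / 2))
      (∑ l, ζ l * ((1 - t) * kn pw s l 1 (ω + t • ζ) ζ)) t := by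
    intro t
    have := (((hasDerivAt_id t).const_sub 1).mul (((q4 t).mul (q3 t ((s - 2) / 2))).const_mul (s * (4 * π ^ 2)))).add (q3 t (s / 2))
    refine this.congr_deriv ?_
    have e1 : ⟪ω + t • ζ, ζ⟫ = ⟪ω, ζ⟫ + t * ‖ζ‖ ^ 2 := by
      rw [inner_add_left, real_inner_smul_left, real_inner_self_eq_norm_sq]
    have e2 : ∑ l, ζ l * (ω + t • ζ) l = ⟪ω, ζ⟫ + t * ‖ζ‖ ^ 2 := by
      rw [← e1, PiLp.inner_apply]; simp
    have e3 : ∑ l, ζ l * ζ l = ‖ζ‖ ^ 2 := by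
      rw [← real_inner_self_eq_norm_sq, PiLp.inner_apply]; simp [sq]
    have e4 : ∑ l, ζ l * ((1 - t) * kn pw s l 1 (ω + t • ζ) ζ) = (1 - t) * (s * (4 * π ^ 2) * (∑ l, ζ l * ζ l) * q t ^ ((s - 2) / 2) +
        s * (s - 2) * (16 * π ^ 4) * (⟪ω, ζ⟫ + t * ‖ζ‖ ^ 2) * (∑ l, ζ l * (ω + t • ζ) l) * q t ^ ((s - 4) / 2)) := by
      rw [Finset.mul_sum, Finset.mul_sum, Finset.sum_mul, Finset.sum_mul, ← Finset.sum_add_distrib, Finset.mul_sum]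
      refine Finset.sum_congr rfl fun l _ => ?_
      rw [kn, e1]; simp only [one_pow, hq]; ring
    rw [e4, e2, e3, show (s - 2) / 2 - 1 = (s - 4) / 2 by ring, show s / 2 - 1 = (s - 2) / 2 by ring]
    simp only [id, Pi.mul_apply]; ring
  have kc : ∀ l, Continuous fun t => (1 - t) * kn pw s l 1 (ω + t • ζ) ζ := fun l => by
    unfold kn pw
    have h1 := rc ((s - 2) / 2)
    have h2 := rc ((s - 4) / 2)
    simp only [hq] at h1 h2
    simp only [one_pow]
    have h3 : Continuous fun t : ℝ => (ω + t • ζ) l :=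
      (EuclideanSpace.proj (𝕜 := ℝ) l : Eu n →L[ℝ] ℝ).continuous.comp
        (show Continuous fun t : ℝ => ω + t • ζ from by fun_prop)
    fun_prop
  have kc' : ∀ l, Continuous fun t => ζ l * ((1 - t) * kn pw s l 1 (ω + t • ζ) ζ) := fun l => continuous_const.mul (kc l)
  simp_rw [← intervalIntegral.integral_const_mul]
  rw [← intervalIntegral.integral_finsetSum fun l _ => (kc' l).intervalIntegrable _ _,
    intervalIntegral.integral_eq_sub_of_hasDerivAt (fun t _ => key t)
    ((continuous_finsetSum _ fun l _ => kc' l).intervalIntegrable _ _)]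
  simp only [m0, bes, hq, one_smul, zero_smul, add_zero, sub_self, zero_mul, zero_add, sub_zero, one_mul]
  rw [add_comm ζ, real_inner_comm ω ζ]; ring

lemma kn_scale (s : ℝ) (l : Fin n) {c : ℝ} (hc : 0 < c) (d : ℝ) (θ ζ : Eu n) :
    kn pw s l 1 (c • θ) (d • ζ) = d * c ^ (s - 2) * kn pw s l c⁻¹ θ ζ := by
  have h : ∀ e : ℝ, (1 ^ 2 + ‖(2 * π) • (c • θ)‖ ^ 2) ^ e = c ^ (2 * e) * (c⁻¹ ^ 2 + ‖(2 * π) • θ‖ ^ 2) ^ e := fun e => by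
    rw [smul_comm, norm_smul c, Real.norm_of_nonneg hc.le, Real.rpow_mul hc.le, ← Real.mul_rpow (by positivity) (by positivity),
      Real.rpow_two]
    congr 1; field_simp
  rw [kn, kn]; simp only [h, PiLp.smul_apply, smul_eq_mul, inner_smul_left, inner_smul_right, pw, conj_trivial]
  rw [show 2 * ((s - 2) / 2) = s - 2 by ring, show 2 * ((s - 4) / 2) = (s - 2) - 2 by ring,
    show c ^ (s - 2) = c ^ (s - 2 - 2) * c ^ 2 by rw [← Real.rpow_two, ← Real.rpow_add hc]; congr 1; ring]
  ring
end KP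

namespace KP
open Set Filter Topology FourierTransform
variable {n : ℕ}

def Kq (s : ℝ) (l : Fin n) (z : (ℝ × ℝ) × (Eu n × Eu n)) : ℝ :=
  ∫ t in (0:ℝ)..1, (1 - t) * kn rr s l z.1.2 (z.2.2 + (t * z.1.1) • z.2.1) z.2.1

lemma cdc (l : Fin n) {E : Type*} [NormedAddCommGroup E] [NormedSpace ℝ E] {u : E → Eu n} (hu : ContDiff ℝ (⊤ : ℕ∞) u) :
    ContDiff ℝ (⊤ : ℕ∞) fun z => u z l := (contDiff_euclidean.1 hu) l

lemma Kq_cd (s : ℝ) (l : Fin n) : ContDiff ℝ (⊤ : ℕ∞) (Kq s l) := by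
  rw [contDiff_infty]; intro N
  refine cd_int N (F := fun w : ((ℝ × ℝ) × (Eu n × Eu n)) × ℝ => (1 - w.2) * kn rr s l w.1.1.2 (w.1.2.2 + (w.2 * w.1.1.1) • w.1.2.1) w.1.2.1) ?_
  refine ContDiff.of_le (n := (⊤ : ℕ∞)) ?_ (by exact_mod_cast le_top)
  have h1 : ContDiff ℝ (⊤ : ℕ∞) fun w : ((ℝ × ℝ) × (Eu n × Eu n)) × ℝ => w.1.2.2 + (w.2 * w.1.1.1) • w.1.2.1 := by fun_prop
  have h2 : ContDiff ℝ (⊤ : ℕ∞) fun w : ((ℝ × ℝ) × (Eu n × Eu n)) × ℝ => w.1.2.1 := by fun_prop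
  have h0 : ContDiff ℝ (⊤ : ℕ∞) fun w : ((ℝ × ℝ) × (Eu n × Eu n)) × ℝ => w.1.1.2 ^ 2 := by fun_prop
  have h3 := fun e => (rr_cd e).comp (h0.add ((contDiff_norm_sq ℝ).comp (h1.const_smul (2 * π))))
  have h4 := h1.inner ℝ h2
  have hs : ContDiff ℝ (⊤ : ℕ∞) fun w : ((ℝ × ℝ) × (Eu n × Eu n)) × ℝ => 1 - w.2 := by fun_prop
  exact hs.mul (((contDiff_const.mul (cdc l h2)).mul (h3 _)).add (((contDiff_const.mul h4).mul (cdc l h1)).mul (h3 _)))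

def ch (ζ : Eu n) : ℝ := ph ((2:ℝ)⁻¹ • ζ)

lemma ch_cd : ContDiff ℝ (⊤ : ℕ∞) (ch (n := n)) := ph_cd.comp (contDiff_const_smul _)
lemma ch_one {ζ : Eu n} (h : ‖ζ‖ ≤ 2) : ch ζ = 1 := ph_one (by rw [norm_smul]; norm_num; linarith)
lemma ch_zero {ζ : Eu n} (h : 4 ≤ ‖ζ‖) : ch ζ = 0 := ph_zero (by rw [norm_smul]; norm_num; linarith)

def Ps (s : ℝ) (l : Fin n) (z : (ℝ × ℝ) × (Eu n × Eu n)) : ℂ := ((ch z.2.1 * ch z.2.2 * Kq s l z : ℝ) : ℂ)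

lemma Ps_cd (s : ℝ) (l : Fin n) : ContDiff ℝ (⊤ : ℕ∞) (Ps s l) :=
  Complex.ofRealCLM.contDiff.comp (((ch_cd.comp (contDiff_fst.comp contDiff_snd)).mul
    (ch_cd.comp (contDiff_snd.comp contDiff_snd))).mul (Kq_cd s l))

lemma Ps_zero (s : ℝ) (l : Fin n) (q : ℝ × ℝ) (v : Eu n × Eu n) (h : 4 ≤ ‖v‖) : Ps s l (q, v) = 0 := by
  rw [Prod.norm_def, le_max_iff] at h
  rcases h with h | h <;> simp [Ps, ch_zero h]

lemma pc_sm {k : ℕ} {ω : Eu n} (h : pc k ω ≠ 0) : ‖((2:ℝ) ^ k)⁻¹ • ω‖ ≤ 2 := by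
  by_contra! h'
  exact h (by rw [pc, ps_zero h'.le]; rfl)

lemma pc_lg {k : ℕ} (hk : 1 ≤ k) {ω : Eu n} (h : pc k ω ≠ 0) : 1 / 2 ≤ ‖((2:ℝ) ^ k)⁻¹ • ω‖ := by
  by_contra! h'
  obtain ⟨i, rfl⟩ : ∃ i, k = i + 1 := ⟨k - 1, by omega⟩
  exact h (by rw [pc, ps]; simp only [pa_zero (Or.inl h'.le)]; rfl)

lemma m0_eq (s : ℝ) {j k : ℕ} (hjk : j ≤ k) (hr : j + 3 ≤ k ∨ k ≤ 2) {ζ ω : Eu n} (hz : pc j ζ ≠ 0) (hw : pc k ω ≠ 0) :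
    (m0 s ζ ω : ℂ) = ((2:ℝ) ^ (j + k * (s - 2)) : ℝ) * ∑ l, ((ζ l : ℝ) : ℂ) *
      Ps s l ((((2:ℝ) ^ (k - j))⁻¹, ((2:ℝ) ^ k)⁻¹), dd n j k (ζ, ω)) := by
  set ζ' := ((2:ℝ) ^ j)⁻¹ • ζ with hζ
  set ω' := ((2:ℝ) ^ k)⁻¹ • ω with hω
  have z2 : ‖ζ'‖ ≤ 2 := pc_sm hz
  have w2 : ‖ω'‖ ≤ 2 := pc_sm hw
  have ez : ζ = (2:ℝ) ^ j • ζ' := by rw [hζ, smul_inv_smul₀ (by positivity)]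
  have ew : ω = (2:ℝ) ^ k • ω' := by rw [hω, smul_inv_smul₀ (by positivity)]
  have e1 : ∀ t : ℝ, ω + t • ζ = (2:ℝ) ^ k • (ω' + (t * ((2:ℝ) ^ (k - j))⁻¹) • ζ') := fun t => by
    conv_lhs => rw [ez, ew]
    rw [smul_add]; simp only [smul_smul]; congr 2
    rw [show (2:ℝ) ^ k = 2 ^ (k - j) * 2 ^ j by rw [← pow_add, Nat.sub_add_cancel hjk]]; field_simp
  have reg : ∀ t ∈ Icc (0:ℝ) 1, 1 / 4 ≤ ‖ω' + (t * ((2:ℝ) ^ (k - j))⁻¹) • ζ'‖ ∨ 1 / 4 ≤ ((2:ℝ) ^ k)⁻¹ := by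
    intro t ht
    rcases hr with h | h
    · left
      have a1 : 1 / 2 ≤ ‖ω'‖ := pc_lg (by omega) hw
      have a2 : ((2:ℝ) ^ (k - j))⁻¹ ≤ 1 / 8 := by
        rw [inv_le_comm₀ (by positivity) (by norm_num)]
        calc ((1:ℝ) / 8)⁻¹ = 2 ^ 3 := by norm_num
          _ ≤ _ := pow_le_pow_right₀ (by norm_num) (by omega)
      have a3 : ‖(t * ((2:ℝ) ^ (k - j))⁻¹) • ζ'‖ ≤ 1 / 8 * 2 := by
        have : 0 ≤ ((2:ℝ) ^ (k - j))⁻¹ := by positivity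
        rw [norm_smul, Real.norm_of_nonneg (mul_nonneg ht.1 this)]
        gcongr
        calc t * ((2:ℝ) ^ (k - j))⁻¹ ≤ 1 * (1 / 8) := by gcongr; exact ht.2
          _ = _ := by norm_num
      have := norm_sub_norm_le ω' (-((t * ((2:ℝ) ^ (k - j))⁻¹) • ζ'))
      rw [norm_neg, sub_neg_eq_add] at this; linarith
    · right
      rw [le_inv_comm₀ (by norm_num) (by positivity)]
      calc (2:ℝ) ^ k ≤ 2 ^ 2 := pow_le_pow_right₀ (by norm_num) h
        _ = _ := by norm_num
  have e2 : ∀ l, ∫ t in (0:ℝ)..1, (1 - t) * kn pw s l 1 (ω + t • ζ) ζ =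
      (2:ℝ) ^ (j + k * (s - 2)) * Kq s l ((((2:ℝ) ^ (k - j))⁻¹, ((2:ℝ) ^ k)⁻¹), (ζ', ω')) := fun l => by
    rw [Kq, ← intervalIntegral.integral_const_mul]
    refine intervalIntegral.integral_congr fun t ht => ?_
    rw [uIcc_of_le zero_le_one] at ht
    simp only
    rw [e1, show kn pw s l 1 ((2:ℝ) ^ k • (ω' + (t * ((2:ℝ) ^ (k - j))⁻¹) • ζ')) ζ =
      kn pw s l 1 ((2:ℝ) ^ k • (ω' + (t * ((2:ℝ) ^ (k - j))⁻¹) • ζ')) ((2:ℝ) ^ j • ζ') by rw [← ez],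
      kn_scale s l (by positivity)]
    have := qb_reg _ (reg t ht)
    rw [kn, kn, rr_eq _ this, rr_eq _ this, Real.rpow_add (by norm_num), Real.rpow_mul (by norm_num), Real.rpow_natCast,
      Real.rpow_natCast]
    ring
  rw [tay]; simp only [e2]
  push_cast
  rw [Finset.mul_sum]
  refine Finset.sum_congr rfl fun l _ => ?_
  rw [dd_apply, Ps]; simp only [← hζ, ← hω, ch_one z2, ch_one w2]; push_cast; ring

lemma BIL (s : ℝ) {m : ℝ} (hm : 0 ≤ m) : ∃ C : ℝ≥0∞, C ≠ ∞ ∧ ∀ j k : ℕ, j ≤ k → (j + 3 ≤ k ∨ k ≤ 2) →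
    ∀ (u v : Sw n) (Φ Γ : Eu n → ℝ≥0∞), Slow j m Φ → Slow k m Γ →
    (∀ l y, ‖T j (cl l) u y‖ₑ ≤ Φ y) → (∀ y, ‖T k (fun _ => 1) v y‖ₑ ≤ Γ y) → ∀ x,
    ‖Bil (fun w => pc j w.1 * pc k w.2 * (m0 s w.1 w.2 : ℂ)) u v x‖ₑ ≤ C * tw (j + k * (s - 2)) * (Φ x * Γ x) := by
  choose C hC h using fun l : Fin n => bil_core (Ps_cd s l) ((isCompact_Icc (a := (0:ℝ)) (b := 1)).prod
    (isCompact_Icc (a := (0:ℝ)) (b := 1))) (R := 4) (fun q _ v hv => Ps_zero s l q v hv) hm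
  refine ⟨∑ l, ‖(2 * π * I : ℂ)⁻¹‖ₑ * C l, by simp [hC, ENNReal.mul_eq_top], fun j k hjk hr u v Φ Γ sΦ sΓ hΦ hΓ x => ?_⟩
  set q : ℝ × ℝ := (((2:ℝ) ^ (k - j))⁻¹, ((2:ℝ) ^ k)⁻¹) with hq
  have le1 : ∀ i : ℕ, ((2:ℝ) ^ i)⁻¹ ∈ Icc (0:ℝ) 1 := fun i =>
    ⟨by positivity, inv_le_one_of_one_le₀ (one_le_pow₀ one_le_two)⟩
  set A : Fin n → Sw n := fun l => Fm (fun ζ => pc j ζ * cl l ζ) u with hA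
  set B : Sw n := Fm (fun ζ => pc k ζ * 1) v with hB
  have hcl := fun l : Fin n => tg_cd (cl_tg l)
  have c1 : ContDiff ℝ (⊤ : ℕ∞) fun _ : Eu n => (1:ℂ) := contDiff_const
  have e : Bil (fun w => pc j w.1 * pc k w.2 * (m0 s w.1 w.2 : ℂ)) u v x =
      ((2:ℝ) ^ (j + k * (s - 2)) : ℝ) * ∑ l, (2 * π * I : ℂ)⁻¹ * Bil (fun w => Ps s l (q, dd n j k w)) (A l) B x := by
    simp only [Bil]
    simp_rw [← integral_const_mul]
    rw [← integral_finsetSum, ← integral_const_mul]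
    · congr 1; ext w
      simp only [hA, hB, Fm_hat (pcP_tg j (hcl _)), Fm_hat (pcP_tg k c1)]
      by_cases h1 : pc j w.1 = 0
      · simp [h1]
      by_cases h2 : pc k w.2 = 0
      · simp [h2]
      rw [m0_eq s hjk hr h1 h2, Finset.mul_sum, Finset.mul_sum, Finset.mul_sum, Finset.sum_mul]
      refine Finset.sum_congr rfl fun l _ => ?_
      have : (2 * π * I : ℂ)⁻¹ * (2 * π * I) = 1 := inv_mul_cancel₀ (by simp [Real.pi_ne_zero])
      rw [cl, ← hq]
      linear_combination (-((2:ℝ) ^ (j + k * (s - 2)) : ℝ) * Ps s l (q, dd n j k w) * ee ⟪w.1 + w.2, x⟫ * pc j w.1 *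
        ((w.1 l : ℝ) : ℂ) * (𝓕 u) w.1 * pc k w.2 * (𝓕 v) w.2) * this
    · intro l _
      have hs : Continuous (fun v => Ps s l (q, v)) := (Ps_cd s l).continuous.comp (by fun_prop)
      have hcs : HasCompactSupport (fun v => Ps s l (q, v)) := by
        refine HasCompactSupport.intro (isCompact_closedBall (0 : Eu n × Eu n) 4) fun v hv => Ps_zero s l q v ?_
        simp at hv; exact hv.le
      obtain ⟨K, hK⟩ := hcs.exists_bound_of_continuous hs
      have hi : Integrable fun w : Eu n × Eu n => (𝓕 (A l)) w.1 * (𝓕 B) w.2 := by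
        rw [Measure.volume_eq_prod]; exact (𝓕 (A l)).integrable.mul_prod (𝓕 B).integrable
      refine Integrable.const_mul (Integrable.bdd_mul (c := K) (Integrable.bdd_mul (c := 1) hi ?_ ?_) ?_ ?_) _
      · exact Continuous.aestronglyMeasurable (by fun_prop)
      · exact Eventually.of_forall fun w => by simp
      · exact (hs.comp (dd n j k).continuous).aestronglyMeasurable
      · exact Eventually.of_forall fun w => hK _
  have e2 : ‖(((2:ℝ) ^ (j + k * (s - 2)) : ℝ) : ℂ)‖ₑ = tw (j + k * (s - 2)) := by
    rw [← ofReal_norm, Complex.norm_real, Real.norm_of_nonneg (by positivity), tw,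
      ← ENNReal.ofReal_rpow_of_pos (by norm_num)]; simp
  rw [e, enorm_mul, e2, mul_comm (∑ l, ‖(2 * π * I : ℂ)⁻¹‖ₑ * C l), mul_assoc (tw _)]
  refine mul_le_mul_right ?_ _
  refine le_trans (enorm_sum_le _ _) ?_
  rw [Finset.sum_mul]
  refine Finset.sum_le_sum fun l _ => ?_
  rw [enorm_mul, mul_assoc _ (C l)]
  refine mul_le_mul_right ?_ _
  refine h l q ⟨le1 _, le1 _⟩ j k (A l) B Φ Γ sΦ sΓ (fun y => ?_) (fun y => ?_) x
  · rw [hA]; simp only; rw [← T_Fm j (hcl l)]; exact hΦ l y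
  · rw [hB, ← T_Fm k c1]; exact hΓ y
end KP

namespace KP
open Set Filter Topology FourierTransform
variable {n : ℕ}

def Gr (M : Eu n × Eu n → ℂ) : Prop := Continuous M ∧ ∃ (N : ℕ) (C : ℝ), 0 ≤ C ∧
  ∀ w, ‖M w‖ ≤ C * ((1 + ‖w.1‖) ^ N * (1 + ‖w.2‖) ^ N)

lemma Gr.add {M M' : Eu n × Eu n → ℂ} (h : Gr M) (h' : Gr M') : Gr fun w => M w + M' w := by
  obtain ⟨c, N, C, h0, h⟩ := h
  obtain ⟨c', N', C', h0', h'⟩ := h'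
  refine ⟨c.add c', N + N', C + C', by positivity, fun w => (norm_add_le _ _).trans ?_⟩
  rw [add_mul]
  exact add_le_add ((h w).trans (by gcongr <;> first | omega | simp))
    ((h' w).trans (by gcongr <;> first | omega | simp))
lemma Gr.mul {M M' : Eu n × Eu n → ℂ} (h : Gr M) (h' : Gr M') : Gr fun w => M w * M' w := by
  obtain ⟨c, N, C, h0, h⟩ := h
  obtain ⟨c', N', C', h0', h'⟩ := h'
  refine ⟨c.mul c', N + N', C * C', by positivity, fun w => ?_⟩
  rw [norm_mul]
  refine (mul_le_mul (h w) (h' w) (norm_nonneg _) (by positivity)).trans (le_of_eq (by rw [pow_add, pow_add]; ring))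
lemma Gr.tg {P : Eu n → ℂ} (hP : P.HasTemperateGrowth) : Gr (fun w => P w.1) ∧ Gr (fun w => P w.2) ∧
    Gr (fun w => P (w.1 + w.2)) := by
  obtain ⟨N, C, h⟩ := hP.2 0
  have hc : Continuous P := (tg_cd hP).continuous
  simp only [norm_iteratedFDeriv_zero] at h
  have h0 : 0 ≤ C := by simpa using (norm_nonneg _).trans (h 0)
  have o : ∀ t : Eu n, 1 ≤ (1 + ‖t‖) ^ N := fun t => one_le_pow₀ (by simp)
  refine ⟨⟨hc.comp continuous_fst, N, C, h0, fun w => (h _).trans ?_⟩,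
    ⟨hc.comp continuous_snd, N, C, h0, fun w => (h _).trans ?_⟩, ⟨hc.comp (by fun_prop), N, C, h0, fun w => (h _).trans ?_⟩⟩
  · gcongr; exact le_mul_of_one_le_right (by positivity) (o _)
  · gcongr; exact le_mul_of_one_le_left (by positivity) (o _)
  · rw [← mul_pow]; gcongr
    nlinarith [norm_add_le w.1 w.2, norm_nonneg w.1, norm_nonneg w.2, mul_nonneg (norm_nonneg w.1) (norm_nonneg w.2)]
lemma Gr.const (c : ℂ) : Gr fun _ : Eu n × Eu n => c :=
  ⟨continuous_const, 0, ‖c‖, norm_nonneg _, fun w => by simp⟩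
lemma Gr.sum {ι : Type*} (S : Finset ι) {M : ι → Eu n × Eu n → ℂ} (h : ∀ i, Gr (M i)) : Gr fun w => ∑ i ∈ S, M i w := by
  classical
  induction S using Finset.induction with
  | empty => simpa using Gr.const (n := n) 0
  | insert a S ha ih => simp_rw [Finset.sum_insert ha]; exact (h a).add ih

lemma sch_int (N : ℕ) (u : Sw n) : Integrable fun x => (1 + ‖x‖) ^ N * ‖u x‖ := by
  have h1 : (fun x : Eu n => (((1 + ‖x‖ ^ 2) ^ ((N:ℝ) / 2) : ℝ) : ℂ)).HasTemperateGrowth :=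
    ofReal_tg (Function.hasTemperateGrowth_one_add_norm_sq_rpow (Eu n) _)
  have h2 := ((SchwartzMap.smulLeftCLM ℂ (fun x : Eu n => (((1 + ‖x‖ ^ 2) ^ ((N:ℝ) / 2) : ℝ) : ℂ)) u).integrable
    (μ := volume)).norm.const_mul ((2:ℝ) ^ N)
  refine h2.mono' (Continuous.aestronglyMeasurable (by fun_prop)) (Eventually.of_forall fun x => ?_)
  rw [SchwartzMap.smulLeftCLM_apply_apply h1, norm_smul, ← mul_assoc, Real.norm_of_nonneg (by positivity),
    Complex.norm_real, Real.norm_of_nonneg (by positivity)]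
  gcongr
  rw [show (1 + ‖x‖ ^ 2) ^ ((N:ℝ) / 2) = (√(1 + ‖x‖ ^ 2)) ^ N by
    rw [Real.sqrt_eq_rpow, ← Real.rpow_natCast _ N, ← Real.rpow_mul (by positivity)]; ring_nf, ← mul_pow]
  gcongr
  have a1 : 1 ≤ √(1 + ‖x‖ ^ 2) := Real.one_le_sqrt.2 (by nlinarith [norm_nonneg x])
  have a2 : ‖x‖ ≤ √(1 + ‖x‖ ^ 2) := Real.le_sqrt_of_sq_le (by linarith)
  linarith

lemma Gr.int {M : Eu n × Eu n → ℂ} (h : Gr M) (u v : Sw n) (x : Eu n) :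
    Integrable fun w : Eu n × Eu n => M w * (ee ⟪w.1 + w.2, x⟫ * ((𝓕 u) w.1 * (𝓕 v) w.2)) := by
  obtain ⟨c, N, C, h0, h⟩ := h
  have := ((sch_int N (𝓕 u)).mul_prod (sch_int N (𝓕 v))).const_mul C
  rw [← Measure.volume_eq_prod] at this
  refine this.mono' (Continuous.aestronglyMeasurable ?_) (Eventually.of_forall fun w => ?_)
  · exact c.mul ((ee_cont.comp (by fun_prop)).mul (by fun_prop))
  · rw [norm_mul, norm_mul, ee_norm, one_mul, norm_mul]
    refine (mul_le_mul_of_nonneg_right (h w) (by positivity)).trans (le_of_eq (by ring))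

lemma bil_add {M M' : Eu n × Eu n → ℂ} (h : Gr M) (h' : Gr M') (u v : Sw n) (x : Eu n) :
    Bil (fun w => M w + M' w) u v x = Bil M u v x + Bil M' u v x := by
  rw [Bil, Bil, Bil, ← integral_add (h.int u v x) (h'.int u v x)]; congr 1; ext w; ring
lemma bil_cmul (c : ℂ) (M : Eu n × Eu n → ℂ) (u v : Sw n) (x : Eu n) :
    Bil (fun w => c * M w) u v x = c * Bil M u v x := by
  rw [Bil, Bil, ← integral_const_mul]; congr 1; ext w; ring
lemma bil_sum {ι : Type*} (S : Finset ι) {M : ι → Eu n × Eu n → ℂ} (h : ∀ i, Gr (M i)) (u v : Sw n)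
    (x : Eu n) : Bil (fun w => ∑ i ∈ S, M i w) u v x = ∑ i ∈ S, Bil (M i) u v x := by
  simp only [Bil]
  rw [← integral_finsetSum _ fun i _ => (h i).int u v x]; congr 1; ext w; rw [Finset.sum_mul]

abbrev pm (u v : Sw n) : Sw n := SchwartzMap.pairing (ContinuousLinearMap.mul ℂ ℂ) u v
lemma pm_apply (u v : Sw n) (x : Eu n) : pm u v x = u x * v x := rfl

lemma pm_hat (u v : Sw n) (ζ : Eu n) : (𝓕 (pm u v)) ζ = ∫ ω, (𝓕 u) (ζ - ω) * (𝓕 v) ω := by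
  rw [hat_apply]
  simp_rw [hat_apply u, pm_apply, ← integral_mul_const]
  rw [integral_integral_swap]
  · congr 1; ext x
    rw [self_apply v x, ← integral_const_mul, ← integral_const_mul]
    congr 1; ext ω
    rw [inner_sub_right, neg_sub, sub_eq_add_neg, ee_add, real_inner_comm x ω]; ring
  · have : Integrable (fun w : Eu n × Eu n => (𝓕 v) w.1 * u w.2) := by
      rw [Measure.volume_eq_prod]; exact (𝓕 v).integrable.mul_prod u.integrable
    refine (Integrable.bdd_mul (c := 1) this (f := fun w => ee (-⟪w.2, ζ - w.1⟫)) ?_ ?_).congr ?_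
    · exact Continuous.aestronglyMeasurable (ee_cont.comp (by fun_prop))
    · exact Eventually.of_forall fun w => by simp
    · exact Eventually.of_forall fun w => by simp only [Function.uncurry]; ring

lemma bil_pm {P : Eu n → ℂ} (h : Gr fun w => P (w.1 + w.2)) (u v : Sw n) (x : Eu n) :
    ∫ ζ, P ζ * (ee ⟪ζ, x⟫ * (𝓕 (pm u v)) ζ) = Bil (fun w => P (w.1 + w.2)) u v x := by
  set G : Eu n × Eu n → ℂ := fun z => P z.2 * (ee ⟪z.2, x⟫ * ((𝓕 u) (z.2 - z.1) * (𝓕 v) z.1)) with hG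
  have hi := h.int u v x
  have e : (fun w : Eu n × Eu n => P (w.1 + w.2) * (ee ⟪w.1 + w.2, x⟫ * ((𝓕 u) w.1 * (𝓕 v) w.2))) =
      G ∘ (fun w : Eu n × Eu n => (w.1, w.1 + w.2)) ∘ Prod.swap := by
    ext w; simp [hG, add_comm w.2]
  have mp : MeasurePreserving ((fun w : Eu n × Eu n => (w.1, w.1 + w.2)) ∘ Prod.swap) volume volume :=
    (measurePreserving_prod_add volume volume).comp Measure.measurePreserving_swap
  have me : MeasurableEmbedding ((fun w : Eu n × Eu n => (w.1, w.1 + w.2)) ∘ Prod.swap) :=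
    ((MeasurableEquiv.shearAddRight (Eu n)).measurableEmbedding).comp MeasurableEquiv.prodComm.measurableEmbedding
  rw [Bil]
  rw [e] at hi
  have e3 := mp.integral_comp me G
  have e4 := congrArg (fun F : Eu n × Eu n → ℂ => ∫ w, F w) e
  refine Eq.trans ?_ (e4.trans e3).symm
  have hi' : Integrable G := (mp.integrable_comp_emb me).1 hi
  rw [Measure.volume_eq_prod] at hi' ⊢
  rw [integral_prod_symm _ hi']
  congr 1; ext ζ
  rw [pm_hat, ← integral_const_mul, ← integral_const_mul]
end KP

namespace KP
open Set Filter Topology FourierTransform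
variable {n : ℕ}

lemma we_pow (b r : ℝ) (x : Eu n) : we (b * r) x = we b x ^ r := by
  rw [we, we, ENNReal.ofReal_rpow_of_pos (jw_pos b x), jw, jw, ← Real.rpow_mul (by positivity)]; ring_nf

lemma Wn_pow {p r : ℝ} (hp : 0 < p) (hr : 0 < r) (b : ℝ) (u : Eu n → ℝ≥0∞) :
    Wn (ENNReal.ofReal p) b u ^ r = Wn (ENNReal.ofReal (p / r)) (b * r) fun x => u x ^ r := by
  rw [Wn_fin hp, Wn_fin (div_pos hp hr), ← ENNReal.rpow_mul]
  simp_rw [we_pow, ← rpm _ _ hr.le, ← ENNReal.rpow_mul]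
  rw [mul_div_cancel₀ _ hr.ne']; congr 1; field_simp

lemma Wn_add_r {p r : ℝ} (hr : 0 < r) (hr1 : r ≤ 1) (hrp : r ≤ p) (b : ℝ) {u v : Eu n → ℝ≥0∞} (hu : Measurable u)
    (hv : Measurable v) : Wn (ENNReal.ofReal p) b (fun x => u x + v x) ^ r ≤
      Wn (ENNReal.ofReal p) b u ^ r + Wn (ENNReal.ofReal p) b v ^ r := by
  have hp := hr.trans_le hrp
  simp_rw [Wn_pow hp hr]
  refine (Wn_mono _ _ (v := fun x => u x ^ r + v x ^ r) fun x => ENNReal.rpow_add_le_add_rpow _ _ hr.le hr1).trans ?_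
  simp only [Wn, mul_add]
  refine eLpNorm_add_le (f := fun x => we (b * r) x * u x ^ r) (g := fun x => we (b * r) x * v x ^ r) ?_ ?_ ?_
  · exact Measurable.aestronglyMeasurable (by fun_prop)
  · exact Measurable.aestronglyMeasurable (by fun_prop)
  · rw [← ENNReal.ofReal_one]; exact ENNReal.ofReal_le_ofReal ((one_le_div hr).2 hrp)

lemma Wn_sum_r {p r : ℝ} (hr : 0 < r) (hr1 : r ≤ 1) (hrp : r ≤ p) (b : ℝ) {ι : Type*} (S : Finset ι)
    {u : ι → Eu n → ℝ≥0∞} (hu : ∀ i, Measurable (u i)) : Wn (ENNReal.ofReal p) b (fun x => ∑ i ∈ S, u i x) ^ r ≤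
      ∑ i ∈ S, Wn (ENNReal.ofReal p) b (u i) ^ r := by
  classical
  induction S using Finset.induction with
  | empty => simp [Wn, hr]
  | insert a S ha ih =>
    simp_rw [Finset.sum_insert ha]
    exact (Wn_add_r hr hr1 hrp b (hu a) (Finset.measurable_sum _ fun i _ => hu i)).trans (by gcongr)

lemma je_scale {l : ℝ} (hl : 0 < l) (t : ℝ) (y : Eu n) : ∫⁻ z, je (l • (y - z)) ^ (-t) =
    ENNReal.ofReal ((l ^ n)⁻¹) * ∫⁻ z : Eu n, je z ^ (-t) := by
  rw [lintegral_sub_left_eq_self (fun z => je (l • z) ^ (-t)) y]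
  have h := Measure.map_addHaar_smul (volume : Measure (Eu n)) hl.ne'
  have m : Measurable fun z : Eu n => je z ^ (-t) := by fun_prop
  rw [← lintegral_map m (measurable_const_smul l), h, lintegral_smul_measure]
  simp [abs_of_pos, hl]

lemma tw_pow (t r : ℝ) : tw t ^ r = tw (t * r) := (ENNReal.rpow_mul _ _ _).symm
lemma tw_ne (t : ℝ) : tw t ≠ 0 := by simp [tw]
lemma tw_real (t : ℝ) : tw t = ENNReal.ofReal ((2:ℝ) ^ t) := by
  rw [tw, ← ENNReal.ofReal_rpow_of_pos (by norm_num)]; simp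

lemma av_r {r M N : ℝ} {K : ℝ≥0∞} (hK : K ≠ ∞) (hr : 0 < r) (hr1 : r ≤ 1) (hM : 0 ≤ M) (hN : 0 ≤ N) (ht : n < (N + M) * r) :
    ∃ C : ℝ≥0∞, C ≠ ∞ ∧ ∀ i j : ℕ, i ≤ j + 4 → ∀ Θ : Eu n → ℝ≥0∞, Measurable Θ →
      (∀ x y, Θ (x - ((2:ℝ) ^ j)⁻¹ • y) ≤ K * je y ^ N * Θ x) → ∀ x,
      Av i M Θ x ^ r ≤ C * tw ((j - i) * n * (1 - r)) * Av i (M * r) (fun x => Θ x ^ r) x := by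
  set c₀ : ℝ≥0∞ := ∫⁻ z : Eu n, je z ^ (-((N + M) * r)) with hc
  have hct : c₀ ≠ ∞ := je_int _ (by simpa using ht)
  have hc0 : c₀ ≠ 0 := by
    intro h0
    rw [hc, lintegral_eq_zero_iff (by fun_prop)] at h0
    obtain ⟨z, hz⟩ := h0.exists
    exact (ENNReal.rpow_pos (zero_lt_one.trans_le (je_one z)) (je_net z)).ne' hz
  set K' : ℝ≥0∞ := (K * 16 ^ M) ^ r with hK'
  have hKt : K' ≠ ∞ := rp_ne (ENNReal.mul_ne_top hK (rp_ne (by simp) hM)) hr.le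
  refine ⟨(K' * c₀⁻¹) ^ (1 - r), rp_ne (ENNReal.mul_ne_top hKt (by simpa using hc0)) (by linarith), fun i j hij Θ mΘ sΘ x => ?_⟩
  set l : ℝ := 2 ^ j / 2 ^ i with hl
  have l0 : 0 < l := by positivity
  have l1 : 1 ≤ 16 * l := by
    rw [hl, ← mul_div_assoc, le_div_iff₀ (by positivity), one_mul, show (16:ℝ) = 2 ^ 4 by norm_num, ← pow_add]
    exact pow_le_pow_right₀ one_le_two (by omega)
  have ltw : ENNReal.ofReal (l ^ n) = tw ((j - i) * n) := by
    rw [tw_real, hl, Real.rpow_mul (by norm_num), Real.rpow_sub (by norm_num)]; simp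
  set h : Eu n → ℝ≥0∞ := fun y => je y ^ (-M) * Θ (x - ((2:ℝ) ^ i)⁻¹ • y) with hh
  have mh : Measurable h := by fun_prop
  set A : ℝ≥0∞ := ∫⁻ y, h y ^ r with hA
  have key : ∀ y z, h y ≤ K * 16 ^ M * je (l • (y - z)) ^ (N + M) * h z := by
    intro y z
    have e1 : x - ((2:ℝ) ^ i)⁻¹ • y = x - ((2:ℝ) ^ i)⁻¹ • z - ((2:ℝ) ^ j)⁻¹ • (l • (y - z)) := by
      rw [smul_smul, hl, show ((2:ℝ) ^ j)⁻¹ * (2 ^ j / 2 ^ i) = (2 ^ i)⁻¹ by field_simp, smul_sub]; abel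
    have e2 : je (y - z) ≤ 16 * je (l • (y - z)) := by
      rw [je_eq, je_eq, show (16:ℝ≥0∞) = ENNReal.ofReal 16 by simp, ← ENNReal.ofReal_mul (by norm_num)]
      refine ENNReal.ofReal_le_ofReal ?_
      rw [norm_smul, Real.norm_of_nonneg l0.le]; nlinarith [norm_nonneg (y - z)]
    have e3 : je y ^ (-M) ≤ 16 ^ M * je (l • (y - z)) ^ M * je z ^ (-M) := by
      have := (je_mul (y := y) (z := z - y)).trans (mul_le_mul_right (show je (z - y) ≤ 16 * je (l • (y - z)) by rw [je, ← enorm_neg, neg_sub]; exact e2) _)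
      rw [add_sub_cancel] at this
      have := rpl this hM
      rw [rpm _ _ hM, rpm _ _ hM] at this
      calc je y ^ (-M) = je y ^ (-M) * (je z ^ M * je z ^ (-M)) := by
            rw [← je_add]; simp
        _ ≤ je y ^ (-M) * ((je y ^ M * (16 ^ M * je (l • (y - z)) ^ M)) * je z ^ (-M)) := by gcongr
        _ = (je y ^ (-M) * je y ^ M) * (16 ^ M * je (l • (y - z)) ^ M * je z ^ (-M)) := by ring
        _ = _ := by rw [← je_add]; simp
    simp only [hh]
    calc _ ≤ (16 ^ M * je (l • (y - z)) ^ M * je z ^ (-M)) *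
          (K * je (l • (y - z)) ^ N * Θ (x - ((2:ℝ) ^ i)⁻¹ • z)) := by
          refine mul_le_mul' e3 ?_; rw [e1]; exact sΘ _ _
      _ = _ := by rw [je_add]; ring
  have sup : ∀ y, h y ^ r ≤ K' * c₀⁻¹ * tw ((j - i) * n) * A := by
    intro y
    have e1 : ∀ z, h y ^ r * je (l • (y - z)) ^ (-((N + M) * r)) ≤ K' * h z ^ r := by
      intro z
      have := rpl (key y z) hr.le
      rw [rpm _ (h z) hr.le, rpm _ (je _ ^ _) hr.le, ← ENNReal.rpow_mul] at this
      calc _ ≤ (K' * je (l • (y - z)) ^ ((N + M) * r) * h z ^ r) * je (l • (y - z)) ^ (-((N + M) * r)) := by gcongr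
        _ = K' * h z ^ r * (je (l • (y - z)) ^ ((N + M) * r) * je (l • (y - z)) ^ (-((N + M) * r))) := by ring
        _ = _ := by rw [← je_add]; simp
    have e2 := lintegral_mono (μ := volume) e1
    rw [lintegral_const_mul _ (by fun_prop), lintegral_const_mul' _ _ hKt, je_scale l0, ENNReal.ofReal_inv_of_pos (by positivity),
      ltw, ← hc, ← hA] at e2
    calc h y ^ r = h y ^ r * ((tw ((j - i) * n))⁻¹ * c₀) * (c₀⁻¹ * tw ((j - i) * n)) := by
          rw [mul_assoc, show (tw ((j - i) * n))⁻¹ * c₀ * (c₀⁻¹ * tw ((j - i) * n)) =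
            ((tw ((j - i) * n))⁻¹ * tw ((j - i) * n)) * (c₀ * c₀⁻¹) by ring, ENNReal.mul_inv_cancel hc0 hct,
            ENNReal.inv_mul_cancel (tw_ne _) (tw_net _), mul_one, mul_one]
      _ ≤ (K' * A) * (c₀⁻¹ * tw ((j - i) * n)) := by gcongr
      _ = _ := by ring
  have e5 : Av i M Θ x ≤ A * (K' * c₀⁻¹ * tw ((j - i) * n) * A) ^ ((1 - r) / r) := by
    rw [Av, ← lintegral_mul_const _ (by fun_prop)]
    refine lintegral_mono fun y => ?_
    calc _ = h y ^ r * (h y ^ r) ^ ((1 - r) / r) := by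
          rw [← ENNReal.rpow_mul, mul_div_cancel₀ _ hr.ne', ← ENNReal.rpow_add_of_nonneg _ _ hr.le (by linarith)]; simp [hh]
      _ ≤ _ := mul_le_mul_right (rpl (sup y) (div_nonneg (sub_nonneg.2 hr1) hr.le)) _
  have e6 : A = Av i (M * r) (fun x => Θ x ^ r) x := by
    rw [Av]; refine lintegral_congr fun y => ?_
    simp only [hh]; rw [rpm _ _ hr.le, ← ENNReal.rpow_mul, neg_mul]
  rw [← e6]
  have h1r : 0 ≤ 1 - r := by linarith
  calc _ ≤ (A * (K' * c₀⁻¹ * tw ((j - i) * n) * A) ^ ((1 - r) / r)) ^ r := rpl e5 hr.le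
    _ = (K' * c₀⁻¹) ^ (1 - r) * tw ((j - i) * n) ^ (1 - r) * (A ^ r * A ^ (1 - r)) := by
      rw [rpm _ _ hr.le, ← ENNReal.rpow_mul, div_mul_cancel₀ _ hr.ne',
        rpm _ _ h1r, rpm _ _ h1r]; ring
    _ = _ := by rw [← ENNReal.rpow_add_of_nonneg _ _ hr.le h1r, tw_pow]; simp

lemma av_wn {p r b M N : ℝ} {K : ℝ≥0∞} (hK : K ≠ ∞) (hr : 0 < r) (hr1 : r ≤ 1) (hrp : r ≤ p) (hb : 0 ≤ b) (hN : 0 ≤ N)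
    (hM : n + b * r < M * r) :
    ∃ C : ℝ≥0∞, C ≠ ∞ ∧ ∀ i j : ℕ, i ≤ j + 4 → ∀ Θ : Eu n → ℝ≥0∞, Measurable Θ →
      (∀ x y, Θ (x - ((2:ℝ) ^ j)⁻¹ • y) ≤ K * je y ^ N * Θ x) →
      Wn (ENNReal.ofReal p) b (Av i M Θ) ^ r ≤ C * tw ((j - i) * n * (1 - r)) * Wn (ENNReal.ofReal p) b Θ ^ r := by
  have hp := hr.trans_le hrp
  have hM0 : 0 ≤ M := by
    by_contra hc; push Not at hc; nlinarith [Nat.cast_nonneg (α := ℝ) n, mul_nonneg hb hr.le]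
  obtain ⟨C, hC, h⟩ := av_r (n := n) (M := M) hK hr hr1 hM0 hN (by nlinarith [mul_nonneg hb hr.le, mul_nonneg hN hr.le])
  obtain ⟨C', hC', h'⟩ := Av_lp (n := n) (mul_nonneg hb hr.le) hM
  refine ⟨C * C', ENNReal.mul_ne_top hC hC', fun i j hij Θ mΘ sΘ => ?_⟩
  rw [Wn_pow hp hr, Wn_pow hp hr]
  refine (Wn_mono _ _ (h i j hij Θ mΘ sΘ)).trans ((Wn_cmul _ _ (ENNReal.mul_ne_top hC (tw_net _)) _).trans ?_)
  have := h' (ENNReal.ofReal (p / r)) (by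
    rw [← ENNReal.ofReal_one]; exact ENNReal.ofReal_le_ofReal ((one_le_div hr).2 hrp)) i _ (mΘ.pow_const r)
  calc _ ≤ _ := mul_le_mul_right this _
    _ = _ := by ring
end KP

namespace KP
open Set Filter Topology FourierTransform
variable {n : ℕ}

lemma m0c (s : ℝ) (ζ ω : Eu n) : (m0 s ζ ω : ℂ) = bc s (ζ + ω) + (-1) * bc s ω +
    ∑ l, s * (cl l ζ * (cl l ω * bc (s - 2) ω)) := by
  have : ∀ l, (s:ℂ) * (cl l ζ * (cl l ω * bc (s - 2) ω)) = (-(s * (4 * π ^ 2) * bes (s - 2) ω) : ℂ) * ((ζ l * ω l : ℝ) : ℂ) := by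
    intro l; simp only [cl, bc]; push_cast
    linear_combination (4 * (s:ℂ) * π ^ 2 * ζ l * ω l * (bes (s - 2) ω : ℂ)) * Complex.I_sq
  rw [Finset.sum_congr rfl fun l _ => this l, ← Finset.mul_sum, ← Complex.ofReal_sum,
    show ∑ l, ζ l * ω l = ⟪ζ, ω⟫ by simp [PiLp.inner_apply, mul_comm], m0, bc, bc]
  push_cast; ring

lemma gr_pc (j k : ℕ) : Gr fun w : Eu n × Eu n => pc j w.1 * pc k w.2 := by
  have h := fun i => (pc_cs (n := n) i).hasTemperateGrowth (pc_cd i)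
  exact (Gr.tg (h j)).1.mul (Gr.tg (h k)).2.1
lemma gr_m0 (s : ℝ) : Gr fun w : Eu n × Eu n => (m0 s w.1 w.2 : ℂ) := by
  simp_rw [m0c]
  exact ((Gr.tg (bc_tg s)).2.2.add ((Gr.const _).mul (Gr.tg (bc_tg s)).2.1)).add (Gr.sum _ fun l =>
    (Gr.const _).mul ((Gr.tg (cl_tg l)).1.mul ((Gr.tg (cl_tg l)).2.1.mul (Gr.tg (bc_tg (s - 2))).2.1)))

def Sm (s : ℝ) (j k : ℕ) (f g : Sw n) (x : Eu n) : ℂ :=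
  Bil (fun w => pc j w.1 * pc k w.2 * bc s (w.1 + w.2)) f g x
def Bm (s : ℝ) (j k : ℕ) (f g : Sw n) (x : Eu n) : ℂ :=
  Bil (fun w => pc j w.1 * pc k w.2 * (m0 s w.1 w.2 : ℂ)) f g x

lemma Sm_swap (s : ℝ) (j k : ℕ) (f g : Sw n) (x : Eu n) : Sm s j k f g x = Sm s k j g f x := by
  rw [Sm, Sm, bil_swap]; congr 1; ext w; simp only [Prod.fst_swap, Prod.snd_swap]; rw [add_comm w.2]; ring

lemma TT (j k : ℕ) (α β : Eu n → ℂ) (f g : Sw n) (x : Eu n) :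
    Bil (fun w => (pc j w.1 * α w.1) * (pc k w.2 * β w.2)) f g x = T j α f x * T k β g x :=
  bil_prod (fun ζ => pc j ζ * α ζ) (fun ζ => pc k ζ * β ζ) f g x

lemma Bm_split (s : ℝ) (j k : ℕ) (f g : Sw n) (x : Eu n) : Bm s j k f g x =
    Sm s j k f g x - T j (fun _ => 1) f x * T k (bc s) g x +
      ∑ l, s * (T j (cl l) f x * T k (fun ζ => cl l ζ * bc (s - 2) ζ) g x) := by
  have hp := gr_pc (n := n) j k
  have g2 := (Gr.const (n := n) (-1)).mul (hp.mul (Gr.tg (bc_tg s)).2.1)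
  have g3 : ∀ l, Gr fun w : Eu n × Eu n => (s:ℂ) * (pc j w.1 * pc k w.2 * (cl l w.1 * (cl l w.2 * bc (s - 2) w.2))) :=
    fun l => (Gr.const _).mul (hp.mul ((Gr.tg (cl_tg l)).1.mul ((Gr.tg (cl_tg l)).2.1.mul (Gr.tg (bc_tg (s - 2))).2.1)))
  rw [Bm, show (fun w : Eu n × Eu n => pc j w.1 * pc k w.2 * (m0 s w.1 w.2 : ℂ)) = fun w =>
      (pc j w.1 * pc k w.2 * bc s (w.1 + w.2) + (-1) * (pc j w.1 * pc k w.2 * bc s w.2)) +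
      ∑ l, s * (pc j w.1 * pc k w.2 * (cl l w.1 * (cl l w.2 * bc (s - 2) w.2))) by
    ext w; rw [m0c, mul_add, Finset.mul_sum]; congr 1
    · ring
    · exact Finset.sum_congr rfl fun l _ => by ring]
  rw [bil_add ((hp.mul (Gr.tg (bc_tg s)).2.2).add g2) (Gr.sum _ g3), bil_add (hp.mul (Gr.tg (bc_tg s)).2.2) g2, bil_sum _ g3,
    bil_cmul]
  simp only [bil_cmul, ← TT, Sm, sub_eq_add_neg, neg_one_mul]
  congr 3
  · congr 1; ext w; ring
  · ext l; congr 2; ext w; ring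

def mu (s : ℝ) (j : ℕ) (w : Eu n × Eu n) : ℂ := (m0 s w.1 w.2 : ℂ) + if j = 0 then 0 else (-1) * bc s w.1
lemma gr_mu (s : ℝ) (j : ℕ) : Gr (mu (n := n) s j) := by
  refine (gr_m0 s).add ?_
  split_ifs
  · exact Gr.const 0
  · exact (Gr.const _).mul (Gr.tg (bc_tg s)).1
def Rj (s : ℝ) (j k : ℕ) (f g : Sw n) (x : Eu n) : ℂ :=
  Bil (fun w => pc j w.1 * pc k w.2 * mu s j w) f g x

lemma Rj_zero (s : ℝ) (k : ℕ) (f g : Sw n) (x : Eu n) : Rj s 0 k f g x = Bm s 0 k f g x := by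
  simp [Rj, Bm, mu]
lemma Rj_pos (s : ℝ) {j : ℕ} (hj : 1 ≤ j) (k : ℕ) (f g : Sw n) (x : Eu n) :
    Rj s j k f g x = Bm s j k f g x - T j (bc s) f x * T k (fun _ => 1) g x := by
  have hp := gr_pc (n := n) j k
  have g2 := (Gr.const (n := n) (-1)).mul (hp.mul (Gr.tg (bc_tg s)).1)
  rw [Rj, show (fun w : Eu n × Eu n => pc j w.1 * pc k w.2 * mu s j w) = fun w =>
    pc j w.1 * pc k w.2 * (m0 s w.1 w.2 : ℂ) + (-1) * (pc j w.1 * pc k w.2 * bc s w.1) by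
      ext w; rw [mu, if_neg (by omega)]; ring, bil_add (hp.mul (gr_m0 s)) g2, bil_cmul, ← TT, Bm, neg_one_mul, sub_eq_add_neg]
  congr 3; ext w; ring

def Ew (s : ℝ) (j k : ℕ) : ℝ≥0∞ := tw (j * min 1 ((s - 1) / 2) + k * (s - 1 - min 1 ((s - 1) / 2))) +
  tw (j * (s - 1 - min 1 ((s - 1) / 2)) + k * min 1 ((s - 1) / 2))

lemma tw_Ew {s e : ℝ} (κ : ℝ) {j k : ℕ} (h : ∀ ε : ℝ, ε ≤ 1 → 2 * ε ≤ s - 1 → 0 ≤ ε →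
    e ≤ κ + (j * ε + k * (s - 1 - ε)) ∨ e ≤ κ + (j * (s - 1 - ε) + k * ε)) (hs : 1 < s) : tw e ≤ tw κ * Ew s j k := by
  have h2 : 2 * min 1 ((s - 1) / 2) ≤ s - 1 := by linarith [min_le_right 1 ((s - 1) / 2)]
  rw [Ew, mul_add, ← tw_add, ← tw_add]
  rcases h _ (min_le_left _ _) h2 (le_min zero_le_one (by linarith)) with h | h
  · exact (tw_mono h).trans le_self_add
  · exact (tw_mono h).trans le_add_self

def Th (m s : ℝ) (f g : Sw n) (j k : ℕ) (x : Eu n) : ℝ≥0∞ := Pf m s f j x * Pg m s g k x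

lemma prd {τ σ : ℝ} {α β : Eu n → ℂ} (hα : Hom τ α) (hβ : Hom σ β) (hβ' : ContDiff ℝ (⊤ : ℕ∞) β) (m s : ℝ) :
    ∃ C : ℝ≥0∞, C ≠ ∞ ∧ ∀ j k, 1 ≤ j → ∀ (f g : Sw n) x,
      ‖T j α f x * T k β g x‖ₑ ≤ C * tw (j * (τ - 1) + k * σ) * Th m s f g j k x := by
  obtain ⟨C, hC, h⟩ := Fbd hα m s
  obtain ⟨C', hC', h'⟩ := Gbd hβ hβ' m s
  refine ⟨C * C', ENNReal.mul_ne_top hC hC', fun j k hj f g x => ?_⟩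
  rw [enorm_mul, tw_add, Th]
  exact (mul_le_mul' (h j hj f x) (h' k g x)).trans (le_of_eq (by ring))

lemma c1_cd : ContDiff ℝ (⊤ : ℕ∞) fun _ : Eu n => (1:ℂ) := contDiff_const
lemma clb_cd (l : Fin n) (s : ℝ) : ContDiff ℝ (⊤ : ℕ∞) fun ζ => cl l ζ * bc s ζ := (tg_cd (cl_tg l)).mul (tg_cd (bc_tg s))

lemma prods (m s : ℝ) : ∃ C : ℝ≥0∞, C ≠ ∞ ∧ ∀ j k, 1 ≤ j → ∀ (f g : Sw n) x,
    ‖T j (fun _ => 1) f x * T k (bc s) g x‖ₑ ≤ C * tw (-j + k * s) * Th m s f g j k x ∧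
    ‖∑ l, (s:ℂ) * (T j (cl l) f x * T k (fun ζ => cl l ζ * bc (s - 2) ζ) g x)‖ₑ ≤ C * tw (k * (s - 1)) * Th m s f g j k x ∧
    ‖T j (bc s) f x * T k (fun _ => 1) g x‖ₑ ≤ C * tw (j * (s - 1)) * Th m s f g j k x ∧
    ‖∑ l, (s:ℂ) * (T k (cl l) g x * T j (fun ζ => cl l ζ * bc (s - 2) ζ) f x)‖ₑ ≤
      C * tw (j * (s - 2) + k) * Th m s f g j k x := by
  obtain ⟨C1, h1, H1⟩ := prd (hom_const (n := n) 1) (hom_bc s) (tg_cd (bc_tg s)) m s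
  choose C2 h2 H2 using fun l : Fin n => prd (hom_cl l) ((hom_cl l).mul (hom_bc (s - 2))) (clb_cd l (s - 2)) m s
  obtain ⟨C3, h3, H3⟩ := prd (hom_bc (n := n) s) (hom_const 1) c1_cd m s
  choose C4 h4 H4 using fun l : Fin n => prd ((hom_cl l).mul (hom_bc (s - 2))) (hom_cl l) (tg_cd (cl_tg l)) m s
  have hh : ∀ (D : Fin n → ℝ≥0∞) (t : ℝ) (F : Fin n → ℂ) (θ : ℝ≥0∞), (∀ l, ‖F l‖ₑ ≤ D l * tw t * θ) →
      ‖∑ l, (s:ℂ) * F l‖ₑ ≤ (∑ l, ‖(s:ℂ)‖ₑ * D l) * tw t * θ := by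
    intro D t F θ h
    refine (enorm_sum_le _ _).trans ?_
    rw [Finset.sum_mul, Finset.sum_mul]
    refine Finset.sum_le_sum fun l _ => ?_
    rw [enorm_mul, mul_assoc, mul_assoc, ← mul_assoc (D l)]; exact mul_le_mul_right (h l) _
  refine ⟨C1 + (∑ l, ‖(s:ℂ)‖ₑ * C2 l) + C3 + ∑ l, ‖(s:ℂ)‖ₑ * C4 l, by simp [h1, h2, h3, h4, ENNReal.mul_eq_top],
    fun j k hj f g x => ⟨?_, ?_, ?_, ?_⟩⟩
  · have := H1 j k hj f g x
    rw [show (j * ((0:ℝ) - 1) + k * s) = -j + k * s by ring] at this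
    refine this.trans ?_
    gcongr; exact le_trans (by rw [add_assoc, add_assoc]; exact le_self_add) le_rfl
  · refine (hh C2 (k * (s - 1)) _ (Th m s f g j k x) fun l => ?_).trans ?_
    · have := H2 l j k hj f g x
      rwa [show (j * ((1:ℝ) - 1) + k * (1 + (s - 2))) = k * (s - 1) by ring] at this
    · gcongr; rw [add_assoc, add_assoc]; exact le_add_left le_self_add
  · have := H3 j k hj f g x
    rw [show (j * (s - 1) + k * (0:ℝ)) = j * (s - 1) by ring] at this
    refine this.trans ?_
    gcongr; rw [add_assoc]; exact le_add_left le_self_add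
  · refine (hh C4 (j * (s - 2) + k) _ (Th m s f g j k x) fun l => ?_).trans ?_
    · have := H4 l j k hj f g x
      rw [show (j * (1 + (s - 2) - 1) + k * 1) = j * (s - 2) + k by ring] at this
      rwa [mul_comm (T k (cl l) g x)]
    · gcongr; exact le_add_self
end KP

namespace KP
open Set Filter Topology FourierTransform
variable {n : ℕ}

lemma Fcl (m s : ℝ) : ∃ C : ℝ≥0∞, C ≠ ∞ ∧ ∀ j l (f : Sw n) x, ‖T j (cl l) f x‖ₑ ≤ C * Pf m s f j x := by
  choose C hC h using fun l : Fin n => Fbd (hom_cl l) m s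
  choose C' hC' h' using fun l : Fin n => F0bd c1_cd l m s
  refine ⟨∑ l, (C l + C' l), by simp [hC, hC'], fun j l f x => ?_⟩
  have hl : C l + C' l ≤ ∑ l, (C l + C' l) := Finset.single_le_sum (f := fun l => C l + C' l) (fun _ _ => zero_le) (Finset.mem_univ l)
  rcases Nat.eq_zero_or_pos j with rfl | hj
  · have := h' l f x
    simp only [one_mul] at this
    exact this.trans (mul_le_mul_left (le_add_self.trans hl) _)
  · have := h l j hj f x
    rw [sub_self, mul_zero, tw_zero, mul_one] at this
    exact this.trans (mul_le_mul_left (le_self_add.trans hl) _)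

lemma up {a C E θ : ℝ≥0∞} {e κ : ℝ} (h : a ≤ C * tw e * θ) (h' : tw e ≤ tw κ * E) : a ≤ C * tw κ * (E * θ) :=
  (h.trans (mul_le_mul_left (mul_le_mul_right h' C) θ)).trans (le_of_eq (by ring))

lemma R_II {m s : ℝ} (hm : 0 ≤ m) (hs : 1 < s) : ∃ C : ℝ≥0∞, C ≠ ∞ ∧ ∀ j k : ℕ, j ≤ k → (j + 3 ≤ k ∨ k ≤ 2) →
    ∀ (f g : Sw n) x, ‖Rj s j k f g x‖ₑ ≤ C * (Ew s j k * Th m s f g j k x) := by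
  obtain ⟨B, hB, bil⟩ := BIL (n := n) s hm
  obtain ⟨F, hF, hf⟩ := Fcl (n := n) m s
  obtain ⟨G, hG, hg⟩ := Gbd (hom_const (n := n) 1) c1_cd m s
  obtain ⟨C, hC, hc⟩ := prods (n := n) m s
  refine ⟨B * F * G * tw 0 + C * tw 0, by simp [hB, hF, hG, hC, ENNReal.mul_eq_top], fun j k hjk hr f g x => ?_⟩
  have hjk' : (j:ℝ) ≤ k := by exact_mod_cast hjk
  have hb : ‖Bm s j k f g x‖ₑ ≤ B * F * G * tw 0 * (Ew s j k * Th m s f g j k x) := by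
    refine up (e := j + k * (s - 2)) ((bil j k hjk hr f g _ _ ((Pf_slow hm s f j).cmul F) ((Pg_slow hm s g k).cmul G)
      (fun l y => hf j l f y) (fun y => ?_) x).trans (le_of_eq (by rw [Th]; ring)))
      (tw_Ew _ (fun ε h1 h2 h0 => Or.inl ?_) hs)
    · have := hg k g y
      rwa [mul_zero, tw_zero, mul_one] at this
    · nlinarith
  rcases Nat.eq_zero_or_pos j with rfl | hj
  · rw [Rj_zero, add_mul]; exact hb.trans le_self_add
  · rw [Rj_pos s hj, add_mul]
    refine enorm_sub_le.trans (add_le_add hb (up (hc j k hj f g x).2.2.1 (tw_Ew _ (fun ε h1 h2 h0 => Or.inl ?_) hs)))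
    nlinarith

lemma R_I {m s : ℝ} (hm : 0 ≤ m) (hs : 1 < s) : ∃ C : ℝ≥0∞, C ≠ ∞ ∧ ∀ j k : ℕ, k + 3 ≤ j →
    ∀ (f g : Sw n) x, ‖Rj s j k f g x‖ₑ ≤ C * (Ew s j k * Th m s f g j k x) := by
  obtain ⟨B, hB, bil⟩ := BIL (n := n) s hm
  choose G' hG' hg' using fun l : Fin n => Gbd (hom_cl l) (tg_cd (cl_tg l)) m s
  obtain ⟨F, hF, hf⟩ := Fbd (hom_const (n := n) 1) m s
  obtain ⟨C, hC, hc⟩ := prods (n := n) m s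
  refine ⟨B * (∑ l, G' l) * F * tw 0 + C * tw 0 + C * tw 0 + C * tw 0,
    by simp [hB, hF, hG', hC, ENNReal.mul_eq_top], fun j k hjk f g x => ?_⟩
  have hjk' : (k:ℝ) + 3 ≤ j := by exact_mod_cast hjk
  have hb : ‖Bm s k j g f x‖ₑ ≤ B * (∑ l, G' l) * F * tw 0 * (Ew s j k * Th m s f g j k x) := by
    refine up (e := k + j * (s - 2) + k + -j) ((bil k j (by omega) (Or.inl hjk) g f _ _
      ((Pg_slow hm s g k).cmul ((∑ l, G' l) * tw k)) ((Pf_slow hm s f j).cmul (F * tw (-j)))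
      (fun l y => ?_) (fun y => ?_) x).trans (le_of_eq (by rw [Th, tw_add _ (-(j:ℝ)), tw_add _ (k:ℝ)]; ring)))
      (tw_Ew _ (fun ε h1 h2 h0 => Or.inr ?_) hs)
    · have := hg' l k g y
      rw [mul_one] at this
      refine this.trans ?_
      gcongr; exact Finset.single_le_sum (fun _ _ => zero_le) (Finset.mem_univ l)
    · have := hf j (by omega) f y
      rwa [show (j:ℝ) * (0 - 1) = -j by ring] at this
    · nlinarith
  obtain ⟨c1, c2, -, c4⟩ := hc j k (by omega) f g x
  have e : Rj s j k f g x = Bm s k j g f x - (T j (fun _ => 1) f x * T k (bc s) g x) +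
      (∑ l, (s:ℂ) * (T j (cl l) f x * T k (fun ζ => cl l ζ * bc (s - 2) ζ) g x)) -
      ∑ l, (s:ℂ) * (T k (cl l) g x * T j (fun ζ => cl l ζ * bc (s - 2) ζ) f x) := by
    rw [Rj_pos s (by omega), Bm_split s j k, Sm_swap, Bm_split s k j]; ring
  rw [e, add_mul, add_mul, add_mul]
  refine enorm_sub_le.trans (add_le_add ((enorm_add_le _ _).trans (add_le_add (enorm_sub_le.trans (add_le_add hb ?_)) ?_)) ?_)
  · exact up c1 (tw_Ew _ (fun ε h1 h2 h0 => Or.inr (by nlinarith)) hs)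
  · exact up c2 (tw_Ew _ (fun ε h1 h2 h0 => Or.inr (by nlinarith)) hs)
  · exact up c4 (tw_Ew _ (fun ε h1 h2 h0 => Or.inr (by nlinarith)) hs)

lemma tw_geo {δ : ℝ} (hδ : 0 < δ) : ∃ C : ℝ≥0∞, C ≠ ∞ ∧ ∀ N : ℕ, ∑ i ∈ Finset.range N, tw (i * δ) ≤ C * tw (N * δ) := by
  have h1 : (1:ℝ) < 2 ^ δ := Real.one_lt_rpow one_lt_two hδ
  refine ⟨ENNReal.ofReal ((2 ^ δ - 1)⁻¹), by simp, fun N => ?_⟩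
  simp_rw [tw_real]
  rw [← ENNReal.ofReal_sum_of_nonneg (fun _ _ => by positivity), ← ENNReal.ofReal_mul (by simp; linarith)]
  refine ENNReal.ofReal_le_ofReal ?_
  have e : ∀ i : ℕ, (2:ℝ) ^ (i * δ) = ((2:ℝ) ^ δ) ^ i := fun i => by
    rw [mul_comm, Real.rpow_mul (by norm_num), Real.rpow_natCast]
  simp_rw [e]
  rw [geom_sum_eq h1.ne', div_eq_inv_mul]
  have : 0 < ((2:ℝ) ^ δ - 1)⁻¹ := inv_pos.2 (by linarith)
  gcongr; linarith

lemma Th_slow {m : ℝ} (hm : 0 ≤ m) (s : ℝ) (f g : Sw n) {j k : ℕ} (hk : k ≤ j + 2) (x y : Eu n) :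
    Th m s f g j k (x - ((2:ℝ) ^ j)⁻¹ • y) ≤ tw (2 * m) * je y ^ (m + m) * Th m s f g j k x := by
  have h1 := Pf_slow hm s f j x y
  have h2 := Pg_slow hm s g k x (((2:ℝ) ^ k * ((2:ℝ) ^ j)⁻¹) • y)
  rw [smul_smul, ← mul_assoc, inv_mul_cancel₀ (by positivity), one_mul] at h2
  have h3 : je (((2:ℝ) ^ k * ((2:ℝ) ^ j)⁻¹) • y) ≤ tw 2 * je y := by
    have h4 : (2:ℝ) ^ k * ((2:ℝ) ^ j)⁻¹ ≤ 4 := by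
      rw [← div_eq_mul_inv, div_le_iff₀ (by positivity)]
      calc (2:ℝ) ^ k ≤ 2 ^ (j + 2) := pow_le_pow_right₀ one_le_two hk
        _ = _ := by ring
    rw [je_eq, je_eq, tw_real, ← ENNReal.ofReal_mul (by positivity), norm_smul, Real.norm_of_nonneg (by positivity)]
    refine ENNReal.ofReal_le_ofReal ?_
    norm_num; nlinarith [norm_nonneg y]
  have h5 := rpl h3 hm
  rw [rpm _ _ hm, tw_pow] at h5
  rw [Th, Th, je_add]
  exact (mul_le_mul' h1 (h2.trans (mul_le_mul_left h5 _))).trans (le_of_eq (by ring))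
end KP

namespace KP
open Set Filter Topology FourierTransform
variable {n : ℕ}

lemma Th_meas (m s : ℝ) (f g : Sw n) (j k : ℕ) : Measurable (Th m s f g j k) :=
  (Pf_meas m s f j).mul (Pg_meas m s g k)
lemma Ew_net (s : ℝ) (j k : ℕ) : Ew s j k ≠ ∞ := by simp [Ew]

lemma pc_sum (N : ℕ) (ζ : Eu n) : ∑ i ∈ Finset.range (N + 1), pc i ζ = (phj N ζ : ℂ) := by
  simp only [pc]; rw [← Complex.ofReal_sum, ps_sum]

lemma Sm_sum (s : ℝ) {j k : ℕ} (hk : k ≤ j + 2) (f g : Sw n) (x : Eu n) :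
    Sm s j k f g x = ∑ i ∈ Finset.range (j + 4 + 1),
      T i (bc s) (pm (Fm (fun ζ => pc j ζ * 1) f) (Fm (fun ζ => pc k ζ * 1) g)) x := by
  have hi := fun i => pcP_tg (n := n) i (tg_cd (bc_tg s))
  have h1 := fun i => pcP_tg (n := n) i c1_cd
  have : ∀ i, T i (bc s) (pm (Fm (fun ζ => pc j ζ * 1) f) (Fm (fun ζ => pc k ζ * 1) g)) x =
    Bil (fun w => pc i (w.1 + w.2) * bc s (w.1 + w.2)) (Fm (fun ζ => pc j ζ * 1) f) (Fm (fun ζ => pc k ζ * 1) g) x :=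
    fun i => bil_pm (P := fun ζ => pc i ζ * bc s ζ) (Gr.tg (hi i)).2.2 _ _ x
  simp_rw [this]
  rw [← bil_sum _ (M := fun i w => pc i (w.1 + w.2) * bc s (w.1 + w.2)) fun i => (Gr.tg (hi i)).2.2, Sm, Bil, Bil]
  congr 1; ext w
  rw [Fm_hat (h1 j), Fm_hat (h1 k), ← Finset.sum_mul, pc_sum]
  by_cases hz : pc j w.1 = 0
  · simp [hz]
  by_cases hw : pc k w.2 = 0
  · simp [hw]
  have a1 := pc_sm hz
  have a2 := pc_sm hw
  rw [nsm, inv_mul_le_iff₀ (by positivity)] at a1 a2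
  have a3 : (2:ℝ) ^ k ≤ 2 ^ j * 4 := (pow_le_pow_right₀ one_le_two hk).trans (le_of_eq (by ring))
  have a4 : phj (j + 4) (w.1 + w.2) = 1 := by
    refine ph_one ?_
    rw [nsm, inv_mul_le_iff₀ (by positivity), pow_add]
    have := norm_add_le w.1 w.2
    have : (0:ℝ) < 2 ^ j := by positivity
    linarith
  rw [a4]; push_cast; ring

lemma Av_cmul (j : ℕ) (m : ℝ) {c : ℝ≥0∞} (hc : c ≠ ∞) (F : Eu n → ℝ≥0∞) (x : Eu n) :
    Av j m (fun y => c * F y) x = c * Av j m F x := by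
  rw [Av, Av, ← lintegral_const_mul' _ _ hc]; congr 1; ext y; ring

lemma R_III (m M : ℝ) {s : ℝ} (hs : 1 < s) : ∃ C : ℝ≥0∞, C ≠ ∞ ∧ ∀ j k : ℕ, 1 ≤ j → k ≤ j + 2 → j ≤ k + 2 →
    ∀ (f g : Sw n) x, ‖Rj s j k f g x‖ₑ ≤ (∑ i ∈ Finset.range (j + 4 + 1), C * tw (i * s - j) *
      Av i M (Th m s f g j k) x) + C * (Ew s j k * Th m s f g j k x) := by
  obtain ⟨L, hL, lin⟩ := LINa (hom_bc (n := n) s) (tg_cd (bc_tg s)) M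
  obtain ⟨D, hD, hd⟩ := prd (hom_const (n := n) 1) (hom_const 1) c1_cd m s
  obtain ⟨C, hC, hc⟩ := prods (n := n) m s
  refine ⟨L * D + (C * tw 4 + C * tw 2 + C * tw 2), by simp [hL, hD, hC, ENNReal.mul_eq_top], fun j k hj hk hk' f g x => ?_⟩
  have q1 : (k:ℝ) ≤ j + 2 := by exact_mod_cast hk
  have q2 : (j:ℝ) ≤ k + 2 := by exact_mod_cast hk'
  obtain ⟨c1, c2, c3, -⟩ := hc j k hj f g x
  rw [Rj_pos s hj, Bm_split]
  have a1 := up (κ := 4) c1 (tw_Ew (j := j) (k := k) _ (fun ε h1 h2 h0 => Or.inl (by nlinarith)) hs)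
  have a2 := up (κ := 2) c2 (tw_Ew (j := j) (k := k) _ (fun ε h1 h2 h0 => Or.inl (by nlinarith)) hs)
  have a3 := up (κ := 2) c3 (tw_Ew (j := j) (k := k) _ (fun ε h1 h2 h0 => Or.inr (by nlinarith)) hs)
  have a0 : ‖Sm s j k f g x‖ₑ ≤ ∑ i ∈ Finset.range (j + 4 + 1), L * D * tw (i * s - j) * Av i M (Th m s f g j k) x := ?_
  · refine enorm_sub_le.trans ((add_le_add ((enorm_add_le _ _).trans (add_le_add (enorm_sub_le.trans
      (add_le_add a0 a1)) a2)) a3).trans ?_)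
    rw [add_assoc, add_assoc, ← add_assoc (C * tw 4 * _), ← add_mul, ← add_mul]
    exact add_le_add (Finset.sum_le_sum fun i _ => mul_le_mul_left (mul_le_mul_left le_self_add _) _)
      (mul_le_mul_left le_add_self _)
  · rw [Sm_sum s hk]
    refine (enorm_sum_le _ _).trans (Finset.sum_le_sum fun i _ => (lin i _ x).trans ?_)
    have : Av i M (fun y => ‖pm (Fm (fun ζ => pc j ζ * 1) f) (Fm (fun ζ => pc k ζ * 1) g) y‖ₑ) x ≤
        (D * tw (-j)) * Av i M (Th m s f g j k) x := by
      rw [← Av_cmul i M (ENNReal.mul_ne_top hD (tw_net _))]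
      refine Av_mono i M (fun y => ?_) x
      have := hd j k hj f g y
      rw [T_Fm j c1_cd, T_Fm k c1_cd, show (j:ℝ) * (0 - 1) + k * 0 = -j by ring] at this
      rwa [pm_apply]
    refine (mul_le_mul_right this _).trans (le_of_eq ?_)
    rw [sub_eq_add_neg, tw_add]; ring

lemma RB {p r b m s : ℝ} (hr : 0 < r) (hr1 : r ≤ 1) (hrp : r ≤ p) (hb : 0 ≤ b) (hm : 0 ≤ m) (hs : 1 < s)
    (hδ : n * (1 - r) < s * r) : ∃ C : ℝ≥0∞, C ≠ ∞ ∧ ∀ (j k : ℕ) (f g : Sw n),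
      Wn (ENNReal.ofReal p) b (fun x => ‖Rj s j k f g x‖ₑ) ^ r ≤ C * (Ew s j k * Wn (ENNReal.ofReal p) b (Th m s f g j k)) ^ r := by
  obtain ⟨C1, hC1, h1⟩ := R_I (n := n) hm hs
  obtain ⟨C2, hC2, h2⟩ := R_II (n := n) hm hs
  obtain ⟨M, hM⟩ : ∃ M : ℝ, n + b * r < M * r := ⟨(n + b * r + 1) / r, by rw [div_mul_cancel₀ _ hr.ne']; linarith⟩
  obtain ⟨C3, hC3, h3⟩ := R_III (n := n) m M hs
  obtain ⟨A, hA, av⟩ := av_wn (p := p) (tw_net (2 * m)) hr hr1 hrp hb (by linarith : 0 ≤ m + m) hM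
  obtain ⟨G, hG, geo⟩ := tw_geo (sub_pos.2 hδ)
  set δ := s * r - n * (1 - r) with hdel
  have cm : ∀ {C : ℝ≥0∞}, C ≠ ∞ → ∀ (j k : ℕ) (f g : Sw n),
      Wn (ENNReal.ofReal p) b (fun x => C * (Ew s j k * Th m s f g j k x)) ^ r ≤
        C ^ r * (Ew s j k * Wn (ENNReal.ofReal p) b (Th m s f g j k)) ^ r := by
    intro C hC j k f g
    rw [← rpm _ _ hr.le]
    exact rpl ((Wn_cmul _ _ hC _).trans (mul_le_mul_right (Wn_cmul _ _ (Ew_net s j k) _) _)) hr.le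
  refine ⟨C1 ^ r + C2 ^ r + (C3 ^ r * A * G * tw (5 * δ) * tw (2 * r) + C3 ^ r), ?_, fun j k f g => ?_⟩
  · have := fun {C : ℝ≥0∞} (h : C ≠ ∞) => rp_ne h hr.le
    simp only [ne_eq, ENNReal.add_eq_top, not_or]
    exact ⟨⟨this hC1, this hC2⟩, ENNReal.mul_ne_top (ENNReal.mul_ne_top (ENNReal.mul_ne_top (ENNReal.mul_ne_top
      (this hC3) hA) hG) (tw_net _)) (tw_net _), this hC3⟩
  rw [add_mul, add_mul]
  by_cases c1 : k + 3 ≤ j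
  · exact ((rpl (Wn_mono _ _ (h1 j k c1 f g)) hr.le).trans (cm hC1 j k f g)).trans (le_self_add.trans le_self_add)
  by_cases c2 : j ≤ k ∧ (j + 3 ≤ k ∨ k ≤ 2)
  · exact ((rpl (Wn_mono _ _ (h2 j k c2.1 c2.2 f g)) hr.le).trans (cm hC2 j k f g)).trans
      (le_add_self.trans le_self_add)
  refine le_trans ?_ le_add_self
  have mT := Th_meas m s f g j k
  refine (rpl (Wn_mono _ _ (h3 j k (by omega) (by omega) (by omega) f g)) hr.le).trans
    ((Wn_add_r hr hr1 hrp b (Finset.measurable_sum _ fun i _ => (Av_meas i M mT).const_mul _)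
      ((mT.const_mul _).const_mul _)).trans ?_)
  rw [add_mul]
  refine add_le_add ?_ (cm hC3 j k f g)
  refine (Wn_sum_r hr hr1 hrp b _ fun i => (Av_meas i M mT).const_mul _).trans ?_
  have q2 : (j:ℝ) ≤ k + 2 := by exact_mod_cast (show j ≤ k + 2 by omega)
  have fin : tw (j * (s - 1)) ^ r ≤ tw (2 * r) * Ew s j k ^ r := by
    rw [← tw_pow 2, ← rpm _ _ hr.le]
    exact rpl (tw_Ew _ (fun ε h1 h2 h0 => Or.inr (by nlinarith)) hs) hr.le
  calc _ ≤ ∑ i ∈ Finset.range (j + 4 + 1), (C3 ^ r * A * tw (j * (n * (1 - r) - r)) *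
        Wn (ENNReal.ofReal p) b (Th m s f g j k) ^ r) * tw (i * δ) := by
        refine Finset.sum_le_sum fun i hi => ?_
        refine (rpl (Wn_cmul _ _ (ENNReal.mul_ne_top hC3 (tw_net _)) _) hr.le).trans ?_
        rw [rpm _ _ hr.le, rpm _ _ hr.le, tw_pow]
        refine (mul_le_mul_right (av i j (by simp at hi; omega) _ mT (fun x y => Th_slow hm s f g (by omega) x y)) _).trans
          (le_of_eq ?_)
        have : tw ((i * s - j) * r) * tw ((j - i) * n * (1 - r)) = tw (j * (n * (1 - r) - r)) * tw (i * δ) := by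
          rw [← tw_add, ← tw_add]; congr 1; rw [hdel]; ring
        calc _ = C3 ^ r * A * (tw ((i * s - j) * r) * tw ((j - i) * n * (1 - r))) * Wn (ENNReal.ofReal p) b (Th m s f g j k) ^ r := by ring
          _ = _ := by rw [this]; ring
    _ ≤ (C3 ^ r * A * tw (j * (n * (1 - r) - r)) * Wn (ENNReal.ofReal p) b (Th m s f g j k) ^ r) * (G * tw ((j + 4 + 1 : ℕ) * δ)) := by
        rw [← Finset.mul_sum]; exact mul_le_mul_right (geo _) _
    _ = C3 ^ r * A * G * tw (5 * δ) * Wn (ENNReal.ofReal p) b (Th m s f g j k) ^ r * tw (j * (s - 1)) ^ r := by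
        have : tw (j * (n * (1 - r) - r)) * tw ((j + 4 + 1 : ℕ) * δ) = tw (5 * δ) * tw (j * (s - 1)) ^ r := by
          rw [tw_pow, ← tw_add, ← tw_add]; congr 1; rw [hdel]; push_cast; ring
        calc _ = C3 ^ r * A * G * Wn (ENNReal.ofReal p) b (Th m s f g j k) ^ r * (tw (j * (n * (1 - r) - r)) * tw ((j + 4 + 1 : ℕ) * δ)) := by ring
          _ = _ := by rw [this]; ring
    _ ≤ _ := by
        rw [rpm _ _ hr.le]
        exact (mul_le_mul_right fin _).trans (le_of_eq (by ring))
end KP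

namespace KP
open Set Filter Topology FourierTransform
variable {n : ℕ}

lemma tw_Z {δ : ℝ} (hδ : 0 < δ) : ∑' i : ℤ, tw (-(δ * |(i:ℝ)|)) ≠ ∞ := by
  simp_rw [tw_real]
  have e : ∀ i : ℕ, (2:ℝ) ^ (-(δ * (i:ℝ))) = ((2:ℝ) ^ (-δ)) ^ i := fun i => by
    rw [← neg_mul, Real.rpow_mul (by norm_num), Real.rpow_natCast]
  have h1 : (2:ℝ) ^ (-δ) < 1 := Real.rpow_lt_one_of_one_lt_of_neg one_lt_two (by linarith)
  have h := summable_geometric_of_lt_one (by positivity) h1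
  rw [← ENNReal.ofReal_tsum_of_nonneg (fun _ => by positivity)]
  · simp
  · refine Summable.of_nat_of_neg ?_ ?_ <;> simpa [e] using h

lemma tw_ex {Z : ℝ≥0∞} (h0 : Z ≠ 0) (ht : Z ≠ ∞) : ∃ σ, Z = tw σ := by
  refine ⟨Real.logb 2 Z.toReal, ?_⟩
  rw [tw_real, Real.rpow_logb (by norm_num) (by norm_num) (ENNReal.toReal_pos h0 ht), ENNReal.ofReal_toReal ht]

lemma geo1 {α β r : ℝ} (hα : 0 < α) (hβ : α < β) (hr : 0 < r) : ∃ C : ℝ≥0∞, C ≠ ∞ ∧ ∀ X Y : ℝ≥0∞, X ≠ 0 → X ≠ ∞ → Y ≠ 0 →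
    Y ≠ ∞ → ∀ S : Finset ℕ, ∑ j ∈ S, (tw (j * α) * min X (tw (j * -β) * Y)) ^ r ≤ C * (X ^ (1 - α / β) * Y ^ (α / β)) ^ r := by
  have hb : 0 < β := hα.trans hβ
  set δ := min α (β - α) with hδ
  have d0 : 0 < δ := lt_min hα (by linarith)
  refine ⟨tw (δ * r) * ∑' i : ℤ, tw (-(δ * r * |(i:ℝ)|)), ENNReal.mul_ne_top (tw_net _) (tw_Z (by positivity)),
    fun X Y x0 xt y0 yt S => ?_⟩
  obtain ⟨σ', hσ'⟩ := tw_ex (ENNReal.div_ne_zero.2 ⟨y0, xt⟩) (ENNReal.div_ne_top yt x0)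
  obtain ⟨σ, rfl⟩ : ∃ σ, σ' = σ * β := ⟨σ' / β, by field_simp⟩
  have hY : Y = tw (σ * β) * X := by rw [← hσ', ENNReal.div_mul_cancel x0 xt]
  have e : X ^ (1 - α / β) * Y ^ (α / β) = tw (σ * α) * X := by
    rw [hY, rpm _ _ (by positivity), tw_pow, show σ * β * (α / β) = σ * α by field_simp, mul_left_comm,
      ← ENNReal.rpow_add _ _ x0 xt]; simp
  have key : ∀ j : ℕ, (tw (j * α) * min X (tw (j * -β) * Y)) ^ r ≤
      (tw (δ * r) * (tw (σ * α) * X) ^ r) * tw (-(δ * r * |(((j:ℤ) - ⌊σ⌋ : ℤ) : ℝ)|)) := by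
    intro j
    have h1 : tw (j * α) * min X (tw (j * -β) * Y) ≤ tw (-(δ * |j - σ|)) * (tw (σ * α) * X) := by
      rw [← mul_assoc, ← tw_add]
      rcases le_total (j:ℝ) σ with h | h
      · refine mul_le_mul' (tw_mono ?_) (min_le_left _ _)
        rw [abs_of_nonpos (by linarith)]; nlinarith [min_le_left α (β - α)]
      · refine (mul_le_mul_right (min_le_right _ _) _).trans ?_
        rw [hY, ← mul_assoc, ← mul_assoc, ← tw_add, ← tw_add]
        refine mul_le_mul_left (tw_mono ?_) _
        rw [abs_of_nonneg (by linarith)]; nlinarith [min_le_right α (β - α)]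
    refine (rpl h1 hr.le).trans ?_
    rw [rpm _ _ hr.le, tw_pow, mul_comm (tw (δ * r)), mul_assoc, ← tw_add, mul_comm]
    refine mul_le_mul_right (tw_mono ?_) _
    have a : |(((j:ℤ) - ⌊σ⌋ : ℤ) : ℝ)| ≤ |j - σ| + 1 := by
      push_cast
      have := abs_add_le ((j:ℝ) - σ) (σ - ⌊σ⌋)
      have h2 : |σ - ⌊σ⌋| ≤ 1 := by rw [abs_of_nonneg (by linarith [Int.floor_le σ])]; linarith [Int.lt_floor_add_one σ]
      rw [sub_add_sub_cancel] at this; linarith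
    nlinarith [mul_pos d0 hr]
  rw [e]
  calc _ ≤ ∑ j ∈ S, (tw (δ * r) * (tw (σ * α) * X) ^ r) * tw (-(δ * r * |(((j:ℤ) - ⌊σ⌋ : ℤ) : ℝ)|)) := Finset.sum_le_sum fun j _ => key j
    _ = (tw (δ * r) * (tw (σ * α) * X) ^ r) * ∑ j ∈ S, tw (-(δ * r * |(((j:ℤ) - ⌊σ⌋ : ℤ) : ℝ)|)) := by rw [Finset.mul_sum]
    _ ≤ (tw (δ * r) * (tw (σ * α) * X) ^ r) * ∑' i : ℤ, tw (-(δ * r * |(i:ℝ)|)) := by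
        refine mul_le_mul_right ((ENNReal.sum_le_tsum S).trans ?_) _
        exact ENNReal.tsum_comp_le_tsum_of_injective (f := fun j : ℕ => (j:ℤ) - ⌊σ⌋) (fun a b h => by simpa using h)
          (fun i : ℤ => tw (-(δ * r * |(i:ℝ)|)))
    _ = _ := by ring

lemma interp {θ : ℝ} (h0 : 0 ≤ θ) (h1 : θ ≤ 1) (X₁ Y₁ X₂ Y₂ : ℝ≥0∞) :
    X₁ ^ (1 - θ) * Y₁ ^ θ * (X₂ ^ θ * Y₂ ^ (1 - θ)) ≤ X₁ * Y₂ + Y₁ * X₂ := by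
  have h : 0 ≤ 1 - θ := by linarith
  calc _ = (X₁ * Y₂) ^ (1 - θ) * (Y₁ * X₂) ^ θ := by
        rw [rpm _ _ h, rpm _ _ h0]; ring
    _ ≤ (X₁ * Y₂ + Y₁ * X₂) ^ (1 - θ) * (X₁ * Y₂ + Y₁ * X₂) ^ θ := by
        gcongr
        · exact le_self_add
        · exact le_add_self
    _ = _ := by rw [← ENNReal.rpow_add_of_nonneg _ _ h h0]; simp

lemma geo2 {s r : ℝ} (hs : 1 < s) (hr : 0 < r) (hr1 : r ≤ 1) : ∃ C : ℝ≥0∞, C ≠ ∞ ∧ ∀ (X₁ Y₁ X₂ Y₂ : ℝ≥0∞) (S : Finset ℕ),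
    ∑ j ∈ S, ∑ k ∈ S, (Ew s j k * (min X₁ (tw (j * -(s - 1)) * Y₁) * min X₂ (tw (k * -(s - 1)) * Y₂))) ^ r ≤
      C * (X₁ * Y₂ + Y₁ * X₂) ^ r := by
  set ε := min 1 ((s - 1) / 2) with hε
  have e0 : 0 < ε := lt_min one_pos (by linarith)
  have e1 : 2 * ε ≤ s - 1 := by linarith [min_le_right 1 ((s - 1) / 2)]
  obtain ⟨C, hC, hc⟩ := geo1 e0 (by linarith : ε < s - 1) hr
  obtain ⟨C', hC', hc'⟩ := geo1 (by linarith : 0 < s - 1 - ε) (by linarith : s - 1 - ε < s - 1) hr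
  refine ⟨C * C' + C' * C + 1, by simp [hC, hC', ENNReal.mul_eq_top], fun X₁ Y₁ X₂ Y₂ S => ?_⟩
  by_cases z : X₁ = 0 ∨ Y₁ = 0 ∨ X₂ = 0 ∨ Y₂ = 0
  · rcases z with rfl | rfl | rfl | rfl <;> simp [hr]
  by_cases ht : X₁ * Y₂ + Y₁ * X₂ = ∞
  · rw [ht, ENNReal.top_rpow_of_pos hr, ENNReal.mul_top (by simp)]; exact le_top
  have z' : (X₁ ≠ 0 ∧ X₁ ≠ ∞) ∧ (Y₁ ≠ 0 ∧ Y₁ ≠ ∞) ∧ (X₂ ≠ 0 ∧ X₂ ≠ ∞) ∧ (Y₂ ≠ 0 ∧ Y₂ ≠ ∞) := by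
    simp only [not_or] at z
    simp only [ENNReal.add_eq_top, ENNReal.mul_eq_top, not_or, not_and_or, not_not] at ht
    obtain ⟨a, b, c, d⟩ := z
    simp only [a, b, c, d, false_or, or_false] at ht
    tauto
  obtain ⟨⟨a, a'⟩, ⟨b, b'⟩, ⟨c, c'⟩, d, d'⟩ := z'
  have p1 := hc X₁ Y₁ a a' b b' S
  have p2 := hc' X₂ Y₂ c c' d d' S
  have p3 := hc' X₁ Y₁ a a' b b' S
  have p4 := hc X₂ Y₂ c c' d d' S
  have t1 : ε / (s - 1) ≤ 1 := (div_le_one (by linarith)).2 (by linarith)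
  have t0 : 0 ≤ ε / (s - 1) := div_nonneg e0.le (by linarith)
  rw [show (s - 1 - ε) / (s - 1) = 1 - ε / (s - 1) by rw [sub_div, div_self (by linarith)], sub_sub_cancel] at p2 p3
  have i1 := interp t0 t1 X₁ Y₁ X₂ Y₂
  have i2 := interp t0 t1 Y₁ X₁ Y₂ X₂
  have st : ∀ (x y : ℕ → ℝ≥0∞), ∑ j ∈ S, ∑ k ∈ S, (x j * y k) ^ r = (∑ j ∈ S, x j ^ r) * ∑ k ∈ S, y k ^ r := by
    intro x y
    rw [Finset.sum_mul_sum]; simp_rw [rpm _ _ hr.le]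
  calc _ ≤ ∑ j ∈ S, ∑ k ∈ S, (((tw (j * ε) * min X₁ (tw (j * -(s - 1)) * Y₁)) * (tw (k * (s - 1 - ε)) * min X₂ (tw (k * -(s - 1)) * Y₂))) ^ r +
        ((tw (j * (s - 1 - ε)) * min X₁ (tw (j * -(s - 1)) * Y₁)) * (tw (k * ε) * min X₂ (tw (k * -(s - 1)) * Y₂))) ^ r) := by
        refine Finset.sum_le_sum fun j _ => Finset.sum_le_sum fun k _ =>
          le_trans (le_of_eq ?_) (ENNReal.rpow_add_le_add_rpow _ _ hr.le hr1)
        rw [Ew, ← hε, tw_add, tw_add]; congr 1; ring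
    _ ≤ (C * (X₁ ^ (1 - ε / (s - 1)) * Y₁ ^ (ε / (s - 1))) ^ r) * (C' * (X₂ ^ (ε / (s - 1)) * Y₂ ^ (1 - ε / (s - 1))) ^ r) +
        (C' * (X₁ ^ (ε / (s - 1)) * Y₁ ^ (1 - ε / (s - 1))) ^ r) * (C * (X₂ ^ (1 - ε / (s - 1)) * Y₂ ^ (ε / (s - 1))) ^ r) := by
        simp_rw [Finset.sum_add_distrib]
        rw [st (fun j => tw (j * ε) * min X₁ (tw (j * -(s - 1)) * Y₁)) fun k => tw (k * (s - 1 - ε)) * min X₂ (tw (k * -(s - 1)) * Y₂),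
          st (fun j => tw (j * (s - 1 - ε)) * min X₁ (tw (j * -(s - 1)) * Y₁)) fun k => tw (k * ε) * min X₂ (tw (k * -(s - 1)) * Y₂)]
        exact add_le_add (mul_le_mul' p1 p2) (mul_le_mul' p3 p4)
    _ = C * C' * (X₁ ^ (1 - ε / (s - 1)) * Y₁ ^ (ε / (s - 1)) * (X₂ ^ (ε / (s - 1)) * Y₂ ^ (1 - ε / (s - 1)))) ^ r +
        C' * C * (Y₁ ^ (1 - ε / (s - 1)) * X₁ ^ (ε / (s - 1)) * (Y₂ ^ (ε / (s - 1)) * X₂ ^ (1 - ε / (s - 1)))) ^ r := by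
        simp_rw [rpm _ _ hr.le]; ring
    _ ≤ C * C' * (X₁ * Y₂ + Y₁ * X₂) ^ r + C' * C * (X₁ * Y₂ + Y₁ * X₂) ^ r := by
        rw [add_comm (Y₁ * X₂)] at i2
        exact add_le_add (mul_le_mul_right (rpl i1 hr.le) _) (mul_le_mul_right (rpl i2 hr.le) _)
    _ ≤ _ := by rw [add_mul, add_mul]; exact le_self_add
end KP

namespace KP
open Set Filter Topology FourierTransform
variable {n : ℕ}

lemma Wmin {p : ℝ≥0∞} (hp : 1 ≤ p) {b m : ℝ} (hb : 0 ≤ b) (hm : n + b < m) : ∃ C : ℝ≥0∞, C ≠ ∞ ∧ ∀ (j : ℕ) (t : ℝ) (F G : Eu n → ℝ≥0∞),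
    Measurable F → Measurable G → Wn p b (fun x => min (Av j m F x) (tw t * Av j m G x)) ≤
      min (C * Wn p b F) (tw t * (C * Wn p b G)) := by
  obtain ⟨C, hC, h⟩ := Av_lp hb hm
  refine ⟨C, hC, fun j t F G hF hG => le_min ?_ ?_⟩
  · exact (Wn_mono p b fun x => min_le_left _ _).trans (h p hp j F hF)
  · exact (Wn_mono p b fun x => min_le_right _ _).trans ((Wn_cmul p b (tw_net t) _).trans (mul_le_mul_right (h p hp j G hG) _))

lemma Bil_meas {M : Eu n × Eu n → ℂ} (hM : Continuous M) (u v : Sw n) : Measurable (Bil M u v) := by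
  have hu := (𝓕 u).continuous
  have hv := (𝓕 v).continuous
  have : Continuous fun z : Eu n × (Eu n × Eu n) => M z.2 * (ee ⟪z.2.1 + z.2.2, z.1⟫ * ((𝓕 u) z.2.1 * (𝓕 v) z.2.2)) := by
    have := ee_cont; fun_prop
  exact (this.stronglyMeasurable.integral_prod_right' (ν := volume)).measurable

lemma Rj_meas (s : ℝ) (j k : ℕ) (f g : Sw n) : Measurable fun x => ‖Rj s j k f g x‖ₑ :=
  (Bil_meas ((gr_pc j k).mul (gr_mu s j)).1 f g).enorm

def XY (p₁ p₂ : ℝ≥0∞) (b₁ b₂ s : ℝ) (f g : Sw n) : ℝ≥0∞ :=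
  Wn p₁ b₁ (gs f) * Wn p₂ b₂ (fun x => ‖Fm (bc (s - 1)) g x‖ₑ) + Wn p₁ b₁ (fun x => ‖Fm (bc s) f x‖ₑ) * Wn p₂ b₂ (fun x => ‖g x‖ₑ)

lemma SUM {p r b₁ b₂ s : ℝ} {p₁ p₂ : ℝ≥0∞} (hr : 0 < r) (hr1 : r ≤ 1) (hrp : r ≤ p) (hb₁ : 0 ≤ b₁) (hb₂ : 0 ≤ b₂) (hs : 1 < s)
    (hδ : n * (1 - r) < s * r) (h1 : 1 ≤ p₁) (h2 : 1 ≤ p₂) (h2' : p₂ ≠ ∞)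
    (hexp : 1 / ENNReal.ofReal p = 1 / p₁ + 1 / p₂) : ∃ C : ℝ≥0∞, C ≠ ∞ ∧ ∀ (f g : Sw n) (S : Finset ℕ),
      Wn (ENNReal.ofReal p) (b₁ + b₂) (fun x => ∑ j ∈ S, ∑ k ∈ S, ‖Rj s j k f g x‖ₑ) ^ r ≤ C * XY p₁ p₂ b₁ b₂ s f g ^ r := by
  have hp := hr.trans_le hrp
  obtain ⟨m, hm1, hm2⟩ : ∃ m : ℝ, n + b₁ < m ∧ n + b₂ < m := ⟨n + b₁ + b₂ + 1, by linarith, by linarith⟩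
  have hm : 0 ≤ m := by have : (0:ℝ) ≤ n := Nat.cast_nonneg n
                        linarith
  obtain ⟨C, hC, rb⟩ := RB (n := n) (p := p) hr hr1 hrp (add_nonneg hb₁ hb₂) hm hs hδ
  obtain ⟨D, hD, hd⟩ := Wmin h1 hb₁ hm1
  obtain ⟨E, hE, he⟩ := Wmin h2 hb₂ hm2
  obtain ⟨G, hG, geo⟩ := geo2 hs hr hr1
  refine ⟨C * (G * (D * E) ^ r), ENNReal.mul_ne_top hC (ENNReal.mul_ne_top hG (rp_ne (ENNReal.mul_ne_top hD hE) hr.le)), fun f g S => ?_⟩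
  refine (Wn_sum_r hr hr1 hrp _ S fun j => Finset.measurable_sum S fun k _ => Rj_meas s j k f g).trans ?_
  calc _ ≤ ∑ j ∈ S, ∑ k ∈ S, C * (Ew s j k * (min (D * Wn p₁ b₁ (gs f)) (tw (j * -(s - 1)) * (D * Wn p₁ b₁ (fun x => ‖Fm (bc s) f x‖ₑ))) *
        min (E * Wn p₂ b₂ (fun x => ‖g x‖ₑ)) (tw (k * -(s - 1)) * (E * Wn p₂ b₂ (fun x => ‖Fm (bc (s - 1)) g x‖ₑ))))) ^ r := by
        refine Finset.sum_le_sum fun j _ => (Wn_sum_r hr hr1 hrp _ S fun k => Rj_meas s j k f g).trans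
          (Finset.sum_le_sum fun k _ => (rb j k f g).trans ?_)
        refine mul_le_mul_right (rpl (mul_le_mul_right ?_ _) hr.le) _
        refine (Wn_holder (by simpa using hp) (zero_lt_one.trans_le h1).ne' (zero_lt_one.trans_le h2).ne' h2' hexp b₁ b₂
          (Pf_meas m s f j) (Pg_meas m s g k)).trans ?_
        rw [neg_sub]
        exact mul_le_mul' (hd j _ _ _ (gs_meas f) (sm_meas _)) (he k _ _ _ (sm_meas g) (sm_meas _))
    _ ≤ C * (G * (D * E * XY p₁ p₂ b₁ b₂ s f g) ^ r) := by
        simp_rw [← Finset.mul_sum]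
        refine mul_le_mul_right ((geo _ _ _ _ S).trans (le_of_eq ?_)) _
        rw [XY]; congr 2; ring
    _ = _ := by rw [rpm _ _ hr.le]; ring

lemma Wn_sup {p : ℝ} (hp : 0 < p) (b : ℝ) {u : Eu n → ℝ≥0∞} {v : ℕ → Eu n → ℝ≥0∞} {B : ℝ≥0∞} (hv : ∀ J, Measurable (v J))
    (mono : Monotone v) (hu : ∀ x, u x ≤ ⨆ J, v J x) (h : ∀ J, Wn (ENNReal.ofReal p) b (v J) ≤ B) :
    Wn (ENNReal.ofReal p) b u ≤ B := by
  refine (Wn_mono _ _ hu).trans ?_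
  rw [Wn_fin hp]
  have e : ∀ x, (we b x * ⨆ J, v J x) ^ p = ⨆ J, (we b x * v J x) ^ p := fun x => by
    rw [ENNReal.mul_iSup]; exact (ENNReal.orderIsoRpow p hp).map_iSup _
  simp_rw [e]
  rw [lintegral_iSup (f := fun J x => (we b x * v J x) ^ p) (fun J => by have := hv J; fun_prop)
    (fun i j hij x => rpl (mul_le_mul_right (mono hij x) _) hp.le)]
  rw [one_div, ENNReal.rpow_inv_le_iff hp]
  refine iSup_le fun J => ?_
  have := h J
  rwa [Wn_fin hp, one_div, ENNReal.rpow_inv_le_iff hp] at this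

def Rt (s : ℝ) (f g : Sw n) (x : Eu n) : ℂ :=
  Bil (fun w => (m0 s w.1 w.2 : ℂ) + (-1) * ((1 + (-1) * pc 0 w.1) * bc s w.1)) f g x

lemma phj_ev (ζ : Eu n) : ∀ᶠ J in atTop, phj J ζ = 1 := by
  obtain ⟨N, hN⟩ := pow_unbounded_of_one_lt ‖ζ‖ (one_lt_two (α := ℝ))
  filter_upwards [eventually_ge_atTop N] with J hJ
  refine ph_one ?_
  rw [nsm, inv_mul_le_iff₀ (by positivity), mul_one]
  exact hN.le.trans (pow_le_pow_right₀ one_le_two hJ)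

def MJ (s : ℝ) (J : ℕ) (w : Eu n × Eu n) : ℂ :=
  (phj J w.2 : ℂ) * (phj J w.1 * (m0 s w.1 w.2 : ℂ) + (-1) * ((phj J w.1 + (-1) * pc 0 w.1) * bc s w.1))

lemma MJ_eq (s : ℝ) (J : ℕ) (w : Eu n × Eu n) : ∑ j ∈ Finset.range (J + 1), ∑ k ∈ Finset.range (J + 1), pc j w.1 * pc k w.2 * mu s j w = MJ s J w := by
  have : ∀ j, ∑ k ∈ Finset.range (J + 1), pc j w.1 * pc k w.2 * mu s j w = phj J w.2 * (pc j w.1 * mu s j w) := by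
    intro j; rw [← pc_sum, Finset.sum_mul]; exact Finset.sum_congr rfl fun k _ => by ring
  simp_rw [this, ← Finset.mul_sum]
  rw [MJ]
  congr 1
  have h2 : ∀ j, pc j w.1 * mu s j w = pc j w.1 * ((m0 s w.1 w.2 : ℂ) + (-1) * bc s w.1) + if j = 0 then pc 0 w.1 * bc s w.1 else 0 := by
    intro j; rw [mu]; split_ifs with h
    · subst h; ring
    · ring
  simp_rw [h2]
  rw [Finset.sum_add_distrib, ← Finset.sum_mul, pc_sum, Finset.sum_ite_eq' _ 0 fun _ => pc 0 w.1 * bc s w.1]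
  simp only [Finset.mem_range, Nat.succ_pos, if_true]; ring

lemma MJ_sum (s : ℝ) (J : ℕ) (f g : Sw n) (x : Eu n) : ∑ j ∈ Finset.range (J + 1), ∑ k ∈ Finset.range (J + 1), Rj s j k f g x =
    Bil (MJ s J) f g x := by
  have gm := fun j k => (gr_pc (n := n) j k).mul (gr_mu s j)
  have e1 : ∀ j, ∑ k ∈ Finset.range (J + 1), Rj s j k f g x =
      Bil (fun w => ∑ k ∈ Finset.range (J + 1), pc j w.1 * pc k w.2 * mu s j w) f g x := fun j => (bil_sum _ (gm j) f g x).symm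
  rw [Finset.sum_congr rfl fun j _ => e1 j, ← bil_sum _ (fun j => Gr.sum _ (gm j)) f g x]
  congr 1; ext w; exact MJ_eq s J w

lemma MJ_cont (s : ℝ) (J : ℕ) : Continuous (MJ (n := n) s J) := by
  have c1 : Continuous fun w : Eu n × Eu n => w.1 := continuous_fst
  have c2 : Continuous fun w : Eu n × Eu n => w.2 := continuous_snd
  have a1 := (gr_m0 (n := n) s).1
  have a2 := (tg_cd (bc_tg (n := n) s)).continuous.comp c1
  have a3 := (pc_cd (n := n) 0).continuous.comp c1
  have a4 : Continuous (phj (n := n) J) := ph_cd.continuous.comp (continuous_const_smul _)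
  have b1 := Complex.continuous_ofReal.comp (a4.comp c1)
  have b2 := Complex.continuous_ofReal.comp (a4.comp c2)
  exact b2.mul ((b1.mul a1).add (continuous_const.mul ((b1.add (continuous_const.mul a3)).mul a2)))

lemma MJ_le (s : ℝ) (J : ℕ) (w : Eu n × Eu n) : ‖MJ s J w‖ ≤ ‖(m0 s w.1 w.2 : ℂ)‖ + 2 * ‖bc s w.1‖ := by
  have pn : ∀ J (ζ : Eu n), ‖(phj J ζ : ℂ)‖ ≤ 1 := fun J ζ => by
    rw [Complex.norm_real, phj, Real.norm_of_nonneg (ph_nn _)]; exact ph_le _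
  have h0 : ‖(phj J w.1 : ℂ) + (-1) * pc 0 w.1‖ ≤ 2 := by
    have := pn 0 w.1
    rw [← pc_sum, Finset.sum_range_one] at this
    refine (norm_add_le _ _).trans ?_
    rw [norm_mul, norm_neg, norm_one, one_mul]; linarith [pn J w.1]
  rw [MJ, norm_mul]
  refine (mul_le_of_le_one_left (norm_nonneg _) (pn J _)).trans ((norm_add_le _ _).trans ?_)
  rw [norm_mul, norm_mul, norm_mul _ (bc s w.1), norm_neg, norm_one, one_mul]
  exact add_le_add (mul_le_of_le_one_left (norm_nonneg _) (pn J _)) (mul_le_mul_of_nonneg_right h0 (norm_nonneg _))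

lemma Rt_lim (s : ℝ) (f g : Sw n) (x : Eu n) : Tendsto (fun J : ℕ => ∑ j ∈ Finset.range (J + 1),
    ∑ k ∈ Finset.range (J + 1), Rj s j k f g x) atTop (𝓝 (Rt s f g x)) := by
  simp only [MJ_sum]
  let K : Eu n × Eu n → ℂ := fun w => ee ⟪w.1 + w.2, x⟫ * ((𝓕 f) w.1 * (𝓕 g) w.2)
  have hK : Continuous K := by
    have h1 := (𝓕 f).continuous.comp (continuous_fst (X := Eu n) (Y := Eu n))
    have h2 := (𝓕 g).continuous.comp (continuous_snd (X := Eu n) (Y := Eu n))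
    have h3 : Continuous fun w : Eu n × Eu n => ⟪w.1 + w.2, x⟫ := by fun_prop
    exact (ee_cont.comp h3).mul (h1.mul h2)
  have g1 : Integrable fun w => (m0 s w.1 w.2 : ℂ) * K w := (gr_m0 (n := n) s).int f g x
  have g2 : Integrable fun w => bc s w.1 * K w := ((Gr.tg (bc_tg (n := n) s)).1).int f g x
  refine tendsto_integral_of_dominated_convergence (F := fun J w => MJ s J w * K w)
    (f := fun w => ((m0 s w.1 w.2 : ℂ) + (-1) * ((1 + (-1) * pc 0 w.1) * bc s w.1)) * K w)
    (fun w => ‖(m0 s w.1 w.2 : ℂ) * K w‖ + 2 * ‖bc s w.1 * K w‖) (fun J => ((MJ_cont s J).mul hK).aestronglyMeasurable)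
    (g1.norm.add (g2.norm.const_mul 2)) (fun J => ae_of_all _ fun w => ?_) (ae_of_all _ fun w => ?_)
  · rw [norm_mul, norm_mul (m0 s w.1 w.2 : ℂ), norm_mul (bc s w.1), ← mul_assoc, ← add_mul]
    exact mul_le_mul_of_nonneg_right (MJ_le s J w) (norm_nonneg _)
  · refine tendsto_const_nhds.congr' ?_
    filter_upwards [phj_ev w.1, phj_ev w.2] with J h1 h2
    rw [MJ, h1, h2, Complex.ofReal_one, one_mul, one_mul]

lemma Rt_bd {p r b₁ b₂ s : ℝ} {p₁ p₂ : ℝ≥0∞} (hr : 0 < r) (hr1 : r ≤ 1) (hrp : r ≤ p) (hb₁ : 0 ≤ b₁) (hb₂ : 0 ≤ b₂) (hs : 1 < s)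
    (hδ : n * (1 - r) < s * r) (h1 : 1 ≤ p₁) (h2 : 1 ≤ p₂) (h2' : p₂ ≠ ∞)
    (hexp : 1 / ENNReal.ofReal p = 1 / p₁ + 1 / p₂) : ∃ C : ℝ≥0∞, C ≠ ∞ ∧ ∀ (f g : Sw n),
      Wn (ENNReal.ofReal p) (b₁ + b₂) (fun x => ‖Rt s f g x‖ₑ) ≤ C * XY p₁ p₂ b₁ b₂ s f g := by
  obtain ⟨C, hC, h⟩ := SUM (n := n) hr hr1 hrp hb₁ hb₂ hs hδ h1 h2 h2' hexp
  refine ⟨C ^ r⁻¹, rp_ne hC (by positivity), fun f g => ?_⟩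
  refine Wn_sup (hr.trans_le hrp) _ (v := fun J x => ∑ j ∈ Finset.range (J + 1), ∑ k ∈ Finset.range (J + 1), ‖Rj s j k f g x‖ₑ)
    (fun J => Finset.measurable_sum _ fun j _ => Finset.measurable_sum _ fun k _ => Rj_meas s j k f g) ?_ ?_ fun J => ?_
  · intro i j hij x
    have : Finset.range (i + 1) ⊆ Finset.range (j + 1) := Finset.range_subset_range.2 (by omega)
    exact (Finset.sum_le_sum fun _ _ => Finset.sum_le_sum_of_subset this).trans (Finset.sum_le_sum_of_subset this)
  · intro x
    refine le_of_tendsto' (Rt_lim s f g x).enorm fun J => ?_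
    refine le_trans ?_ (le_iSup _ J)
    exact (enorm_sum_le _ _).trans (Finset.sum_le_sum fun j _ => enorm_sum_le _ _)
  · have := h f g (Finset.range (J + 1))
    rw [← ENNReal.le_rpow_inv_iff hr, rpm _ _ (by positivity), ← ENNReal.rpow_mul, mul_inv_cancel₀ hr.ne',
      ENNReal.rpow_one] at this
    exact this
end KP

namespace KP
open Set Filter Topology FourierTransform
variable {n : ℕ}

lemma fm_int {m : Eu n → ℂ} (hm : m.HasTemperateGrowth) (f : Sw n) (x : Eu n) :
    ∫ ζ, m ζ * (ee ⟪ζ, x⟫ * (𝓕 f) ζ) = Fm m f x := by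
  rw [Fm_apply hm]; congr 1; ext ζ; ring
lemma one_int (f : Sw n) (x : Eu n) : ∫ ζ, (1:ℂ) * (ee ⟪ζ, x⟫ * (𝓕 f) ζ) = f x := by
  simp only [one_mul]; exact (self_apply f x).symm

lemma rz_bc (s : ℝ) (l : Fin n) (ζ : Eu n) : cl l ζ * bc (s - 2) ζ = rz l ζ * bc (s - 1) ζ := by
  have h := bc_mul (-1) (s - 1) ζ
  rw [show -1 + (s - 1) = s - 2 by ring] at h
  rw [← h, cl, rz, bc, bc]; push_cast; ring

lemma Dl (s : ℝ) (l : Fin n) (g : Sw n) (x : Eu n) :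
    ∫ ζ, (cl l ζ * bc (s - 2) ζ) * (ee ⟪ζ, x⟫ * (𝓕 g) ζ) = Fm (rz l) (Fm (bc (s - 1)) g) x := by
  rw [Fm_apply (rz_tg l)]; congr 1; ext ζ; rw [Fm_hat (bc_tg _), rz_bc]; ring

lemma comm_eq (s : ℝ) (f g : Sw n) (x : Eu n) : Fm (bc s) (pm f g) x - f x * Fm (bc s) g x =
    Rt s f g x + ((Fm (bc s) f x - T 0 (fun _ => 1) (Fm (bc s) f) x) * g x +
      ∑ l, (-s : ℂ) * (Fm (cl l) f x * Fm (rz l) (Fm (bc (s - 1)) g) x)) := by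
  have tb := Gr.tg (bc_tg (n := n) s)
  have gA := tb.2.2
  have gp : Gr fun w : Eu n × Eu n => pc 0 w.1 := (Gr.tg (by simpa using pcP_tg (n := n) 0 c1_cd)).1
  have gB : Gr fun w : Eu n × Eu n => 1 * bc s w.2 := (Gr.const 1).mul tb.2.1
  have gS : ∀ l : Fin n, Gr fun w : Eu n × Eu n => (s:ℂ) * (cl l w.1 * (cl l w.2 * bc (s - 2) w.2)) := fun l =>
    (Gr.const _).mul ((Gr.tg (cl_tg l)).1.mul ((Gr.tg (cl_tg l)).2.1.mul (Gr.tg (bc_tg _)).2.1))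
  have gE : Gr fun w : Eu n × Eu n => bc s w.1 * 1 := tb.1.mul (Gr.const 1)
  have gF : Gr fun w : Eu n × Eu n => pc 0 w.1 * bc s w.1 * 1 := (gp.mul tb.1).mul (Gr.const 1)
  have e : Rt s f g x = Bil (fun w => (((bc s (w.1 + w.2) + (-1) * (1 * bc s w.2)) +
      ∑ l, (s:ℂ) * (cl l w.1 * (cl l w.2 * bc (s - 2) w.2))) + (-1) * (bc s w.1 * 1)) + pc 0 w.1 * bc s w.1 * 1) f g x := by
    rw [Rt]; congr 1; ext w; rw [m0c]; ring
  have g1 := (gA.add ((Gr.const (-1)).mul gB))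
  have g2 := g1.add (Gr.sum Finset.univ gS)
  have g3 := g2.add ((Gr.const (-1)).mul gE)
  rw [e, bil_add g3 gF, bil_add g2 ((Gr.const (-1)).mul gE), bil_add g1 (Gr.sum Finset.univ gS), bil_add gA ((Gr.const (-1)).mul gB),
    bil_cmul (-1) (fun w => 1 * bc s w.2), bil_cmul (-1) (fun w => bc s w.1 * 1), bil_sum _ gS, ← bil_pm gA, fm_int (bc_tg s), bil_prod (fun _ => 1) (bc s), bil_prod (bc s) fun _ => 1,
    bil_prod (fun ζ => pc 0 ζ * bc s ζ) fun _ => 1, one_int, one_int, fm_int (bc_tg s), fm_int (bc_tg s)]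
  have h1 : ∀ l : Fin n, Bil (fun w => (s:ℂ) * (cl l w.1 * (cl l w.2 * bc (s - 2) w.2))) f g x =
      s * (Fm (cl l) f x * Fm (rz l) (Fm (bc (s - 1)) g) x) := fun l => by
    rw [bil_cmul, bil_prod (cl l) fun ζ => cl l ζ * bc (s - 2) ζ, fm_int (cl_tg l), Dl]
  have h2 : ∫ ζ, pc 0 ζ * bc s ζ * (ee ⟪ζ, x⟫ * (𝓕 f) ζ) = T 0 (fun _ => 1) (Fm (bc s) f) x :=
    T_tr 0 (bc_tg s) (P := bc s) (fun ζ => (one_mul _).symm) f x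
  simp_rw [h1, h2, ← Finset.mul_sum]
  ring

lemma D_bd {p₂ : ℝ≥0∞} (h2 : 1 < p₂) (h2' : p₂ ≠ ∞) {b : ℝ} (hb : 0 ≤ b) (l : Fin n) : ∃ C : ℝ≥0∞, C ≠ ∞ ∧ ∀ h : Sw n,
    Wn p₂ b (fun x => ‖Fm (rz l) h x‖ₑ) ≤ C * Wn p₂ b (fun x => ‖h x‖ₑ) := by
  have hp : 1 < p₂.toReal := by
    rw [← ENNReal.toReal_one]; exact (ENNReal.toReal_lt_toReal ENNReal.one_ne_top h2').2 h2
  have hp0 := zero_lt_one.trans hp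
  obtain ⟨C, hC, H⟩ := riesz_wlp l hp hb
  refine ⟨C ^ (1 / p₂.toReal), rp_ne hC (by positivity), fun h => ?_⟩
  have e : ∀ u : Sw n, Wn p₂ b (fun x => ‖u x‖ₑ) = (∫⁻ x, ‖(jw b x : ℂ) * u x‖ₑ ^ p₂.toReal) ^ (1 / p₂.toReal) := fun u => by
    rw [← ENNReal.ofReal_toReal h2', Wn_fin hp0, ENNReal.toReal_ofReal hp0.le]
    simp_rw [enorm_mul, we]
    congr 2; ext x; congr 2
    rw [← ofReal_norm, Complex.norm_real, Real.norm_of_nonneg (jw_pos b x).le]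
  rw [e, e, ← rpm _ _ (by positivity)]
  exact rpl (H h) (by positivity)

lemma T_bd {b m : ℝ} (hb : 0 ≤ b) (hm : n + b < m) : ∃ C : ℝ≥0∞, C ≠ ∞ ∧ ∀ (p : ℝ≥0∞), 1 ≤ p → ∀ F : Sw n,
    Wn p b (fun x => ‖T 0 (fun _ => 1) F x‖ₑ) ≤ C * Wn p b (fun x => ‖F x‖ₑ) := by
  obtain ⟨C, hC, h⟩ := LIN0 (n := n) c1_cd m
  obtain ⟨D, hD, h'⟩ := Av_lp hb hm
  refine ⟨C * D, ENNReal.mul_ne_top hC hD, fun p hp F => ?_⟩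
  refine (Wn_mono p b (h F)).trans ((Wn_cmul p b hC _).trans ?_)
  rw [mul_assoc]
  exact mul_le_mul_right (h' p hp 0 _ (sm_meas F)) _

lemma T_meas (F : Sw n) : Measurable fun x => ‖T 0 (fun _ => 1) F x‖ₑ := by
  simp_rw [T_Fm 0 c1_cd F]; exact sm_meas _

lemma MAIN {p r b₁ b₂ s : ℝ} {p₁ p₂ : ℝ≥0∞} (hr : 0 < r) (hr1 : r ≤ 1) (hrp : r ≤ p) (hb₁ : 0 ≤ b₁) (hb₂ : 0 ≤ b₂) (hs : 1 < s)
    (hδ : n * (1 - r) < s * r) (h1 : 1 ≤ p₁) (h2 : 1 < p₂) (h2' : p₂ ≠ ∞)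
    (hexp : 1 / ENNReal.ofReal p = 1 / p₁ + 1 / p₂) : ∃ C : ℝ≥0∞, C ≠ ∞ ∧ ∀ (f g : Sw n),
      Wn (ENNReal.ofReal p) (b₁ + b₂) (fun x => ‖Fm (bc s) (pm f g) x - f x * Fm (bc s) g x‖ₑ) ≤ C * XY p₁ p₂ b₁ b₂ s f g := by
  have hp := hr.trans_le hrp
  obtain ⟨A, hA, ha⟩ := Rt_bd (n := n) hr hr1 hrp hb₁ hb₂ hs hδ h1 h2.le h2' hexp
  choose D hD hd using fun l : Fin n => D_bd (n := n) h2 h2' hb₂ l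
  obtain ⟨B, hB, hb⟩ := T_bd (n := n) (m := n + b₁ + 1) hb₁ (by linarith)
  have hol : ∀ {u v : Eu n → ℝ≥0∞}, Measurable u → Measurable v → Wn (ENNReal.ofReal p) (b₁ + b₂) (fun x => u x * v x) ≤
      Wn p₁ b₁ u * Wn p₂ b₂ v := fun hu hv => Wn_holder (by simpa using hp) (zero_lt_one.trans_le h1).ne' (zero_lt_one.trans h2).ne' h2' hexp b₁ b₂ hu hv
  set c : ℝ≥0∞ := ‖(-s : ℂ)‖ₑ with hc
  have hct : c ≠ ∞ := enorm_ne_top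
  set K : ℝ≥0∞ := A ^ r + (1 + (B ^ r + ∑ l, (c * D l) ^ r)) with hK
  have hKt : K ≠ ∞ := by
    simp only [hK, ne_eq, ENNReal.add_eq_top, ENNReal.sum_eq_top, not_or, not_exists, not_and]
    exact ⟨rp_ne hA hr.le, ENNReal.one_ne_top, rp_ne hB hr.le, fun l _ => rp_ne (ENNReal.mul_ne_top hct (hD l)) hr.le⟩
  refine ⟨K ^ r⁻¹, rp_ne hKt (by positivity), fun f g => ?_⟩
  set X := XY p₁ p₂ b₁ b₂ s f g with hX
  have m1 : Measurable fun x => ‖Rt s f g x‖ₑ := by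
    have tb := Gr.tg (bc_tg (n := n) s)
    have gp : Gr fun w : Eu n × Eu n => pc 0 w.1 := (Gr.tg (by simpa using pcP_tg (n := n) 0 c1_cd)).1
    exact (Bil_meas ((gr_m0 (n := n) s).add ((Gr.const (-1)).mul (((Gr.const 1).add ((Gr.const (-1)).mul gp)).mul tb.1))).1 f g).enorm
  have m2 := (sm_meas (Fm (bc s) f)).mul (sm_meas g)
  have m3 := (T_meas (Fm (bc s) f)).mul (sm_meas g)
  have m4 : ∀ l : Fin n, Measurable fun x => c * (gs f x * ‖Fm (rz l) (Fm (bc (s - 1)) g) x‖ₑ) := fun l =>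
    ((gs_meas f).mul (sm_meas _)).const_mul c
  have m5 := Finset.measurable_sum Finset.univ fun l _ => m4 l
  have pw : ∀ x, ‖Fm (bc s) (pm f g) x - f x * Fm (bc s) g x‖ₑ ≤ ‖Rt s f g x‖ₑ + (‖Fm (bc s) f x‖ₑ * ‖g x‖ₑ +
      (‖T 0 (fun _ => 1) (Fm (bc s) f) x‖ₑ * ‖g x‖ₑ + ∑ l, c * (gs f x * ‖Fm (rz l) (Fm (bc (s - 1)) g) x‖ₑ))) := fun x => by
    rw [comm_eq]
    refine (enorm_add_le _ _).trans (add_le_add le_rfl ((enorm_add_le _ _).trans ?_))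
    rw [← add_assoc, ← add_mul, enorm_mul]
    refine add_le_add (mul_le_mul_left enorm_sub_le _) ((enorm_sum_le _ _).trans (Finset.sum_le_sum fun l _ => ?_))
    rw [enorm_mul, enorm_mul]
    exact mul_le_mul_right (mul_le_mul_left (le_gs f l x) _) _
  rw [← ENNReal.rpow_le_rpow_iff hr, rpm _ _ hr.le, ← ENNReal.rpow_mul, inv_mul_cancel₀ hr.ne', ENNReal.rpow_one]
  refine (rpl (Wn_mono _ _ pw) hr.le).trans ?_
  refine (Wn_add_r hr hr1 hrp _ m1 (m2.add (m3.add m5))).trans ?_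
  rw [hK, add_mul, add_mul, add_mul, Finset.sum_mul, one_mul]
  have up : ∀ {Y k : ℝ≥0∞}, Y ≤ k * X → Y ^ r ≤ k ^ r * X ^ r := fun h => by
    rw [← rpm _ _ hr.le]; exact rpl h hr.le
  refine add_le_add (up (ha f g)) ((Wn_add_r hr hr1 hrp _ m2 (m3.add m5)).trans (add_le_add ?_
    ((Wn_add_r hr hr1 hrp _ m3 m5).trans (add_le_add (up ?_) ((Wn_sum_r hr hr1 hrp _ _ m4).trans (Finset.sum_le_sum fun l _ => up ?_))))))
  · exact rpl ((hol (sm_meas _) (sm_meas _)).trans le_add_self) hr.le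
  · refine (hol (T_meas _) (sm_meas g)).trans ((mul_le_mul_left (hb p₁ h1 _) _).trans ?_)
    rw [mul_assoc]; exact mul_le_mul_right le_add_self _
  · refine (Wn_cmul _ _ hct _).trans ?_
    rw [mul_assoc c]
    refine mul_le_mul_right ((hol (gs_meas f) (sm_meas _)).trans ((mul_le_mul_right (hd l _) _).trans ?_)) _
    rw [mul_left_comm]; exact mul_le_mul_right le_self_add _
end KP

namespace KP
open Set Filter Topology FourierTransform
variable {n : ℕ}

lemma FT_eq (f : Sw n) (ζ : Eu n) : FT f ((2 * π) • ζ) = (𝓕 f) ζ := by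
  rw [FT, hat_apply]; congr 1; ext x
  rw [mul_comm, ee, inner_smul_right]; congr 2; push_cast; ring

lemma Js_eq (s : ℝ) (f : Sw n) (x : Eu n) : Js s f x = Fm (bc s) f x := by
  rw [Js, Fm_apply (bc_tg s)]
  have h := Measure.integral_comp_smul (volume : Measure (Eu n)) (fun ξ : Eu n => (((1 + ‖ξ‖ ^ 2) ^ (s / 2) : ℝ) : ℂ) * FT f ξ *
      Complex.exp (Complex.I * ((⟪x, ξ⟫ : ℝ) : ℂ))) (2 * π)
  rw [finrank_euclideanSpace_fin, abs_of_pos (by positivity), Complex.real_smul] at h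
  rw [← h]; congr 1; ext ζ
  rw [FT_eq, bc, bes, ee, real_inner_comm x ζ, inner_smul_right]
  rw [show (((2 * π * ⟪x, ζ⟫ : ℝ)) : ℂ) * I = I * ((2 * π * ⟪x, ζ⟫ : ℝ) : ℂ) from mul_comm _ _]
  ring

lemma cl_eq (l : Fin n) (f : Sw n) (x : Eu n) : Fm (cl l) f x = fderiv ℝ f x (EuclideanSpace.single l 1) := by
  have h := SchwartzMap.lineDeriv_eq_fourierMultiplierCLM (EuclideanSpace.single l (1:ℝ)) f
  have h2 := congrArg (fun u : Sw n => u x) h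
  simp only [SchwartzMap.lineDerivOp_apply_eq_fderiv] at h2
  rw [h2]
  have e : (fun ζ : Eu n => ⟪ζ, EuclideanSpace.single l (1:ℝ)⟫) = fun ζ => ζ l := by
    ext ζ; simp [EuclideanSpace.inner_single_right]
  have e2 : cl l = (2 * π * I : ℂ) • fun ζ : Eu n => ((ζ l : ℝ) : ℂ) := rfl
  rw [e, e2, Fm, SchwartzMap.fourierMultiplierCLM_smul (F := ℂ) (ofReal_tg (coord_tg l)) (2 * π * I : ℂ), ← SchwartzMap.fourierMultiplierCLM_ofReal ℂ (coord_tg l)]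
  rfl

lemma wN_eq {F : Type*} [NormedAddCommGroup F] {p : ℝ≥0∞} (hp : p ≠ 0) (a : ℝ) (u : Eu n → F) :
    wNorm p a u = Wn p (a / p.toReal) (fun x => ‖u x‖ₑ) := by
  rw [wNorm]; split_ifs with h
  · subst h
    rw [Wn_top]; simp [we, jw, enorm_eq_nnnorm]
  · have h0 := ENNReal.toReal_pos hp h
    conv_rhs => rw [← ENNReal.ofReal_toReal h, Wn_fin h0, ENNReal.toReal_ofReal h0.le]
    congr 2; ext x
    rw [rpm _ _ h0.le, ← we_pow, div_mul_cancel₀ _ h0.ne', mul_comm]; rfl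

lemma gs_le (f : Sw n) (x : Eu n) : gs f x ≤ n * ‖gradNorm f x‖ₑ := by
  rw [gs]
  refine (Finset.sum_le_sum fun l _ => ?_).trans_eq (by rw [Finset.sum_const, Finset.card_univ, Fintype.card_fin, nsmul_eq_mul])
  rw [cl_eq, enorm_le_iff_norm_le, gradNorm, Real.norm_of_nonneg (Real.sqrt_nonneg _)]
  refine Real.le_sqrt_of_sq_le ?_
  exact Finset.single_le_sum (f := fun j => ‖fderiv ℝ f x (EuclideanSpace.single j 1)‖ ^ 2) (fun _ _ => by positivity) (Finset.mem_univ l)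

end KP

/-- **Corollary 1.3: the first-form commutator estimate for `s > max{1, n(1/p−1)}`,
`s ∉ 2ℕ`, under the Muckenhoupt-type restriction `a₂ ≤ n(p₂−1)`.** -/
theorem weighted_kato_ponce_commutator_cor (n : ℕ) (hn : 1 ≤ n) (p p₁ p₂ : ℝ≥0∞)
    (a a₁ a₂ s : ℝ)
    (hp : 2⁻¹ < p) (hpfin : p < ∞) (hp1 : 1 ≤ p₁) (hp2 : 1 < p₂) (hp2fin : p₂ < ∞)
    (ha1 : 0 ≤ a₁) (ha2 : 0 ≤ a₂) (ha2' : a₂ ≤ (n : ℝ) * (p₂.toReal - 1))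
    (hexp : 1 / p = 1 / p₁ + 1 / p₂)
    (hwexp : ENNReal.ofReal a / p = ENNReal.ofReal a₁ / p₁ + ENNReal.ofReal a₂ / p₂)
    (hs : max 1 ((n : ℝ) * (1 / p.toReal - 1)) < s)
    (hnev : ¬ ∃ m : ℕ, s = 2 * m) :
    ∃ C : ℝ, 0 < C ∧ ∀ f g : SchwartzMap (Eu n) ℂ,
      wNorm p a (fun x => Js s (fun y => f y * g y) x - f x * Js s ⇑g x) ≤
        ENNReal.ofReal C *
          (wNorm p₁ a₁ (Js s ⇑f) * wNorm p₂ a₂ ⇑g +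
            wNorm p₁ a₁ (gradNorm ⇑f) * wNorm p₂ a₂ (Js (s - 1) ⇑g)) := by
  have hp0 : p ≠ 0 := (lt_of_le_of_lt zero_le hp).ne'
  have h10 : p₁ ≠ 0 := (zero_lt_one.trans_le hp1).ne'
  have h20 : p₂ ≠ 0 := (zero_lt_one.trans hp2).ne'
  have hP := ENNReal.toReal_pos hp0 hpfin.ne
  have hs1 := (le_max_left _ _).trans_lt hs
  have hs2 := (le_max_right _ _).trans_lt hs
  set b₁ := a₁ / p₁.toReal with hb₁
  set b₂ := a₂ / p₂.toReal with hb₂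
  have hb₁0 : 0 ≤ b₁ := div_nonneg ha1 ENNReal.toReal_nonneg
  have hb₂0 : 0 ≤ b₂ := div_nonneg ha2 ENNReal.toReal_nonneg
  have hb : a / p.toReal ≤ b₁ + b₂ := by
    have h := congrArg ENNReal.toReal hwexp
    rw [ENNReal.toReal_add (ENNReal.div_ne_top ENNReal.ofReal_ne_top h10) (ENNReal.div_ne_top ENNReal.ofReal_ne_top h20),
      ENNReal.toReal_div, ENNReal.toReal_div, ENNReal.toReal_div, ENNReal.toReal_ofReal ha1, ENNReal.toReal_ofReal ha2] at h
    rw [hb₁, hb₂, ← h]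
    exact div_le_div_of_nonneg_right (ENNReal.toReal_ofReal' (r := a) ▸ le_max_left _ _) hP.le
  have hδ : n * (1 - min 1 p.toReal) < s * min 1 p.toReal := by
    rcases le_total 1 p.toReal with h | h
    · rw [min_eq_left h]; linarith
    · rw [min_eq_right h]
      have := mul_lt_mul_of_pos_right hs2 hP
      calc _ = n * (1 / p.toReal - 1) * p.toReal := by field_simp
        _ < _ := this
  obtain ⟨C, hC, H⟩ := KP.MAIN (n := n) (p := p.toReal) (lt_min one_pos hP) (min_le_left _ _) (min_le_right _ _) hb₁0 hb₂0 hs1 hδ hp1 hp2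
    hp2fin.ne (by rwa [ENNReal.ofReal_toReal hpfin.ne])
  rw [ENNReal.ofReal_toReal hpfin.ne] at H
  have hCn : C * n + C ≠ ∞ := ENNReal.add_ne_top.2 ⟨ENNReal.mul_ne_top hC (ENNReal.natCast_ne_top n), hC⟩
  refine ⟨(C * n + C).toReal + 1, by positivity, fun f g => ?_⟩
  have hCle : C * n + C ≤ ENNReal.ofReal ((C * n + C).toReal + 1) := by
    rw [← ENNReal.ofReal_toReal hCn, ENNReal.toReal_ofReal ENNReal.toReal_nonneg]; exact ENNReal.ofReal_le_ofReal (by linarith)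
  have e : (fun x => Js s (fun y => f y * g y) x - f x * Js s ⇑g x) =
      fun x => KP.Fm (KP.bc s) (KP.pm f g) x - f x * KP.Fm (KP.bc s) g x := by
    ext x; rw [KP.Js_eq s g, ← KP.Js_eq s (KP.pm f g)]; rfl
  have e1 : Js s ⇑f = fun x => KP.Fm (KP.bc s) f x := funext (KP.Js_eq s f)
  have e2 : Js (s - 1) ⇑g = fun x => KP.Fm (KP.bc (s - 1)) g x := funext (KP.Js_eq _ g)
  rw [e, e1, e2, KP.wN_eq hp0, KP.wN_eq h10, KP.wN_eq h10, KP.wN_eq h20, KP.wN_eq h20, ← hb₁, ← hb₂]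
  refine le_trans ?_ ((H f g).trans ?_)
  · refine eLpNorm_mono_enorm fun x => ?_
    simp only [enorm_eq_self]
    refine mul_le_mul_left (ENNReal.ofReal_le_ofReal ?_) _
    rw [KP.jw, KP.jw]
    exact Real.rpow_le_rpow_of_exponent_le (by nlinarith [sq_nonneg ‖x‖]) (by linarith)
  · refine le_trans ?_ (mul_le_mul_left hCle _)
    have hg : KP.Wn p₁ b₁ (KP.gs f) ≤ n * KP.Wn p₁ b₁ fun x => ‖gradNorm (⇑f) x‖ₑ :=
      (KP.Wn_mono p₁ b₁ (KP.gs_le f)).trans (KP.Wn_cmul p₁ b₁ (ENNReal.natCast_ne_top n) _)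
    rw [KP.XY, mul_add, add_comm, mul_add]
    refine add_le_add (mul_le_mul_left le_add_self _) ?_
    refine (mul_le_mul_right (mul_le_mul_left hg _) C).trans ?_
    rw [mul_assoc, ← mul_assoc C]
    exact mul_le_mul_left le_self_add _
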